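/- In the one-boundary setting (ξ₂(t) ≡ X constant and u(X,t) ≠ 0 for all t ∈ [0,T]): if s ∈ (0,T) is an N-moment of w₁(t) := u(ξ₁(t),t), i.e. u(ξ₁(s),s) ≠ 0, then there exists ε > 0 such that on (s−ε, s+ε): Z(t) < ∞ for every t, Z(t) is non-increasing in t, and if u(·,τ) has a multiple zero in I(τ) for some τ ∈ (s−ε, s+ε) then Z(t₁) > Z(t₂) for all t₁, t₂ with s−ε < t₁ < τ < t₂ < s+ε. -/

import Mathlib

open Set

/-- spatial partial derivative `u_x` -/
noncomputable def pdx (u : ℝ → ℝ → ℝ) (x t : ℝ) : ℝ := deriv (fun y => u y t) x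

/-- second spatial partial derivative `u_xx` -/
noncomputable def pdxx (u : ℝ → ℝ → ℝ) (x t : ℝ) : ℝ := deriv (fun y => pdx u y t) x

/-- time partial derivative `u_t` -/
noncomputable def pdt (u : ℝ → ℝ → ℝ) (x t : ℝ) : ℝ := deriv (fun s => u x s) t

/-- the closure of the space-time domain `Ω` -/
def domCl (xi1 xi2 : ℝ → ℝ) (T : ℝ) : Set (ℝ × ℝ) :=
  {p : ℝ × ℝ | p.2 ∈ Icc (0:ℝ) T ∧ p.1 ∈ Icc (xi1 p.2) (xi2 p.2)}

/-- the domain together with its lateral boundaries -/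
def domLat (xi1 xi2 : ℝ → ℝ) (T : ℝ) : Set (ℝ × ℝ) :=
  {p : ℝ × ℝ | p.2 ∈ Ioc (0:ℝ) T ∧ p.1 ∈ Icc (xi1 p.2) (xi2 p.2)}

/-- `u` is a classical solution of `u_t = a u_xx + b u_x + c u` on
`Ω = {(x,t) : ξ₁(t) < x < ξ₂(t), 0 < t ≤ T}`: it is continuous on the closure, its
partial derivatives `u_t, u_x, u_xx` exist and are continuous up to the lateral
boundaries, and the equation holds. -/
structure IsClassicalSolution (a b c : ℝ → ℝ → ℝ) (xi1 xi2 : ℝ → ℝ) (T : ℝ)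
    (u : ℝ → ℝ → ℝ) : Prop where
  cont : ContinuousOn (fun p : ℝ × ℝ => u p.1 p.2) (domCl xi1 xi2 T)
  diff_x : ∀ p ∈ domLat xi1 xi2 T, DifferentiableAt ℝ (fun y => u y p.2) p.1
  diff_xx : ∀ p ∈ domLat xi1 xi2 T, DifferentiableAt ℝ (fun y => pdx u y p.2) p.1
  diff_t : ∀ p ∈ domLat xi1 xi2 T, DifferentiableAt ℝ (fun s => u p.1 s) p.2
  cont_x : ContinuousOn (fun p : ℝ × ℝ => pdx u p.1 p.2) (domLat xi1 xi2 T)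
  cont_xx : ContinuousOn (fun p : ℝ × ℝ => pdxx u p.1 p.2) (domLat xi1 xi2 T)
  cont_t : ContinuousOn (fun p : ℝ × ℝ => pdt u p.1 p.2) (domLat xi1 xi2 T)
  eqn : ∀ p ∈ domLat xi1 xi2 T,
    pdt u p.1 p.2 =
      a p.1 p.2 * pdxx u p.1 p.2 + b p.1 p.2 * pdx u p.1 p.2 + c p.1 p.2 * u p.1 p.2

/-- the regularity assumption (1.2): `a, a⁻¹, a_t, a_x, a_xx, b, b_t, b_x, c ∈ L^∞`,
with `a > 0` -/
def Reg12 (a b c : ℝ → ℝ → ℝ) (xi1 xi2 : ℝ → ℝ) (T : ℝ) : Prop :=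
  ∃ M : ℝ, ∀ p ∈ domLat xi1 xi2 T,
    0 < a p.1 p.2 ∧
    DifferentiableAt ℝ (fun y => a y p.2) p.1 ∧
    DifferentiableAt ℝ (fun y => pdx a y p.2) p.1 ∧
    DifferentiableAt ℝ (fun s => a p.1 s) p.2 ∧
    DifferentiableAt ℝ (fun y => b y p.2) p.1 ∧
    DifferentiableAt ℝ (fun s => b p.1 s) p.2 ∧
    |a p.1 p.2| ≤ M ∧ |(a p.1 p.2)⁻¹| ≤ M ∧ |pdt a p.1 p.2| ≤ M ∧ |pdx a p.1 p.2| ≤ M ∧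
    |pdxx a p.1 p.2| ≤ M ∧ |b p.1 p.2| ≤ M ∧ |pdt b p.1 p.2| ≤ M ∧ |pdx b p.1 p.2| ≤ M ∧
    |c p.1 p.2| ≤ M

/-- the set of zeroes of `u(·,t)` in `I(t) = [ξ₁(t), ξ₂(t)]` -/
def zeroSet (u : ℝ → ℝ → ℝ) (xi1 xi2 : ℝ → ℝ) (t : ℝ) : Set ℝ :=
  {x ∈ Icc (xi1 t) (xi2 t) | u x t = 0}

/-- `Z(t)`: the (extended-natural) number of zeroes of `u(·,t)` in `I(t)` -/
noncomputable def Znum (u : ℝ → ℝ → ℝ) (xi1 xi2 : ℝ → ℝ) (t : ℝ) : ℕ∞ :=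
  (zeroSet u xi1 xi2 t).encard

/-- `u(·,s)` has a multiple (degenerate) zero in `I(s)` -/
def HasMultipleZero (u : ℝ → ℝ → ℝ) (xi1 xi2 : ℝ → ℝ) (s : ℝ) : Prop :=
  ∃ x₀ ∈ Icc (xi1 s) (xi2 s), u x₀ s = 0 ∧ pdx u x₀ s = 0

/-- the boundary trace `wᵢ(t) := u(ξᵢ(t), t)` -/
def bdryTrace (u : ℝ → ℝ → ℝ) (xi : ℝ → ℝ) : ℝ → ℝ := fun t => u (xi t) t

/-- some left neighborhood of `s` consists entirely of N-moments -/
def leftN (w : ℝ → ℝ) (s : ℝ) : Prop := ∃ ε > 0, ∀ t ∈ Ioo (s - ε) s, w t ≠ 0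

/-- some left neighborhood of `s` consists entirely of Z-moments -/
def leftZ (w : ℝ → ℝ) (s : ℝ) : Prop := ∃ ε > 0, ∀ t ∈ Ioo (s - ε) s, w t = 0

/-- some right neighborhood of `s` consists entirely of N-moments -/
def rightN (w : ℝ → ℝ) (s : ℝ) : Prop := ∃ ε > 0, ∀ t ∈ Ioo s (s + ε), w t ≠ 0

/-- some right neighborhood of `s` consists entirely of Z-moments -/
def rightZ (w : ℝ → ℝ) (s : ℝ) : Prop := ∃ ε > 0, ∀ t ∈ Ioo s (s + ε), w t = 0

/-- `s` is an NZN-moment of `w` -/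
def IsNZN (w : ℝ → ℝ) (s : ℝ) : Prop := w s = 0 ∧ leftN w s ∧ rightN w s

/-- `s` is a ZZZ-moment of `w` -/
def IsZZZ (w : ℝ → ℝ) (s : ℝ) : Prop := w s = 0 ∧ leftZ w s ∧ rightZ w s

/-- `s` is an NZZ-moment of `w` -/
def IsNZZ (w : ℝ → ℝ) (s : ℝ) : Prop := w s = 0 ∧ leftN w s ∧ rightZ w s

/-- `s` is a ZZN-moment of `w` -/
def IsZZN (w : ℝ → ℝ) (s : ℝ) : Prop := w s = 0 ∧ leftZ w s ∧ rightN w s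

/-- `s` is an NZ*-moment of `w` -/
def IsNZstar (w : ℝ → ℝ) (s : ℝ) : Prop := w s = 0 ∧ leftN w s

/-- (H1): on every nondegenerate closed interval of Z-moments of the boundary trace `w`,
the boundary curve `ξ` is `C¹` -/
def H1cond (w xi : ℝ → ℝ) (T : ℝ) : Prop :=
  ∀ p q : ℝ, 0 ≤ p → p < q → q ≤ T → (∀ t ∈ Icc p q, w t = 0) → ContDiffOn ℝ 1 xi (Icc p q)

/-- (H2) at an NZ*-moment `s` of `u(ξ(·),·)`, with sign `σ = (-1)^i`:
`ξ'(s-0)` exists, and `σ · u_x(ξ(s),s) ≥ 0` (resp. `≤ 0`) if `u(ξ(t),t) > 0`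
(resp. `< 0`) shortly before `s`. -/
def H2at (u : ℝ → ℝ → ℝ) (xi : ℝ → ℝ) (σ s : ℝ) : Prop :=
  (∃ L : ℝ, HasDerivWithinAt xi L (Iio s) s) ∧
  ((∃ ε > 0, ∀ t ∈ Ioo (s - ε) s, 0 < u (xi t) t) → 0 ≤ σ * pdx u (xi s) s) ∧
  ((∃ ε > 0, ∀ t ∈ Ioo (s - ε) s, u (xi t) t < 0) → σ * pdx u (xi s) s ≤ 0)

/-- (H3) at a Z-moment `s` of `u(ξ(·),·)`, with sign `σ = (-1)^i`:
`σ · u(ξ(t),t) · u(x,s) ≤ 0` for `t` slightly after `s` and `x ∈ I(s)` near (but not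
equal to) `ξ(s)`. -/
def H3at (u : ℝ → ℝ → ℝ) (xi1 xi2 xi : ℝ → ℝ) (σ s : ℝ) : Prop :=
  ∃ ε > 0, ∃ δ > 0, ∀ t ∈ Ioo s (s + ε), ∀ x ∈ Icc (xi1 s) (xi2 s),
    x ≠ xi s → |x - xi s| < δ → σ * (u (xi t) t * u x s) ≤ 0

/-- (H3) at a Z-moment `s` for the left boundary (`i = 1`, one-boundary setting):
`-u(ξ₁(t),t) · u(x,s) ≤ 0` for `t` slightly after `s` and `x` slightly to the right
of `ξ₁(s)`. -/
def H3one (u : ℝ → ℝ → ℝ) (xi : ℝ → ℝ) (s : ℝ) : Prop :=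
  ∃ ε > 0, ∃ δ > 0, ∀ t ∈ Ioo s (s + ε), ∀ x : ℝ,
    xi s < x → x - xi s < δ → -(u (xi t) t) * u x s ≤ 0


open Set

/-- backward Gaussian weight -/
noncomputable def Eg (x t : ℝ) : ℝ := Real.exp (x ^ 2 / (4 * t))

lemma Eg_pos (x t : ℝ) : 0 < Eg x t := Real.exp_pos _

lemma Eg_cont (t : ℝ) : Continuous (fun x => Eg x t) := by unfold Eg; fun_prop

lemma Eg_le_one {x t : ℝ} (ht : t < 0) : Eg x t ≤ 1 := by
  unfold Eg
  rw [Real.exp_le_one_iff]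
  exact div_nonpos_of_nonneg_of_nonpos (sq_nonneg _) (by linarith)

lemma Eg_dx {t : ℝ} (ht : t < 0) (x : ℝ) :
    HasDerivAt (fun y => Eg y t) (x / (2 * t) * Eg x t) x := by
  unfold Eg
  have h : HasDerivAt (fun y : ℝ => y ^ 2 / (4 * t)) (x / (2 * t)) x := by
    have := (hasDerivAt_pow 2 x).div_const (4 * t)
    refine this.congr_deriv ?_
    have : t ≠ 0 := ht.ne
    field_simp
    ring
  refine h.exp.congr_deriv (by ring)

lemma Eg_dt {t : ℝ} (ht : t < 0) (x : ℝ) :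
    HasDerivAt (fun s => Eg x s) (-(x ^ 2 / (4 * t ^ 2)) * Eg x t) t := by
  unfold Eg
  have h0 : t ≠ 0 := ht.ne
  have h : HasDerivAt (fun s : ℝ => x ^ 2 / (4 * s)) (-(x ^ 2 / (4 * t ^ 2))) t := by
    have := (hasDerivAt_const t (x ^ 2)).div ((hasDerivAt_id t).const_mul 4)
      (by simpa using h0)
    refine this.congr_deriv ?_
    simp only [id]
    field_simp
    ring
  refine h.exp.congr_deriv (by ring)

lemma ibp0 {F F' : ℝ → ℝ} (hF : Continuous F) (hF' : Continuous F')
    (hd : ∀ x ∈ Ioo (-1 : ℝ) 1, HasDerivAt F (F' x) x) (h1 : F 1 = 0) (h2 : F (-1) = 0) :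
    ∫ x in (-1 : ℝ)..1, F' x = 0 := by
  rw [intervalIntegral.integral_eq_sub_of_hasDerivAt_of_le (by norm_num) hF.continuousOn hd
    (hF'.intervalIntegrable _ _), h1, h2, sub_zero]

structure PS (p p1 p2 : ℝ → ℝ) : Prop where
  c0 : Continuous p
  c1 : Continuous p1
  c2 : Continuous p2
  d0 : ∀ x ∈ Ioo (-1 : ℝ) 1, HasDerivAt p (p1 x) x
  d1 : ∀ x ∈ Ioo (-1 : ℝ) 1, HasDerivAt p1 (p2 x) x
  z0 : p 1 = 0
  z0' : p (-1) = 0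
  z1 : p1 1 = 0
  z1' : p1 (-1) = 0

section fixedt
variable {p p1 p2 : ℝ → ℝ} {t : ℝ}

lemma ps_I1 (h : PS p p1 p2) (ht : t < 0) :
    ∫ x in (-1 : ℝ)..1, (p1 x ^ 2 * Eg x t + p x * (p2 x + x / (2 * t) * p1 x) * Eg x t) = 0 := by
  have := h.c0; have := h.c1; have := h.c2; have := Eg_cont t
  apply ibp0 (F := fun x => p x * p1 x * Eg x t) (by fun_prop) (by fun_prop)
  · intro x hx
    refine (((h.d0 x hx).mul (h.d1 x hx)).mul (Eg_dx ht x)).congr_deriv ?_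
    simp only [Pi.mul_apply]; ring
  · simp [h.z0]
  · simp [h.z0']

lemma ps_I2 (h0 : Continuous p) (h1 : Continuous p1)
    (d : ∀ x ∈ Ioo (-1 : ℝ) 1, HasDerivAt p (p1 x) x) (z : p 1 = 0) (z' : p (-1) = 0)
    (ht : t < 0) :
    ∫ x in (-1 : ℝ)..1, (2 * p x * p1 x * (x / (2 * t)) * Eg x t
      + p x ^ 2 * (1 / (2 * t) + x ^ 2 / (4 * t ^ 2)) * Eg x t) = 0 := by
  have := Eg_cont t
  apply ibp0 (F := fun x => p x * p x * (x / (2 * t)) * Eg x t) (by fun_prop) (by fun_prop)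
  · intro x hx
    refine ((((d x hx).mul (d x hx)).mul ((hasDerivAt_id x).div_const (2 * t))).mul
      (Eg_dx ht x)).congr_deriv ?_
    simp only [Pi.mul_apply, id]
    have : t ≠ 0 := ht.ne
    field_simp
    ring
  · simp [z]
  · simp [z']

lemma ps_I4 (h : PS p p1 p2) (ht : t < 0) {A Ax : ℝ → ℝ} (hA : Continuous A)
    (hAx : Continuous Ax) (dA : ∀ x ∈ Ioo (-1 : ℝ) 1, HasDerivAt A (Ax x) x) :
    ∫ x in (-1 : ℝ)..1, (Ax x * p x * p1 x + (A x - 1) * (p1 x ^ 2 + p x * p2 x +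
      x / (2 * t) * p x * p1 x)) * Eg x t = 0 := by
  have := h.c0; have := h.c1; have := h.c2; have := Eg_cont t
  apply ibp0 (F := fun x => (A x - 1) * p x * p1 x * Eg x t) (by fun_prop) (by fun_prop)
  · intro x hx
    refine (((((dA x hx).sub_const 1).mul (h.d0 x hx)).mul (h.d1 x hx)).mul
      (Eg_dx ht x)).congr_deriv ?_
    simp only [Pi.mul_apply]; ring
  · simp [h.z0]
  · simp [h.z0']

end fixedt

/-- cut-off solution -/
structure VS (v vx vxx vt A Ax : ℝ → ℝ → ℝ) (C : ℝ) : Prop where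
  cv : Continuous (fun q : ℝ × ℝ => v q.1 q.2)
  cvx : Continuous (fun q : ℝ × ℝ => vx q.1 q.2)
  cvxx : Continuous (fun q : ℝ × ℝ => vxx q.1 q.2)
  cvt : Continuous (fun q : ℝ × ℝ => vt q.1 q.2)
  cA : ∀ t, Continuous (fun x => A x t)
  cAx : ∀ t, Continuous (fun x => Ax x t)
  ps : ∀ t ∈ Ioo (-1 : ℝ) 0, PS (fun x => v x t) (fun x => vx x t) (fun x => vxx x t)
  dt : ∀ x ∈ Icc (-1 : ℝ) 1, ∀ t ∈ Ioo (-1 : ℝ) 0, HasDerivAt (fun s => v x s) (vt x t) t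
  dA : ∀ x ∈ Ioo (-1 : ℝ) 1, ∀ t ∈ Ioo (-1 : ℝ) 0, HasDerivAt (fun y => A y t) (Ax x t) x
  bA : ∀ x ∈ Icc (-1 : ℝ) 1, ∀ t ∈ Ioo (-1 : ℝ) 0, |A x t - 1| ≤ |t| / 100
  bAx : ∀ x ∈ Icc (-1 : ℝ) 1, ∀ t ∈ Ioo (-1 : ℝ) 0, |Ax x t| ≤ 1 / 100
  C1 : 1 ≤ C
  b : ∀ x t, |v x t| ≤ C ∧ |vx x t| ≤ C ∧ |vxx x t| ≤ C ∧ |vt x t| ≤ C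
  h1 : ∀ x ∈ Icc (-1 : ℝ) 1, ∀ t ∈ Ioo (-1 : ℝ) 0, |vt x t - A x t * vxx x t| ≤ C
  h2 : ∀ x ∈ Icc (-(1/2) : ℝ) (1/2), ∀ t ∈ Ioo (-1 : ℝ) 0,
    |vt x t - A x t * vxx x t| ≤ C * (|vx x t| + |v x t|)

section freq
variable (v vx vxx vt : ℝ → ℝ → ℝ)
noncomputable def Hf (t : ℝ) : ℝ := ∫ x in (-1 : ℝ)..1, v x t ^ 2 * Eg x t
noncomputable def fL (x t : ℝ) : ℝ := vxx x t + x / (2 * t) * vx x t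
noncomputable def Nf (t : ℝ) : ℝ := -t * Hf vx t / Hf v t
noncomputable def Vf (t : ℝ) : ℝ :=
  (∫ x in (-1 : ℝ)..1, (fL vx vxx x t + Hf vx t / Hf v t * v x t) ^ 2 * Eg x t) / Hf v t
end freq

lemma cfix {g : ℝ → ℝ → ℝ} (h : Continuous (fun q : ℝ × ℝ => g q.1 q.2)) (t : ℝ) :
    Continuous (fun x => g x t) := by
  have : Continuous (fun x : ℝ => ((x, t) : ℝ × ℝ)) := by fun_prop
  exact h.comp this

lemma cfix' {g : ℝ → ℝ → ℝ} (h : Continuous (fun q : ℝ × ℝ => g q.1 q.2)) (x : ℝ) :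
    Continuous (fun t => g x t) := by
  have : Continuous (fun t : ℝ => ((x, t) : ℝ × ℝ)) := by fun_prop
  exact h.comp this

lemma Hf_nonneg (v : ℝ → ℝ → ℝ) (t : ℝ) : 0 ≤ Hf v t :=
  intervalIntegral.integral_nonneg (by norm_num) fun x _ => by have := Eg_pos x t; positivity

section main
variable {v vx vxx vt A Ax : ℝ → ℝ → ℝ} {C : ℝ}

/-- `D = - ∫ v L v E` -/
lemma D_eq (h : VS v vx vxx vt A Ax C) {t : ℝ} (ht : t ∈ Ioo (-1 : ℝ) 0) :
    Hf vx t = -∫ x in (-1 : ℝ)..1, v x t * fL vx vxx x t * Eg x t := by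
  have P := h.ps t ht
  have c0 := P.c0; have c1 := P.c1; have c2 := P.c2; have := Eg_cont t
  have := ps_I1 P ht.2
  rw [intervalIntegral.integral_add (Continuous.intervalIntegrable (by fun_prop) _ _)
    (Continuous.intervalIntegrable (by fun_prop) _ _)] at this
  unfold Hf fL
  linarith

/-- `∫ (Lv)² E = ∫ vxx² E - D/(2t)` -/
lemma L2_eq (h : VS v vx vxx vt A Ax C) {t : ℝ} (ht : t ∈ Ioo (-1 : ℝ) 0) :
    ∫ x in (-1 : ℝ)..1, fL vx vxx x t ^ 2 * Eg x t = Hf vxx t - Hf vx t / (2 * t) := by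
  have P := h.ps t ht
  have c0 := P.c0; have c1 := P.c1; have c2 := P.c2; have := Eg_cont t
  have I := ps_I2 P.c1 P.c2 P.d1 P.z1 P.z1' ht.2
  have h0 : t ≠ 0 := ht.2.ne
  unfold Hf fL
  rw [← intervalIntegral.integral_div, ← intervalIntegral.integral_sub
    (Continuous.intervalIntegrable (by fun_prop) _ _)
    (Continuous.intervalIntegrable (by fun_prop) _ _), ← sub_eq_zero,
    ← intervalIntegral.integral_sub
    (Continuous.intervalIntegrable (by fun_prop) _ _)
    (Continuous.intervalIntegrable (by fun_prop) _ _), ← I]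
  congr 1; ext x
  field_simp
  ring

end main

open Set Filter Topology

section main
variable {v vx vxx vt A Ax : ℝ → ℝ → ℝ} {C : ℝ}

lemma slope_bd {f f' : ℝ → ℝ} {B a b t s : ℝ} (hd : ∀ r ∈ Icc a b, HasDerivAt f (f' r) r)
    (hb : ∀ r ∈ Icc a b, |f' r| ≤ B) (ht : t ∈ Icc a b) (hs : s ∈ Icc a b) :
    |slope f t s| ≤ B := by
  have hB : 0 ≤ B := (abs_nonneg _).trans (hb t ht)
  have := Convex.norm_image_sub_le_of_norm_hasDerivWithin_le (f := f) (f' := f') (C := B)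
    (s := Icc a b) (fun r hr => (hd r hr).hasDerivWithinAt) hb (convex_Icc a b) ht hs
  rw [slope_def_field, abs_div]
  exact div_le_of_le_mul₀ (abs_nonneg _) hB this

lemma deriv_gen {t : ℝ} (ht : t ∈ Ioo (-1 : ℝ) 0) {w wt g k : ℝ → ℝ → ℝ} {C : ℝ} {G : ℝ → ℝ}
    (cw : Continuous (fun q : ℝ × ℝ => w q.1 q.2))
    (dt : ∀ x ∈ Icc (-1 : ℝ) 1, ∀ t ∈ Ioo (-1 : ℝ) 0, HasDerivAt (fun s => w x s) (wt x t) t)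
    (bt : ∀ x t, |wt x t| ≤ C)
    (cg : Continuous (fun q : ℝ × ℝ => g q.1 q.2)) (ck : Continuous (fun q : ℝ × ℝ => k q.1 q.2))
    (hG : ∀ s ∈ Ioo (-1 : ℝ) 0, G s - G t = ∫ x in (-1 : ℝ)..1,
      (g x s * (Eg x s - Eg x t) + (w x s - w x t) * k x s)) :
    HasDerivAt G (∫ x in (-1 : ℝ)..1, (g x t * (-(x ^ 2 / (4 * t ^ 2)) * Eg x t)
      + wt x t * k x t)) t := by
  obtain ⟨a, ha1, hat⟩ := exists_between ht.1
  obtain ⟨b, htb, hb0⟩ := exists_between ht.2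
  have hKc : IsCompact (Icc (-1 : ℝ) 1 ×ˢ Icc a b) := isCompact_Icc.prod isCompact_Icc
  obtain ⟨M1, hM1⟩ := hKc.exists_bound_of_continuousOn cg.continuousOn
  obtain ⟨M2, hM2⟩ := hKc.exists_bound_of_continuousOn ck.continuousOn
  have hsub : ∀ r ∈ Icc a b, r ∈ Ioo (-1 : ℝ) 0 := fun r hr =>
    ⟨by linarith [hr.1], by linarith [hr.2]⟩
  have htI : t ∈ Icc a b := ⟨hat.le, htb.le⟩
  have hev : ∀ᶠ s in 𝓝[≠] t, s ∈ Icc a b :=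
    nhdsWithin_le_nhds (Icc_mem_nhds hat htb)
  rw [hasDerivAt_iff_tendsto_slope]
  have key : Tendsto (fun s => ∫ x in (-1 : ℝ)..1, (g x s * slope (fun r => Eg x r) t s
      + slope (fun r => w x r) t s * k x s)) (𝓝[≠] t)
      (𝓝 (∫ x in (-1 : ℝ)..1, (g x t * (-(x ^ 2 / (4 * t ^ 2)) * Eg x t)
      + wt x t * k x t))) := by
    apply intervalIntegral.tendsto_integral_filter_of_dominated_convergence
      (fun _ => M1 * (1 / (4 * b ^ 2)) + C * M2)
    · filter_upwards with s
      apply Continuous.aestronglyMeasurable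
      have := cfix cg s; have := cfix ck s; have := cfix cw s; have := cfix cw t
      have := Eg_cont s; have := Eg_cont t
      simp only [slope_def_field]
      fun_prop
    · filter_upwards [hev] with s hs
      filter_upwards with x hx
      rw [uIoc_of_le (by norm_num)] at hx
      have hx' : x ∈ Icc (-1 : ℝ) 1 := ⟨hx.1.le, hx.2⟩
      have e1 : |slope (fun r => Eg x r) t s| ≤ 1 / (4 * b ^ 2) := by
        refine slope_bd (fun r hr => Eg_dt (hsub r hr).2 x) (fun r hr => ?_) htI hs
        have h1 := Eg_le_one (x := x) (hsub r hr).2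
        have h2 := Eg_pos x r
        have h3 : x ^ 2 ≤ 1 := by nlinarith [hx'.1, hx'.2]
        have h4 : b ^ 2 ≤ r ^ 2 := by nlinarith [hr.2]
        have h5 : 0 < b ^ 2 := by nlinarith
        rw [neg_mul, abs_neg, abs_mul, abs_of_pos h2, abs_of_nonneg (by positivity)]
        calc x ^ 2 / (4 * r ^ 2) * Eg x r ≤ x ^ 2 / (4 * r ^ 2) * 1 := by gcongr
          _ ≤ 1 / (4 * b ^ 2) := by rw [mul_one]; gcongr
      have e2 : |slope (fun r => w x r) t s| ≤ C :=
        slope_bd (fun r hr => dt x hx' r (hsub r hr)) (fun r hr => bt x r) htI hs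
      have m1 := hM1 (x, s) ⟨hx', hs⟩
      have m2 := hM2 (x, s) ⟨hx', hs⟩
      have hC : 0 ≤ C := (abs_nonneg _).trans e2
      rw [Real.norm_eq_abs] at m1 m2 ⊢
      simp only at m1 m2
      refine (abs_add_le _ _).trans ?_
      rw [abs_mul, abs_mul]
      have : 0 ≤ M1 := (abs_nonneg _).trans m1
      gcongr
    · simp
    · filter_upwards with x hx
      rw [uIoc_of_le (by norm_num)] at hx
      have hx' : x ∈ Icc (-1 : ℝ) 1 := ⟨hx.1.le, hx.2⟩
      have a1 := ((cfix' cg x).tendsto t).mono_left (nhdsWithin_le_nhds (s := {t}ᶜ))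
      have a2 := ((cfix' ck x).tendsto t).mono_left (nhdsWithin_le_nhds (s := {t}ᶜ))
      have a3 := (Eg_dt ht.2 x).tendsto_slope
      have a4 := (dt x hx' t ht).tendsto_slope
      exact (a1.mul a3).add (a4.mul a2)
  refine key.congr' ?_
  filter_upwards [hev] with s hs
  rw [slope_def_field, hG s (hsub s hs), ← intervalIntegral.integral_div]
  congr 1; ext x
  simp only [slope_def_field]
  ring

lemma H_deriv (h : VS v vx vxx vt A Ax C) {t : ℝ} (ht : t ∈ Ioo (-1 : ℝ) 0) :
    HasDerivAt (Hf v) (-2 * Hf vx t + 2 * (∫ x in (-1 : ℝ)..1, v x t * (vt x t - vxx x t) * Eg x t)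
      + Hf v t / (2 * t)) t := by
  have P := h.ps t ht
  have c0 := P.c0; have c1 := P.c1; have c2 := P.c2; have c3 := cfix h.cvt t; have cE := Eg_cont t
  have h0 : t ≠ 0 := ht.2.ne
  have key := deriv_gen (G := Hf v) (w := v) (wt := vt) (C := C) ht
    (g := fun x s => v x s ^ 2) (k := fun x s => (v x s + v x t) * Eg x t) h.cv h.dt
    (fun x t => (h.b x t).2.2.2) (by have := h.cv; fun_prop)
    (by
      have := h.cv
      have : Continuous (fun q : ℝ × ℝ => v q.1 t) := (cfix h.cv t).comp continuous_fst
      have : Continuous (fun q : ℝ × ℝ => Eg q.1 t) := cE.comp continuous_fst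
      fun_prop)
    (by
      intro s hs
      have := cfix h.cv s; have := Eg_cont s
      unfold Hf
      rw [← intervalIntegral.integral_sub (Continuous.intervalIntegrable (by fun_prop) _ _)
        (Continuous.intervalIntegrable (by fun_prop) _ _)]
      congr 1; ext x; ring)
  refine key.congr_deriv ?_
  rw [D_eq h ht]
  have I := ps_I2 P.c0 P.c1 P.d0 P.z0 P.z0' ht.2
  unfold Hf fL
  rw [← sub_eq_zero, ← intervalIntegral.integral_div, ← intervalIntegral.integral_neg,
    ← intervalIntegral.integral_const_mul, ← intervalIntegral.integral_const_mul,
    ← intervalIntegral.integral_add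
    (Continuous.intervalIntegrable (by fun_prop) _ _)
    (Continuous.intervalIntegrable (by fun_prop) _ _),
    ← intervalIntegral.integral_add
    (Continuous.intervalIntegrable (by fun_prop) _ _)
    (Continuous.intervalIntegrable (by fun_prop) _ _),
    ← intervalIntegral.integral_sub
    (Continuous.intervalIntegrable (by fun_prop) _ _)
    (Continuous.intervalIntegrable (by fun_prop) _ _), ← neg_eq_zero,
    ← intervalIntegral.integral_neg, ← I]
  congr 1; ext x
  field_simp
  ring

lemma D_deriv (h : VS v vx vxx vt A Ax C) {t : ℝ} (ht : t ∈ Ioo (-1 : ℝ) 0) :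
    HasDerivAt (Hf vx) (-(Hf vx t / (2 * t))
      - 2 * (∫ x in (-1 : ℝ)..1, fL vx vxx x t ^ 2 * Eg x t)
      - 2 * (∫ x in (-1 : ℝ)..1, fL vx vxx x t * (vt x t - vxx x t) * Eg x t)) t := by
  have P := h.ps t ht
  have c0 := P.c0; have c1 := P.c1; have c2 := P.c2; have c3 := cfix h.cvt t; have cE := Eg_cont t
  have h0 : t ≠ 0 := ht.2.ne
  have key := deriv_gen (G := Hf vx) (w := v) (wt := vt) (C := C) ht
    (g := fun x s => vx x s ^ 2)
    (k := fun x s => -((vxx x s + vxx x t) + x / (2 * t) * (vx x s + vx x t)) * Eg x t) h.cv h.dt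
    (fun x t => (h.b x t).2.2.2) (by have := h.cvx; fun_prop)
    (by
      have := h.cvx
      have := h.cvxx
      have : Continuous (fun q : ℝ × ℝ => vx q.1 t) := c1.comp continuous_fst
      have : Continuous (fun q : ℝ × ℝ => vxx q.1 t) := c2.comp continuous_fst
      have : Continuous (fun q : ℝ × ℝ => Eg q.1 t) := cE.comp continuous_fst
      fun_prop)
    (by
      intro s hs
      have P' := h.ps s hs
      have := P'.c0; have := P'.c1; have := P'.c2; have := Eg_cont s
      have J : ∫ x in (-1 : ℝ)..1, ((vx x s - vx x t) * ((vx x s + vx x t) * Eg x t) +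
          (v x s - v x t) * (((vxx x s + vxx x t) + x / (2 * t) * (vx x s + vx x t)) * Eg x t))
          = 0 := by
        apply ibp0 (F := fun x => (v x s - v x t) * ((vx x s + vx x t) * Eg x t)) (by fun_prop)
          (by fun_prop)
        · intro x hx
          refine (((P'.d0 x hx).sub (P.d0 x hx)).mul (((P'.d1 x hx).add (P.d1 x hx)).mul
            (Eg_dx ht.2 x))).congr_deriv ?_
          simp only [Pi.mul_apply, Pi.add_apply, Pi.sub_apply]; ring
        · simp [P'.z0, P.z0]
        · simp [P'.z0', P.z0']
      unfold Hf
      rw [← sub_eq_zero, ← intervalIntegral.integral_sub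
        (Continuous.intervalIntegrable (by fun_prop) _ _)
        (Continuous.intervalIntegrable (by fun_prop) _ _),
        ← intervalIntegral.integral_sub (Continuous.intervalIntegrable (by fun_prop) _ _)
        (Continuous.intervalIntegrable (by fun_prop) _ _), ← J]
      congr 1; ext x; ring)
  refine key.congr_deriv ?_
  have I := ps_I2 P.c1 P.c2 P.d1 P.z1 P.z1' ht.2
  have L := L2_eq h ht
  have : -(Hf vx t / (2 * t)) - 2 * (∫ x in (-1 : ℝ)..1, fL vx vxx x t ^ 2 * Eg x t) =
    Hf vx t / (2 * t) - 2 * Hf vxx t := by rw [L]; field_simp; ring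
  rw [this]
  unfold Hf fL
  rw [← sub_eq_zero, ← intervalIntegral.integral_div, 
    ← intervalIntegral.integral_const_mul, ← intervalIntegral.integral_const_mul,
    ← intervalIntegral.integral_sub
    (Continuous.intervalIntegrable (by fun_prop) _ _)
    (Continuous.intervalIntegrable (by fun_prop) _ _),
    ← intervalIntegral.integral_sub
    (Continuous.intervalIntegrable (by fun_prop) _ _)
    (Continuous.intervalIntegrable (by fun_prop) _ _),
    ← intervalIntegral.integral_sub
    (Continuous.intervalIntegrable (by fun_prop) _ _)
    (Continuous.intervalIntegrable (by fun_prop) _ _), ← neg_eq_zero,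
    ← intervalIntegral.integral_neg, ← I]
  congr 1; ext x
  field_simp
  ring

end main

open Set Filter Topology

lemma int_le3 {F f g k : ℝ → ℝ} {a b c p q : ℝ} (hpq : p ≤ q) (hF : Continuous F)
    (hf : Continuous f) (hg : Continuous g) (hk : Continuous k)
    (h : ∀ x ∈ Icc p q, F x ≤ a * f x + b * g x + c * k x) :
    ∫ x in p..q, F x ≤ a * (∫ x in p..q, f x) + b * (∫ x in p..q, g x) + c * ∫ x in p..q, k x := by
  rw [← intervalIntegral.integral_const_mul, ← intervalIntegral.integral_const_mul,
    ← intervalIntegral.integral_const_mul, ← intervalIntegral.integral_add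
    (Continuous.intervalIntegrable (by fun_prop) _ _)
    (Continuous.intervalIntegrable (by fun_prop) _ _), ← intervalIntegral.integral_add
    (Continuous.intervalIntegrable (by fun_prop) _ _)
    (Continuous.intervalIntegrable (by fun_prop) _ _)]
  exact intervalIntegral.integral_mono_on hpq (Continuous.intervalIntegrable (by fun_prop) _ _)
    (Continuous.intervalIntegrable (by fun_prop) _ _) h

lemma int_eq3 {F f g k : ℝ → ℝ} {a b c p q : ℝ} (hF : Continuous F)
    (hf : Continuous f) (hg : Continuous g) (hk : Continuous k)
    (h : ∀ x, F x = a * f x + b * g x + c * k x) :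
    ∫ x in p..q, F x = a * (∫ x in p..q, f x) + b * (∫ x in p..q, g x) + c * ∫ x in p..q, k x := by
  rw [← intervalIntegral.integral_const_mul, ← intervalIntegral.integral_const_mul,
    ← intervalIntegral.integral_const_mul, ← intervalIntegral.integral_add
    (Continuous.intervalIntegrable (by fun_prop) _ _)
    (Continuous.intervalIntegrable (by fun_prop) _ _), ← intervalIntegral.integral_add
    (Continuous.intervalIntegrable (by fun_prop) _ _)
    (Continuous.intervalIntegrable (by fun_prop) _ _)]
  congr 1; ext x; exact h x

lemma Eg_shell {x t : ℝ} (ht : t < 0) (hx : 1 / 4 ≤ x ^ 2) : Eg x t ≤ Real.exp (1 / (16 * t)) := by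
  unfold Eg
  apply Real.exp_le_exp.2
  have e : x ^ 2 / (4 * t) - 1 / (16 * t) = (x ^ 2 - 1 / 4) / (4 * t) := by
    have := ht.ne
    field_simp
    ring
  have := div_nonpos_of_nonneg_of_nonpos (by linarith : 0 ≤ x ^ 2 - 1 / 4)
    (by linarith : 4 * t ≤ 0)
  linarith

lemma pw1 {V P a b k : ℝ} (ha : |a| ≤ 1 / 100) (hb : |b| ≤ 1 / 100) (hk : |k| ≤ 1 / 200) :
    |a * (V * P) + b * P ^ 2 + k * (V * P)| ≤ 1 / 50 * P ^ 2 + 1 / 100 * V ^ 2 := by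
  have am : |V * P| ≤ (V ^ 2 + P ^ 2) / 2 := by
    rw [abs_le]; constructor <;> nlinarith [sq_nonneg (V + P), sq_nonneg (V - P)]
  refine (abs_add_three _ _ _).trans ?_
  rw [abs_mul a, abs_mul b, abs_mul k, abs_of_nonneg (sq_nonneg P)]
  have e1 := mul_le_mul ha am (abs_nonneg _) (by norm_num)
  have e2 := mul_le_mul hk am (abs_nonneg _) (by norm_num)
  have e3 := mul_le_mul_of_nonneg_right hb (sq_nonneg P)
  nlinarith [sq_nonneg P, sq_nonneg V]

lemma pw2 {X Y E V P C S : ℝ} (hE : 0 < E) (h1 : Y ≤ 1 / 50 * P ^ 2 + 1 / 100 * V ^ 2)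
    (h2 : X * E ≤ (1 / 200 * P ^ 2 + 57 * C ^ 2 * V ^ 2) * E + C ^ 2 * S) (hC : 1 ≤ C) :
    (X + Y) * E ≤ 1 / 40 * (P ^ 2 * E) + 58 * C ^ 2 * (V ^ 2 * E) + C ^ 2 * S * 1 := by
  have q4 := mul_le_mul_of_nonneg_right h1 hE.le
  have q5 : V ^ 2 * E ≤ C ^ 2 * (V ^ 2 * E) :=
    le_mul_of_one_le_left (by positivity) (by nlinarith)
  have q6 : 0 ≤ V ^ 2 * E := by positivity
  linarith

lemma N_alg {H t m W C Y Iff IfL Ivf G : ℝ} (hH : 0 < H) (ht1 : -1 < t) (ht0 : t < 0)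
    (hm0 : 0 ≤ m) (hW : 0 ≤ W) (hC : 1 ≤ C) (Q : Y - H * W = 1 * Iff + 2 * IfL + 2 * m * Ivf)
    (hY : 0 ≤ Y) (L : H * (W + m ^ 2) = G - m * H / (2 * t))
    (F : Iff ≤ t ^ 2 / 2 * G + 8 * C ^ 2 * (m * H + H)) :
    2 * t * (W + (IfL + m * Ivf) / H) ≤
      t / 2 * W + 8 * C ^ 2 * (-t * (-t * m) ^ 2 + -t * m - t) := by
  have hx : G ≤ H * (W + m ^ 2) := by
    have : m * H / (2 * t) ≤ 0 := div_nonpos_of_nonneg_of_nonpos (by positivity) (by linarith)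
    linarith
  have F2 : Iff ≤ H * (t ^ 2 / 2 * (W + m ^ 2) + 8 * C ^ 2 * (m + 1)) := by
    linarith [mul_le_mul_of_nonneg_left hx (by positivity : 0 ≤ t ^ 2 / 2)]
  have F3 : -(H * W) / 2 - Iff / 2 ≤ IfL + m * Ivf := by linarith
  have F4 : -W / 2 - (t ^ 2 / 2 * (W + m ^ 2) + 8 * C ^ 2 * (m + 1)) / 2 ≤ (IfL + m * Ivf) / H := by
    rw [le_div_iff₀ hH]; linarith
  have ht2 : t ^ 2 ≤ 1 := by nlinarith
  have F5 : W / 2 - (t ^ 2 / 2 * (W + m ^ 2) + 8 * C ^ 2 * (m + 1)) / 2 ≤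
    W + (IfL + m * Ivf) / H := by linarith
  have F6 := mul_le_mul_of_nonpos_left F5 (by linarith : 2 * t ≤ 0)
  refine F6.trans ?_
  have g1 : -t * (t ^ 2 * W) ≤ -t * W := by
    apply mul_le_mul_of_nonneg_left _ (by linarith); nlinarith
  have g3 : 0 ≤ -t * (t ^ 2 * m ^ 2) := mul_nonneg (by linarith) (by positivity)
  have g2 : -t * (t ^ 2 * m ^ 2) ≤ C ^ 2 * (-t * (t ^ 2 * m ^ 2)) :=
    le_mul_of_one_le_left g3 (by nlinarith)
  linarith

section main
variable {v vx vxx vt A Ax : ℝ → ℝ → ℝ} {C : ℝ}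

lemma vf_bound (h : VS v vx vxx vt A Ax C) {t : ℝ} (ht : t ∈ Ioo (-1 : ℝ) 0)
    (hS : Real.exp (1 / (16 * t)) ≤ Hf v t) :
    |∫ x in (-1 : ℝ)..1, v x t * (vt x t - vxx x t) * Eg x t| ≤
      1 / 40 * Hf vx t + 60 * C ^ 2 * Hf v t := by
  have P := h.ps t ht
  have c0 := P.c0; have c1 := P.c1; have c2 := P.c2; have c3 := cfix h.cvt t; have cE := Eg_cont t
  have cA := h.cA t; have cAx := h.cAx t
  have h0 : t ≠ 0 := ht.2.ne
  have I := ps_I4 P ht.2 cA cAx (fun x hx => h.dA x hx t ht)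
  have hC := h.C1
  rw [← sub_zero (∫ x in (-1 : ℝ)..1, v x t * (vt x t - vxx x t) * Eg x t), ← I,
    ← intervalIntegral.integral_sub
    (Continuous.intervalIntegrable (by fun_prop) _ _)
    (Continuous.intervalIntegrable (by fun_prop) _ _)]
  refine (intervalIntegral.abs_integral_le_integral_abs (by norm_num)).trans ?_
  have key := int_le3 (p := -1) (q := 1)
    (F := fun x => |v x t * (vt x t - vxx x t) * Eg x t - (Ax x t * v x t * vx x t +
      (A x t - 1) * (vx x t ^ 2 + v x t * vxx x t + x / (2 * t) * v x t * vx x t)) * Eg x t|)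
    (f := fun x => vx x t ^ 2 * Eg x t) (g := fun x => v x t ^ 2 * Eg x t) (k := fun _ => 1)
    (a := 1 / 40) (b := 58 * C ^ 2) (c := C ^ 2 * Real.exp (1 / (16 * t)))
    (by norm_num) (by fun_prop) (by fun_prop) (by fun_prop) (by fun_prop) ?_
  · refine key.trans ?_
    simp only [intervalIntegral.integral_const, smul_eq_mul]
    change _ * Hf vx t + _ * Hf v t + _ ≤ _
    nlinarith [sq_nonneg C]
  · intro x hx
    have hE := Eg_pos x t
    have e : v x t * (vt x t - vxx x t) * Eg x t - (Ax x t * v x t * vx x t +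
      (A x t - 1) * (vx x t ^ 2 + v x t * vxx x t + x / (2 * t) * v x t * vx x t)) * Eg x t =
      (v x t * (vt x t - A x t * vxx x t) - (Ax x t * (v x t * vx x t) +
      (A x t - 1) * vx x t ^ 2 + ((A x t - 1) * x / (2 * t)) * (v x t * vx x t))) * Eg x t := by
        ring
    rw [e, abs_mul, abs_of_pos hE]
    have b1 := h.bA x hx t ht
    have b2 := h.bAx x hx t ht
    have b3 : |(A x t - 1) * x / (2 * t)| ≤ 1 / 200 := by
      rw [abs_div, abs_mul, div_le_iff₀ (by positivity), abs_mul]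
      have : |x| ≤ 1 := abs_le.2 hx
      norm_num
      nlinarith [abs_nonneg x, abs_nonneg (A x t - 1)]
    have ht1 : |t| ≤ 1 := abs_le.2 ⟨ht.1.le, by linarith [ht.2]⟩
    have q1 := pw1 (V := v x t) (P := vx x t) b2 (b1.trans (by linarith : |t| / 100 ≤ 1 / 100)) b3
    have bb := h.b x t
    have q2 : |v x t * (vt x t - A x t * vxx x t)| * Eg x t ≤
        (1 / 200 * vx x t ^ 2 + 57 * C ^ 2 * v x t ^ 2) * Eg x t
          + C ^ 2 * Real.exp (1 / (16 * t)) := by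
      rw [abs_mul]
      by_cases hx2 : x ∈ Icc (-(1/2) : ℝ) (1/2)
      · have b4 := h.h2 x hx2 t ht
        have : |v x t| * |vt x t - A x t * vxx x t| ≤
            1 / 200 * vx x t ^ 2 + 57 * C ^ 2 * v x t ^ 2 := by
          rw [← sq_abs (vx x t), ← sq_abs (v x t)]
          have e1 := mul_le_mul_of_nonneg_left b4 (abs_nonneg (v x t))
          have e2 : C * |v x t| ^ 2 ≤ C ^ 2 * |v x t| ^ 2 := by
            gcongr; nlinarith
          nlinarith [sq_nonneg (|vx x t| - 100 * C * |v x t|), sq_nonneg (C * |v x t|)]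
        have e3 : 0 ≤ C ^ 2 * Real.exp (1 / (16 * t)) := by positivity
        nlinarith
      · have : 1 / 4 ≤ x ^ 2 := by
          rw [mem_Icc, not_and_or, not_le, not_le] at hx2
          rcases hx2 with hx2 | hx2 <;> nlinarith
        have e1 := Eg_shell ht.2 this
        have e2 : |v x t| * |vt x t - A x t * vxx x t| ≤ C * C :=
          mul_le_mul bb.1 (h.h1 x hx t ht) (abs_nonneg _) (by linarith)
        have e3 : 0 ≤ (1 / 200 * vx x t ^ 2 + 57 * C ^ 2 * v x t ^ 2) * Eg x t := by positivity
        have e4 := mul_le_mul e2 e1 hE.le (by positivity)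
        linarith
    refine (mul_le_mul_of_nonneg_right (abs_sub _ _) hE.le).trans ?_
    exact pw2 hE q1 q2 hC

lemma ff_bound (h : VS v vx vxx vt A Ax C) {t : ℝ} (ht : t ∈ Ioo (-1 : ℝ) 0)
    (hS : Real.exp (1 / (16 * t)) ≤ Hf v t) :
    ∫ x in (-1 : ℝ)..1, (vt x t - vxx x t) ^ 2 * Eg x t ≤
      t ^ 2 / 2 * Hf vxx t + 8 * C ^ 2 * (Hf vx t + Hf v t) := by
  have P := h.ps t ht
  have c0 := P.c0; have c1 := P.c1; have c2 := P.c2; have c3 := cfix h.cvt t; have cE := Eg_cont t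
  have hC := h.C1
  have key := int_le3 (p := -1) (q := 1)
    (F := fun x => (vt x t - vxx x t) ^ 2 * Eg x t - t ^ 2 / 2 * (vxx x t ^ 2 * Eg x t))
    (f := fun x => vx x t ^ 2 * Eg x t) (g := fun x => v x t ^ 2 * Eg x t) (k := fun _ => 1)
    (a := 4 * C ^ 2) (b := 4 * C ^ 2) (c := 2 * C ^ 2 * Real.exp (1 / (16 * t)))
    (by norm_num) (by fun_prop) (by fun_prop) (by fun_prop) (by fun_prop) ?_
  · rw [intervalIntegral.integral_sub
      (Continuous.intervalIntegrable (by fun_prop) _ _)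
      (Continuous.intervalIntegrable (by fun_prop) _ _), intervalIntegral.integral_const_mul] at key
    simp only [intervalIntegral.integral_const, smul_eq_mul] at key
    change _ - _ * Hf vxx t ≤ _ * Hf vx t + _ * Hf v t + _ at key
    have := Hf_nonneg vx t
    nlinarith [sq_nonneg C, mul_nonneg (sq_nonneg C) this]
  · intro x hx
    have hE := Eg_pos x t
    have b1 := h.bA x hx t ht
    have b5 : (A x t - 1) ^ 2 ≤ t ^ 2 / 4 := by
      rw [← sq_abs, ← sq_abs t]
      nlinarith [abs_nonneg (A x t - 1), abs_nonneg t]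
    have q2 : (vt x t - A x t * vxx x t) ^ 2 * Eg x t ≤
        2 * C ^ 2 * (vx x t ^ 2 + v x t ^ 2) * Eg x t
          + C ^ 2 * Real.exp (1 / (16 * t)) := by
      rw [← sq_abs (vt x t - A x t * vxx x t)]
      by_cases hx2 : x ∈ Icc (-(1/2) : ℝ) (1/2)
      · have b4 := h.h2 x hx2 t ht
        have : |vt x t - A x t * vxx x t| ^ 2 ≤ 2 * C ^ 2 * (vx x t ^ 2 + v x t ^ 2) := by
          refine (pow_le_pow_left₀ (abs_nonneg _) b4 2).trans ?_
          rw [← sq_abs (vx x t), ← sq_abs (v x t)]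
          nlinarith [mul_nonneg (sq_nonneg C) (sq_nonneg (|vx x t| - |v x t|))]
        have e3 : 0 ≤ C ^ 2 * Real.exp (1 / (16 * t)) := by positivity
        nlinarith
      · have : 1 / 4 ≤ x ^ 2 := by
          rw [mem_Icc, not_and_or, not_le, not_le] at hx2
          rcases hx2 with hx2 | hx2 <;> nlinarith
        have e1 := Eg_shell ht.2 this
        have e2 := pow_le_pow_left₀ (abs_nonneg _) (h.h1 x hx t ht) 2
        have e3 : 0 ≤ 2 * C ^ 2 * (vx x t ^ 2 + v x t ^ 2) * Eg x t := by positivity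
        have e4 := mul_le_mul e2 e1 hE.le (by positivity)
        linarith
    have q3 : (vt x t - vxx x t) ^ 2 ≤ 2 * (vt x t - A x t * vxx x t) ^ 2 +
        t ^ 2 / 2 * vxx x t ^ 2 := by
      have := mul_le_mul_of_nonneg_right b5 (sq_nonneg (vxx x t))
      nlinarith [sq_nonneg (vt x t - A x t * vxx x t - (A x t - 1) * vxx x t)]
    have q4 := mul_le_mul_of_nonneg_right q3 hE.le
    nlinarith

lemma V_eq (h : VS v vx vxx vt A Ax C) {t : ℝ} (ht : t ∈ Ioo (-1 : ℝ) 0) (hH : 0 < Hf v t) :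
    ∫ x in (-1 : ℝ)..1, fL vx vxx x t ^ 2 * Eg x t =
      Hf v t * (Vf v vx vxx t + (Hf vx t / Hf v t) ^ 2) := by
  have P := h.ps t ht
  have c0 := P.c0; have c1 := P.c1; have c2 := P.c2; have cE := Eg_cont t
  have D := D_eq h ht
  have c4 : Continuous (fun x => fL vx vxx x t) := by unfold fL; fun_prop
  have := int_eq3 (p := -1) (q := 1)
    (F := fun x => (fL vx vxx x t + Hf vx t / Hf v t * v x t) ^ 2 * Eg x t)
    (f := fun x => fL vx vxx x t ^ 2 * Eg x t) (g := fun x => v x t * fL vx vxx x t * Eg x t)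
    (k := fun x => v x t ^ 2 * Eg x t) (a := 1) (b := 2 * (Hf vx t / Hf v t))
    (c := (Hf vx t / Hf v t) ^ 2) (by fun_prop) (by fun_prop) (by fun_prop) (by fun_prop)
    (fun x => by ring)
  unfold Vf
  rw [this]
  change _ = Hf v t * ((_ + _ + _ * Hf v t) / _ + _)
  have e : ∫ x in (-1 : ℝ)..1, v x t * fL vx vxx x t * Eg x t = - Hf vx t := by linarith
  rw [e]
  field_simp
  ring

lemma N_deriv (h : VS v vx vxx vt A Ax C) {t : ℝ} (ht : t ∈ Ioo (-1 : ℝ) 0)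
    (hS : Real.exp (1 / (16 * t)) ≤ Hf v t) :
    ∃ N', HasDerivAt (Nf v vx) N' t ∧ N' ≤ t / 2 * Vf v vx vxx t +
      8 * C ^ 2 * (-t * Nf v vx t ^ 2 + Nf v vx t - t) := by
  have P := h.ps t ht
  have c0 := P.c0; have c1 := P.c1; have c2 := P.c2; have c3 := cfix h.cvt t; have cE := Eg_cont t
  have hH : 0 < Hf v t := (Real.exp_pos _).trans_le hS
  have h0 : t ≠ 0 := ht.2.ne
  have c4 : Continuous (fun x => fL vx vxx x t) := by unfold fL; fun_prop
  have d1 := ((((hasDerivAt_id t).neg).mul (D_deriv h ht)).div (H_deriv h ht) hH.ne')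
  refine ⟨_, d1, ?_⟩
  have V := V_eq h ht hH
  have L := L2_eq h ht
  have F := ff_bound h ht hS
  have hD := Hf_nonneg vx t
  have Q := int_eq3 (p := -1) (q := 1)
    (F := fun x => ((vt x t - vxx x t) + (fL vx vxx x t + Hf vx t / Hf v t * v x t)) ^ 2 * Eg x t
      - (fL vx vxx x t + Hf vx t / Hf v t * v x t) ^ 2 * Eg x t)
    (f := fun x => (vt x t - vxx x t) ^ 2 * Eg x t)
    (g := fun x => fL vx vxx x t * (vt x t - vxx x t) * Eg x t)
    (k := fun x => v x t * (vt x t - vxx x t) * Eg x t) (a := 1) (b := 2)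
    (c := 2 * (Hf vx t / Hf v t)) (by fun_prop) (by fun_prop) (by fun_prop) (by fun_prop)
    (fun x => by ring)
  rw [intervalIntegral.integral_sub
      (Continuous.intervalIntegrable (by fun_prop) _ _)
      (Continuous.intervalIntegrable (by fun_prop) _ _)] at Q
  have pos : 0 ≤ ∫ x in (-1 : ℝ)..1,
      ((vt x t - vxx x t) + (fL vx vxx x t + Hf vx t / Hf v t * v x t)) ^ 2 * Eg x t :=
    intervalIntegral.integral_nonneg (by norm_num) fun x _ => by have := Eg_pos x t; positivity
  have hV : ∫ x in (-1 : ℝ)..1, (fL vx vxx x t + Hf vx t / Hf v t * v x t) ^ 2 * Eg x t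
      = Hf v t * Vf v vx vxx t := by unfold Vf; rw [mul_div_cancel₀ _ hH.ne']
  rw [hV] at Q
  have hVn : 0 ≤ Vf v vx vxx t := by
    unfold Vf
    exact div_nonneg (intervalIntegral.integral_nonneg (by norm_num) fun x _ => by
      have := Eg_pos x t; positivity) hH.le
  generalize (∫ x in (-1 : ℝ)..1,
      ((vt x t - vxx x t) + (fL vx vxx x t + Hf vx t / Hf v t * v x t)) ^ 2 * Eg x t) = Y at *
  simp only [Pi.neg_apply, Pi.mul_apply, id]
  unfold Nf
  rw [V]
  rw [V] at L
  set IfL := ∫ x in (-1 : ℝ)..1, fL vx vxx x t * (vt x t - vxx x t) * Eg x t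
  set Ivf := ∫ x in (-1 : ℝ)..1, v x t * (vt x t - vxx x t) * Eg x t
  set Iff := ∫ x in (-1 : ℝ)..1, (vt x t - vxx x t) ^ 2 * Eg x t
  set W := Vf v vx vxx t
  set H := Hf v t
  obtain ⟨m, hm⟩ : ∃ m, m = Hf vx t / H := ⟨_, rfl⟩
  have hD' : Hf vx t = m * H := by rw [hm]; field_simp
  have hm0 : 0 ≤ m := by rw [hm]; positivity
  rw [← hm] at Q L
  rw [hD'] at L F
  rw [hD']
  have e1 : (((-1 * (m * H) + -t * (-(m * H / (2 * t)) - 2 * (H * (W + (m * H / H) ^ 2)) - 2 * IfL)) * H -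
        -t * (m * H) * (-2 * (m * H) + 2 * Ivf + H / (2 * t))) / H ^ 2) =
      2 * t * (W + (IfL + m * Ivf) / H) := by
    field_simp
    ring
  rw [e1]
  have e2 : -t * (m * H) / H = -t * m := by field_simp
  rw [e2]
  exact N_alg hH ht.1 ht.2 hm0 hVn h.C1 Q pos L F

end main

open Set Filter Topology

lemma anti_of {g g' : ℝ → ℝ} {s t : ℝ} (hst : s ≤ t)
    (hd : ∀ r ∈ Icc s t, HasDerivAt g (g' r) r) (hg : ∀ r ∈ Icc s t, g' r ≤ 0) : g t ≤ g s := by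
  have : AntitoneOn g (Icc s t) := by
    apply antitoneOn_of_hasDerivWithinAt_nonpos (convex_Icc s t) (f' := g')
      (fun r hr => (hd r hr).continuousAt.continuousWithinAt)
    · intro r hr; exact (hd r (interior_subset hr)).hasDerivWithinAt
    · intro r hr; exact hg r (interior_subset hr)
  exact this (left_mem_Icc.2 hst) (right_mem_Icc.2 hst) hst

section main
variable {v vx vxx vt A Ax : ℝ → ℝ → ℝ} {C : ℝ}

lemma Nf_nonneg {t : ℝ} (ht : t < 0) : 0 ≤ Nf v vx t :=
  div_nonneg (mul_nonneg (by linarith) (Hf_nonneg _ _)) (Hf_nonneg _ _)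

lemma Vf_nonneg (t : ℝ) : 0 ≤ Vf v vx vxx t :=
  div_nonneg (intervalIntegral.integral_nonneg (by norm_num) fun x _ => by
      have := Eg_pos x t; positivity) (Hf_nonneg _ _)

/-- logarithmic derivative of `H` -/
lemma logH (h : VS v vx vxx vt A Ax C) {t : ℝ} (ht : t ∈ Ioo (-1 : ℝ) 0)
    (hS : Real.exp (1 / (16 * t)) ≤ Hf v t) :
    ∃ l, HasDerivAt (fun s => Real.log (Hf v s)) l t ∧
      l ≤ Nf v vx t / t + 120 * C ^ 2 ∧
      (41 / 20 * Nf v vx t + 1 / 2) / t - 120 * C ^ 2 ≤ l := by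
  have hH : 0 < Hf v t := (Real.exp_pos _).trans_le hS
  have b := vf_bound h ht hS
  have hD := Hf_nonneg vx t
  refine ⟨_, (H_deriv h ht).log hH.ne', ?_⟩
  rw [abs_le] at b
  have h0 := ht.2
  have h0' := ht.2.ne
  have e : Nf v vx t = -t * (Hf vx t / Hf v t) := by unfold Nf; ring
  set I := ∫ x in (-1 : ℝ)..1, v x t * (vt x t - vxx x t) * Eg x t
  have e2 : (-2 * Hf vx t + 2 * I + Hf v t / (2 * t)) / Hf v t
    = -2 * (Hf vx t / Hf v t) + 2 * (I / Hf v t) + 1 / (2 * t) := by field_simp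
  have b1 : I / Hf v t ≤ 1 / 40 * (Hf vx t / Hf v t) + 60 * C ^ 2 := by
    rw [div_le_iff₀ hH]; field_simp; linarith [b.2]
  have b2 : -(1 / 40 * (Hf vx t / Hf v t) + 60 * C ^ 2) ≤ I / Hf v t := by
    rw [le_div_iff₀ hH]; field_simp; linarith [b.1]
  have hm : 0 ≤ Hf vx t / Hf v t := by positivity
  rw [e2, e]
  have e3 : 1 / (2 * t) ≤ 0 := div_nonpos_of_nonneg_of_nonpos (by norm_num) (by linarith)
  have e4 : -t * (Hf vx t / Hf v t) / t = -(Hf vx t / Hf v t) := by field_simp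
  have e5 : (41 / 20 * (-t * (Hf vx t / Hf v t)) + 1 / 2) / t =
    -(41 / 20) * (Hf vx t / Hf v t) + 1 / (2 * t) := by field_simp
  rw [e4, e5]
  constructor <;> linarith

/-- lower bound of `H` from upper bound of `N` -/
lemma logH_lower (h : VS v vx vxx vt A Ax C) {t1 ν : ℝ} (ht1 : t1 ∈ Ioo (-1 : ℝ) 0)
    (hS : ∀ t ∈ Ico t1 0, Real.exp (1 / (16 * t)) ≤ Hf v t)
    (hN : ∀ t ∈ Ico t1 0, Nf v vx t ≤ ν) :
    ∃ K, ∀ t ∈ Ico t1 0, (41 / 20 * ν + 1 / 2) * Real.log (-t) - K ≤ Real.log (Hf v t) := by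
  have hsub : ∀ t ∈ Ico t1 (0:ℝ), t ∈ Ioo (-1 : ℝ) 0 := fun t ht => ⟨ht1.1.trans_le ht.1, ht.2⟩
  choose! l hl1 hl2 hl3 using fun t (ht : t ∈ Ico t1 (0:ℝ)) => logH h (hsub t ht) (hS t ht)
  set e := 41 / 20 * ν + 1 / 2
  refine ⟨e * Real.log (-t1) - 120 * C ^ 2 * t1 - Real.log (Hf v t1), fun t ht => ?_⟩
  have hC := sq_nonneg C
  have := anti_of (g := fun s => e * Real.log (-s) - 120 * C ^ 2 * s - Real.log (Hf v s))
    (g' := fun s => e * (1 / s) - 120 * C ^ 2 - l s) (s := t1) (t := t) ht.1 ?_ ?_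
  · nlinarith [ht.2]
  · intro r hr
    have hr' : r ∈ Ico t1 (0:ℝ) := ⟨hr.1, hr.2.trans_lt ht.2⟩
    have hr0 : r ≠ 0 := hr'.2.ne
    have d1 : HasDerivAt (fun s : ℝ => Real.log (-s)) (1 / r) r := by
      refine ((hasDerivAt_neg r).log (by simpa using hr0)).congr_deriv ?_
      field_simp
    have d2 : HasDerivAt (fun s : ℝ => 120 * C ^ 2 * s) (120 * C ^ 2) r := by
      simpa using (hasDerivAt_id r).const_mul (120 * C ^ 2)
    exact ((d1.const_mul e).sub d2).sub (hl1 r hr')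
  · intro r hr
    have hr' : r ∈ Ico t1 (0:ℝ) := ⟨hr.1, hr.2.trans_lt ht.2⟩
    have := hl3 r hr'
    have h2 : e / r ≤ (41 / 20 * Nf v vx r + 1 / 2) / r :=
      div_le_div_of_nonpos_of_le hr'.2.le (by have := hN r hr'; simp only [e]; linarith)
    have : e * (1 / r) = e / r := by ring
    linarith

/-- summary of frequency estimates -/
structure FQ (v vx vxx : ℝ → ℝ → ℝ) (t0 Nb : ℝ) : Prop where
  ht0 : t0 ∈ Ioo (-1 : ℝ) 0
  hS : ∀ t ∈ Ico t0 0, Real.exp (1 / (16 * t)) ≤ Hf v t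
  hN : ∀ t ∈ Ico t0 0, Nf v vx t ≤ Nb
  dbl : ∀ t ∈ Ico t0 0, ∀ t' ∈ Ico t0 0, t ≤ t' → Hf v t' ≤ 2 * Hf v t
  Nd : ∃ C3, 0 ≤ C3 ∧ ∀ t ∈ Ico t0 0, ∃ N', HasDerivAt (Nf v vx) N' t ∧
    N' ≤ t / 2 * Vf v vx vxx t + C3

lemma exists_t0 (h : VS v vx vxx vt A Ax C) {κ δ : ℝ} (hκ : 0 < κ) (hδ : 0 < δ) (hδ1 : δ ≤ 1)
    (hlow : ∀ t ∈ Ioo (-δ) 0, κ * Real.exp (1 / (256 * t)) ≤ Hf v t)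
    (hS : ∀ t ∈ Ioo (-δ) 0, Real.exp (1 / (16 * t)) ≤ Hf v t) :
    ∃ t ∈ Ioo (-δ) 0, Nf v vx t ≤ -1 / t := by
  by_contra hcon
  push Not at hcon
  have hsub : ∀ t ∈ Ioo (-δ) (0:ℝ), t ∈ Ioo (-1 : ℝ) 0 := fun t ht => ⟨by linarith [ht.1], ht.2⟩
  choose! l hl1 hl2 hl3 using fun t (ht : t ∈ Ioo (-δ) (0:ℝ)) => logH h (hsub t ht) (hS t ht)
  obtain ⟨s, hs⟩ : (Ioo (-δ) (0:ℝ)).Nonempty := nonempty_Ioo.2 (by linarith)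
  have key : ∀ t ∈ Ico s 0, Real.log (Hf v t) ≤ 1 / t + 120 * C ^ 2 * t +
      (Real.log (Hf v s) - 1 / s - 120 * C ^ 2 * s) := by
    intro t ht
    have := anti_of (g := fun r => Real.log (Hf v r) - 1 / r - 120 * C ^ 2 * r)
      (g' := fun r => l r - -1 / r ^ 2 - 120 * C ^ 2) (s := s) (t := t) ht.1 ?_ ?_
    · linarith
    · intro r hr
      have hr' : r ∈ Ioo (-δ) (0:ℝ) := ⟨hs.1.trans_le hr.1, hr.2.trans_lt ht.2⟩
      have hr0 : r ≠ 0 := hr'.2.ne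
      have d1 : HasDerivAt (fun s : ℝ => 1 / s) (-1 / r ^ 2) r := by
        have := (hasDerivAt_inv hr0)
        simp only [one_div]
        exact this.congr_deriv (by ring)
      have d2 : HasDerivAt (fun s : ℝ => 120 * C ^ 2 * s) (120 * C ^ 2) r := by
        simpa using (hasDerivAt_id r).const_mul (120 * C ^ 2)
      exact ((hl1 r hr').sub d1).sub d2
    · intro r hr
      have hr' : r ∈ Ioo (-δ) (0:ℝ) := ⟨hs.1.trans_le hr.1, hr.2.trans_lt ht.2⟩
      have := hl2 r hr'
      have h2 : Nf v vx r / r ≤ (-1 / r) / r :=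
        div_le_div_of_nonpos_of_le hr'.2.le (hcon r hr').le
      have h3 : (-1 / r) / r = -1 / r ^ 2 := by have := hr'.2.ne; field_simp
      linarith
  set B := Real.log (Hf v s) - 1 / s - 120 * C ^ 2 * s
  -- choose t
  set Q := |B| + |Real.log κ| + 1 with hQ
  have hQ1 : 1 ≤ Q := by have := abs_nonneg B; have := abs_nonneg (Real.log κ); linarith
  have hs' : 0 < -s := by linarith [hs.2]
  obtain ⟨y, hy0, hy1, hy2⟩ : ∃ y : ℝ, 0 < y ∧ y ≤ -s ∧ y ≤ 1 / (2 * Q) :=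
    ⟨min (-s) (1 / (2 * Q)), by positivity, min_le_left _ _, min_le_right _ _⟩
  have k1 := key (-y) ⟨by linarith, by linarith⟩
  have k2 := hlow (-y) ⟨by linarith [hs.1], by linarith⟩
  have k3 := Real.log_le_log (by positivity) k2
  rw [Real.log_mul hκ.ne' (Real.exp_pos _).ne', Real.log_exp] at k3
  have k4 : 2 * Q ≤ 1 / y := by
    rw [le_div_iff₀ hy0]; rw [le_div_iff₀ (by positivity)] at hy2; linarith
  have e1 : 1 / (256 * -y) = -(1 / 256) * (1 / y) := by field_simp
  have e2 : 1 / -y = -(1 / y) := by field_simp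
  rw [e1] at k3
  rw [e2] at k1
  have a1 := neg_abs_le (Real.log κ)
  have a2 := le_abs_self B
  nlinarith [sq_nonneg C]

lemma N_grow (h : VS v vx vxx vt A Ax C) {t0 : ℝ} (ht0 : t0 ∈ Ioo (-1 : ℝ) 0)
    (hs : -t0 * (64 * C ^ 2) ≤ 1)
    (hS : ∀ t ∈ Ico t0 0, Real.exp (1 / (16 * t)) ≤ Hf v t) (hN0 : Nf v vx t0 ≤ -1 / t0) :
    ∀ t ∈ Ico t0 0, Nf v vx t ≤ 8 / (-t0) := by
  intro t ht
  have hsub : ∀ t ∈ Ico t0 (0:ℝ), t ∈ Ioo (-1 : ℝ) 0 := fun t ht => ⟨ht0.1.trans_le ht.1, ht.2⟩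
  choose! N' hN1 hN2 using fun t (ht : t ∈ Ico t0 (0:ℝ)) => N_deriv h (hsub t ht) (hS t ht)
  set c := 8 * C ^ 2
  have hc : 1 ≤ c := by have := h.C1; simp only [c]; nlinarith
  set N := Nf v vx
  have hN0' : ∀ r ∈ Ico t0 (0:ℝ), 0 ≤ N r := fun r hr => Nf_nonneg hr.2
  have h0 := ht0.2
  have hA := anti_of (g := fun s => c * t0 * s - Real.exp (c * s) * (N s + 1)⁻¹)
    (g' := fun s => c * t0 - (Real.exp (c * s) * c * (N s + 1)⁻¹ +
      Real.exp (c * s) * (-N' s / (N s + 1) ^ 2))) (s := t0) (t := t) ht.1 ?_ ?_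
  · have p0 := hN0' t ht
    have e1 : Real.exp (c * t) ≤ 1 := Real.exp_le_one_iff.2 (by nlinarith [ht.2])
    have e2 : 1 / 2 ≤ Real.exp (c * t0) := by
      have := Real.add_one_le_exp (c * t0); nlinarith
    have e3 : -t0 / 2 ≤ (N t0 + 1)⁻¹ := by
      have p1 := hN0' t0 ⟨le_rfl, ht0.2⟩
      rw [le_inv_comm₀ (by linarith) (by linarith)]
      have : (-t0 / 2)⁻¹ = 2 * (-1 / t0) := by have := ht0.2.ne; field_simp
      rw [this]
      have : 1 ≤ -1 / t0 := by rw [le_div_iff_of_neg ht0.2]; linarith [ht0.1]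
      linarith
    have e4 : 1 / 2 * (-t0 / 2) ≤ Real.exp (c * t0) * (N t0 + 1)⁻¹ :=
      mul_le_mul e2 e3 (by linarith) (Real.exp_pos _).le
    have e5 : Real.exp (c * t) * (N t + 1)⁻¹ ≤ (N t + 1)⁻¹ :=
      mul_le_of_le_one_left (by positivity) e1
    have e6 : -t0 / 8 ≤ (N t + 1)⁻¹ := by
      have : c * t0 * t ≥ 0 := by
        have := mul_nonneg_of_nonpos_of_nonpos h0.le ht.2.le
        nlinarith
      have : c * t0 * t0 ≤ -t0 / 8 := by nlinarith
      linarith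
    rw [le_inv_comm₀ (by linarith) (by linarith)] at e6
    have : (-t0 / 8)⁻¹ = 8 / (-t0) := by field_simp
    linarith
  · intro r hr
    have hr' : r ∈ Ico t0 (0:ℝ) := ⟨hr.1, hr.2.trans_lt ht.2⟩
    have d1 : HasDerivAt (fun s : ℝ => c * t0 * s) (c * t0) r := by
      simpa using (hasDerivAt_id r).const_mul (c * t0)
    have d2 : HasDerivAt (fun s : ℝ => Real.exp (c * s)) (Real.exp (c * r) * c) r := by
      simpa using ((hasDerivAt_id r).const_mul c).exp
    have d3 := ((hN1 r hr').add_const 1).inv (by have := hN0' r hr'; positivity)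
    exact d1.sub (d2.mul d3)
  · intro r hr
    have hr' : r ∈ Ico t0 (0:ℝ) := ⟨hr.1, hr.2.trans_lt ht.2⟩
    have p := hN0' r hr'
    have hV := Vf_nonneg (v := v) (vx := vx) (vxx := vxx) r
    have q1 : N' r ≤ c * (-r * N r ^ 2 + N r - r) := by
      refine (hN2 r hr').trans ?_
      nlinarith [hr'.2]
    have hr0 := hr'.2
    have q2 : N' r / (N r + 1) ^ 2 ≤ c * (N r + 1)⁻¹ - c * r := by
      rw [div_le_iff₀ (by positivity)]
      refine q1.trans ?_
      have : (c * (N r + 1)⁻¹ - c * r) * (N r + 1) ^ 2 = c * (N r + 1) - c * r * (N r + 1) ^ 2 := by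
        field_simp
      rw [this]
      have : 0 ≤ c * (-r) * N r := by have : 0 ≤ -r := by linarith
                                      positivity
      nlinarith
    have e1 : Real.exp (c * r) ≤ 1 := Real.exp_le_one_iff.2 (by nlinarith)
    have e0 := Real.exp_pos (c * r)
    have q3 := mul_le_mul_of_nonneg_left q2 e0.le
    have q4 : Real.exp (c * r) * (c * (-r)) ≤ c * (-r) :=
      mul_le_of_le_one_left (mul_nonneg (by linarith) (by linarith)) e1
    have q5 : Real.exp (c * r) * (-N' r / (N r + 1) ^ 2) =
      -(Real.exp (c * r) * (N' r / (N r + 1) ^ 2)) := by ring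
    rw [q5]
    nlinarith [hr'.1]

lemma freq (h : VS v vx vxx vt A Ax C) {κ δ : ℝ} (hκ : 0 < κ) (hδ : 0 < δ)
    (hlow : ∀ t ∈ Ioo (-δ) 0, κ * Real.exp (1 / (256 * t)) ≤ Hf v t) :
    ∃ t0 Nb, FQ v vx vxx t0 Nb := by
  have hC := h.C1
  obtain ⟨d, hd0, hd1, hd2, hd3, hd4⟩ : ∃ d : ℝ, 0 < d ∧ d ≤ δ ∧ d ≤ 1 ∧
      d ≤ 1 / (240 * C ^ 2) ∧ d ≤ (15 / 256) / (1 + |Real.log κ|) :=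
    ⟨min (min δ 1) (min (1 / (240 * C ^ 2)) ((15 / 256) / (1 + |Real.log κ|))), by positivity,
      (min_le_left _ _).trans (min_le_left _ _), (min_le_left _ _).trans (min_le_right _ _),
      (min_le_right _ _).trans (min_le_left _ _), (min_le_right _ _).trans (min_le_right _ _)⟩
  have hS : ∀ t ∈ Ioo (-d) (0:ℝ), Real.exp (1 / (16 * t)) ≤ Hf v t := by
    intro t ht
    refine le_trans ?_ (hlow t ⟨by linarith [ht.1], ht.2⟩)
    nth_rw 1 [← Real.exp_log hκ]
    rw [← Real.exp_add]
    apply Real.exp_le_exp.2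
    have e : 1 / (256 * t) - 1 / (16 * t) = (15 / 256) / (-t) := by
      have := ht.2.ne; field_simp; norm_num
    have : 1 + |Real.log κ| ≤ (15 / 256) / (-t) := by
      rw [le_div_iff₀ (by linarith [ht.2])]
      rw [le_div_iff₀ (by positivity)] at hd4
      nlinarith [ht.1, abs_nonneg (Real.log κ)]
    linarith [neg_abs_le (Real.log κ)]
  obtain ⟨t0, ht0, hN0⟩ := exists_t0 h hκ hd0 hd2
    (fun t ht => hlow t ⟨by linarith [ht.1], ht.2⟩) hS
  have hsub : ∀ t ∈ Ico t0 (0:ℝ), t ∈ Ioo (-d) (0:ℝ) := fun t ht => ⟨ht0.1.trans_le ht.1, ht.2⟩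
  have hsub' : ∀ t ∈ Ico t0 (0:ℝ), t ∈ Ioo (-1 : ℝ) 0 := fun t ht =>
    ⟨by linarith [(hsub t ht).1], ht.2⟩
  have ht01 : t0 ∈ Ioo (-1 : ℝ) 0 := ⟨by linarith [ht0.1], ht0.2⟩
  rw [le_div_iff₀ (by positivity)] at hd3
  have hsm : -t0 * (240 * C ^ 2) ≤ 1 := by
    have : -t0 ≤ d := by linarith [ht0.1]
    have := mul_le_mul_of_nonneg_right this (by positivity : 0 ≤ 240 * C ^ 2)
    linarith
  have hN := N_grow h ht01 (by have := ht0.2; nlinarith [sq_nonneg C]) (fun t ht => hS t (hsub t ht)) hN0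
  refine ⟨t0, 8 / (-t0), ht01, fun t ht => hS t (hsub t ht), hN, ?_, ?_⟩
  · intro t ht t' ht' htt
    choose! l hl1 hl2 hl3 using fun t (ht : t ∈ Ico t0 (0:ℝ)) =>
      logH h (hsub' t ht) (hS t (hsub t ht))
    have hA := anti_of (g := fun r => Real.log (Hf v r) - 120 * C ^ 2 * r)
      (g' := fun r => l r - 120 * C ^ 2) (s := t) (t := t') htt ?_ ?_
    · have p1 : 0 < Hf v t := (Real.exp_pos _).trans_le (hS t (hsub t ht))
      have p2 : 0 < Hf v t' := (Real.exp_pos _).trans_le (hS t' (hsub t' ht'))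
      have : Real.log (Hf v t') ≤ Real.log (2 * Hf v t) := by
        rw [Real.log_mul (by norm_num) p1.ne']
        have : 120 * C ^ 2 * (t' - t) ≤ 1 / 2 := by
          have : t' - t ≤ -t0 := by linarith [ht'.2, ht.1]
          have := mul_le_mul_of_nonneg_left this (by positivity : 0 ≤ 120 * C ^ 2)
          linarith
        have := Real.log_two_gt_d9
        linarith
      exact (Real.log_le_log_iff p2 (by positivity)).1 this
    · intro r hr
      have d2 : HasDerivAt (fun s : ℝ => 120 * C ^ 2 * s) (120 * C ^ 2) r := by
        simpa using (hasDerivAt_id r).const_mul (120 * C ^ 2)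
      exact (hl1 r ⟨ht.1.trans hr.1, hr.2.trans_lt ht'.2⟩).sub d2
    · intro r hr
      have hr' : r ∈ Ico t0 (0:ℝ) := ⟨ht.1.trans hr.1, hr.2.trans_lt ht'.2⟩
      have := hl2 r hr'
      have h2 : Nf v vx r / r ≤ 0 :=
        div_nonpos_of_nonneg_of_nonpos (Nf_nonneg hr'.2) hr'.2.le
      linarith
  · have hNb : 0 ≤ 8 / (-t0) := div_nonneg (by norm_num) (by linarith [ht0.2])
    refine ⟨8 * C ^ 2 * ((8 / (-t0)) ^ 2 + 8 / (-t0) + 1), by positivity, fun t ht => ?_⟩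
    obtain ⟨N', h1, h2⟩ := N_deriv h (hsub' t ht) (hS t (hsub t ht))
    refine ⟨N', h1, h2.trans ?_⟩
    gcongr
    have a := hN t ht
    have a0 : 0 ≤ Nf v vx t := Nf_nonneg ht.2
    have b1 := (hsub' t ht).1
    have : -t * Nf v vx t ^ 2 ≤ 1 * (8 / (-t0)) ^ 2 :=
      mul_le_mul (by linarith) (pow_le_pow_left₀ a0 a 2) (by positivity) (by norm_num)
    linarith

lemma good_times {t0 Nb : ℝ} (q : FQ v vx vxx t0 Nb) {δ η : ℝ} (hδ : 0 < δ) (hη : 0 < η)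
    (hη1 : η < 1) : ∃ t1 ∈ Ico t0 (0:ℝ), ∀ t ∈ Ico t1 0, ∃ t' ∈ Ioo t ((1 - η) * t),
      t' ^ 2 * Vf v vx vxx t' ≤ δ := by
  obtain ⟨C3, hC3, hN⟩ := q.Nd
  choose! N' hN1 hN2 using hN
  set G : ℝ → ℝ := fun t => Nf v vx t - C3 * t
  have hGd : ∀ t ∈ Ico t0 (0:ℝ), HasDerivAt G (N' t - C3) t := fun t ht => by
    have d2 : HasDerivAt (fun s : ℝ => C3 * s) C3 t := by
      simpa using (hasDerivAt_id t).const_mul C3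
    exact (hN1 t ht).sub d2
  have hG0 : ∀ t ∈ Ico t0 (0:ℝ), 0 ≤ G t := fun t ht => by
    have : 0 ≤ Nf v vx t := Nf_nonneg ht.2
    simp only [G]; nlinarith [ht.2]
  have hGa : ∀ s ∈ Ico t0 (0:ℝ), ∀ t ∈ Ico t0 (0:ℝ), s ≤ t → G t ≤ G s := by
    intro s hs t ht hst
    refine anti_of hst (g' := fun r => N' r - C3) (fun r hr => hGd r ⟨hs.1.trans hr.1,
      hr.2.trans_lt ht.2⟩) (fun r hr => ?_)
    have hr' : r ∈ Ico t0 (0:ℝ) := ⟨hs.1.trans hr.1, hr.2.trans_lt ht.2⟩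
    have := hN2 r hr'
    have hV := Vf_nonneg (v := v) (vx := vx) (vxx := vxx) r
    nlinarith [hr'.2]
  have hne : (G '' Ico t0 (0:ℝ)).Nonempty := ⟨G t0, t0, ⟨le_rfl, q.ht0.2⟩, rfl⟩
  have hbd : BddBelow (G '' Ico t0 (0:ℝ)) := ⟨0, by rintro _ ⟨t, ht, rfl⟩; exact hG0 t ht⟩
  obtain ⟨_, ⟨t1, ht1, rfl⟩, hlt⟩ := exists_lt_of_csInf_lt hne
    (lt_add_of_pos_right (sInf (G '' Ico t0 (0:ℝ))) (by positivity : 0 < δ * η / 4))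
  refine ⟨t1, ht1, fun t ht => ?_⟩
  have ht' : t ∈ Ico t0 (0:ℝ) := ⟨ht1.1.trans ht.1, ht.2⟩
  have hlt2 : t < (1 - η) * t := by nlinarith [ht.2]
  have ht2 : (1 - η) * t ∈ Ico t0 (0:ℝ) := ⟨by linarith [ht'.1], by nlinarith [ht.2]⟩
  have hs2 : ∀ r ∈ Icc t ((1 - η) * t), r ∈ Ico t0 (0:ℝ) := fun r hr =>
    ⟨ht'.1.trans hr.1, hr.2.trans_lt ht2.2⟩
  obtain ⟨c, hc, hcs⟩ := exists_hasDerivAt_eq_slope G (fun r => N' r - C3) hlt2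
    (fun r hr => (hGd r (hs2 r hr)).continuousAt.continuousWithinAt)
    (fun r hr => hGd r (hs2 r ⟨hr.1.le, hr.2.le⟩))
  refine ⟨c, hc, ?_⟩
  have b1 := hN2 c (hs2 c ⟨hc.1.le, hc.2.le⟩)
  have b2 : sInf (G '' Ico t0 (0:ℝ)) ≤ G ((1 - η) * t) := csInf_le hbd ⟨_, ht2, rfl⟩
  have b3 := hGa t1 ht1 t ht' ht.1
  have e : (1 - η) * t - t = η * (-t) := by ring
  rw [e] at hcs
  have hpos : 0 < η * (-t) := mul_pos hη (by linarith [ht.2])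
  have hcs' := (eq_div_iff hpos.ne').1 hcs
  have b4 : -(δ * η / 4) ≤ (c / 2 * Vf v vx vxx c) * (η * (-t)) := by
    have : (N' c - C3) * (η * (-t)) ≤ (c / 2 * Vf v vx vxx c) * (η * (-t)) :=
      mul_le_mul_of_nonneg_right (by linarith) hpos.le
    linarith
  have hV := Vf_nonneg (v := v) (vx := vx) (vxx := vxx) c
  have b5 : (-c) * Vf v vx vxx c * (-t) ≤ δ / 2 := by
    have : η * ((-c) * Vf v vx vxx c * (-t)) ≤ η * (δ / 2) := by linarith
    exact le_of_mul_le_mul_left this hη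
  have b6 : (-c) * Vf v vx vxx c * (-c) ≤ (-c) * Vf v vx vxx c * (-t) :=
    mul_le_mul_of_nonneg_left (by linarith [hc.1])
      (mul_nonneg (by have := hc.2; linarith [ht2.2]) hV)
  nlinarith

lemma H_low {t0 Nb : ℝ} (h : VS v vx vxx vt A Ax C) (q : FQ v vx vxx t0 Nb) :
    ∃ c > 0, ∃ p : ℕ, ∀ t ∈ Ico t0 (0:ℝ), c * (-t) ^ p ≤ Hf v t := by
  obtain ⟨K, hK⟩ := logH_lower h q.ht0 q.hS q.hN
  obtain ⟨p, hp⟩ := exists_nat_ge (41 / 20 * Nb + 1 / 2)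
  refine ⟨Real.exp (-K), Real.exp_pos _, p, fun t ht => ?_⟩
  have hH : 0 < Hf v t := (Real.exp_pos _).trans_le (q.hS t ht)
  have h0 : 0 < -t := by linarith [ht.2]
  rw [← Real.log_le_log_iff (by positivity) hH, Real.log_mul (Real.exp_pos _).ne' (by positivity),
    Real.log_exp, Real.log_pow]
  have h1 : Real.log (-t) ≤ 0 := Real.log_nonpos h0.le (by linarith [q.ht0.1, ht.1])
  have := hK t ht
  nlinarith

lemma N_low {t0 Nb K : ℝ} (h : VS v vx vxx vt A Ax C) (q : FQ v vx vxx t0 Nb) (hK : 0 < K)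
    (hm : ∀ t ∈ Ico t0 (0:ℝ), Hf v t ≤ K * ((-t) ^ 2 * Real.sqrt (-t))) :
    ∃ t1 ∈ Ico t0 (0:ℝ), ∀ t ∈ Ico t1 (0:ℝ), 9 / 10 ≤ Nf v vx t := by
  obtain ⟨C3, hC3, hN⟩ := q.Nd
  choose! N' hN1 hN2 using hN
  obtain ⟨d, hd0, hd1, hd2⟩ : ∃ d : ℝ, 0 < d ∧ d ≤ -t0 ∧ d ≤ 1 / (20 * (C3 + 1)) :=
    ⟨min (-t0) (1 / (20 * (C3 + 1))), by have := q.ht0.2; have : 0 < -t0 := by linarith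
                                         positivity, min_le_left _ _, min_le_right _ _⟩
  rw [le_div_iff₀ (by positivity)] at hd2
  refine ⟨-d, ⟨by linarith, by linarith⟩, fun t ht => ?_⟩
  by_contra hcon
  push Not at hcon
  have ht0 : t ∈ Ico t0 (0:ℝ) := ⟨by linarith [ht.1], ht.2⟩
  have hN' : ∀ s ∈ Ico t (0:ℝ), Nf v vx s ≤ 19 / 20 := by
    intro s hs
    have := anti_of (g := fun r => Nf v vx r - C3 * r) (g' := fun r => N' r - C3) hs.1 ?_ ?_
    · nlinarith [hs.2, ht.1]
    · intro r hr
      have d2 : HasDerivAt (fun s : ℝ => C3 * s) C3 r := by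
        simpa using (hasDerivAt_id r).const_mul C3
      exact (hN1 r ⟨ht0.1.trans hr.1, hr.2.trans_lt hs.2⟩).sub d2
    · intro r hr
      have hr' : r ∈ Ico t0 (0:ℝ) := ⟨ht0.1.trans hr.1, hr.2.trans_lt hs.2⟩
      have := hN2 r hr'
      have hV := Vf_nonneg (v := v) (vx := vx) (vxx := vxx) r
      nlinarith [hr'.2]
  obtain ⟨K2, hK2⟩ := logH_lower h (t1 := t) ⟨by linarith [q.ht0.1, ht0.1], ht.2⟩
    (fun s hs => q.hS s ⟨ht0.1.trans hs.1, hs.2⟩) hN'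
  -- choose s close to 0
  set Q := 20 * (|K2| + |Real.log K| + 1)
  have hsmall : ∃ y : ℝ, 0 < y ∧ y ≤ -t ∧ Real.log y ≤ -Q := by
    refine ⟨min (-t) (Real.exp (-Q)), by have := ht.2; have : 0 < -t := by linarith
                                         positivity, min_le_left _ _, ?_⟩
    have := Real.log_le_log (by have := ht.2; have : 0 < -t := by linarith
                                positivity) (min_le_right (-t) (Real.exp (-Q)))
    rwa [Real.log_exp] at this
  obtain ⟨y, hy0, hy1, hy2⟩ := hsmall
  have k1 := hK2 (-y) ⟨by linarith, by linarith⟩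
  have k2 := hm (-y) ⟨by linarith [ht0.1], by linarith⟩
  rw [neg_neg] at k1 k2
  have hH : 0 < Hf v (-y) := (Real.exp_pos _).trans_le (q.hS _ ⟨by linarith [ht0.1], by linarith⟩)
  have k3 := Real.log_le_log hH k2
  rw [Real.log_mul hK.ne' (by positivity), Real.log_mul (by positivity) (by positivity),
    Real.log_pow, Real.log_sqrt hy0.le] at k3
  push_cast at k3
  have a1 := le_abs_self K2
  have a2 := le_abs_self (Real.log K)
  have a3 := abs_nonneg K2
  have a4 := abs_nonneg (Real.log K)
  have : Q = 20 * (|K2| + |Real.log K| + 1) := rfl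
  linarith

end main

open Set Filter Topology

structure CoreS (U Ux Uxx Ut A Ax : ℝ → ℝ → ℝ) : Prop where
  cU : Continuous (fun q : ℝ × ℝ => U q.1 q.2)
  cUx : Continuous (fun q : ℝ × ℝ => Ux q.1 q.2)
  cUxx : Continuous (fun q : ℝ × ℝ => Uxx q.1 q.2)
  cUt : Continuous (fun q : ℝ × ℝ => Ut q.1 q.2)
  cA : ∀ t, Continuous (fun x => A x t)
  cAx : ∀ t, Continuous (fun x => Ax x t)
  dx : ∀ x ∈ Ioo (-1 : ℝ) 1, ∀ t ∈ Ioo (-1 : ℝ) 0, HasDerivAt (fun y => U y t) (Ux x t) x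
  dxx : ∀ x ∈ Ioo (-1 : ℝ) 1, ∀ t ∈ Ioo (-1 : ℝ) 0, HasDerivAt (fun y => Ux y t) (Uxx x t) x
  dt : ∀ x ∈ Icc (-1 : ℝ) 1, ∀ t ∈ Ioo (-1 : ℝ) 0, HasDerivAt (fun s => U x s) (Ut x t) t
  dA : ∀ x ∈ Ioo (-1 : ℝ) 1, ∀ t ∈ Ioo (-1 : ℝ) 0, HasDerivAt (fun y => A y t) (Ax x t) x
  bA : ∀ x ∈ Icc (-1 : ℝ) 1, ∀ t ∈ Ioo (-1 : ℝ) 0, |A x t - 1| ≤ |t| / 100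
  bAx : ∀ x ∈ Icc (-1 : ℝ) 1, ∀ t ∈ Ioo (-1 : ℝ) 0, |Ax x t| ≤ 1 / 100
  b : ∀ x t, |U x t| ≤ 1 ∧ |Ux x t| ≤ 1 ∧ |Uxx x t| ≤ 1 ∧ |Ut x t| ≤ 1
  e : ∀ x ∈ Icc (-1 : ℝ) 1, ∀ t ∈ Ioo (-1 : ℝ) 0,
    |Ut x t - A x t * Uxx x t| ≤ (|Ux x t| + |U x t|) / 100

noncomputable def chi (x : ℝ) : ℝ := (max 0 (1 - x ^ 2)) ^ 2
noncomputable def chi1 (x : ℝ) : ℝ := -4 * x * max 0 (1 - x ^ 2)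
noncomputable def chi2 (x : ℝ) : ℝ := 12 * min (x ^ 2) 1 - 4

lemma chi_eq {x : ℝ} (hx : x ∈ Icc (-1 : ℝ) 1) :
    chi x = (1 - x ^ 2) ^ 2 ∧ chi1 x = -4 * x * (1 - x ^ 2) ∧ chi2 x = 12 * x ^ 2 - 4 := by
  have : x ^ 2 ≤ 1 := by nlinarith [hx.1, hx.2]
  unfold chi chi1 chi2
  rw [max_eq_right (by linarith), min_eq_left this]
  exact ⟨rfl, rfl, rfl⟩

lemma chi_bd (x : ℝ) : 0 ≤ chi x ∧ chi x ≤ 1 ∧ |chi1 x| ≤ 4 ∧ |chi2 x| ≤ 8 := by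
  by_cases hx : x ∈ Icc (-1 : ℝ) 1
  · obtain ⟨e1, e2, e3⟩ := chi_eq hx
    rw [e1, e2, e3]
    have h0 := sq_nonneg x
    have : x ^ 2 ≤ 1 := by nlinarith [hx.1, hx.2]
    refine ⟨by positivity, by nlinarith, ?_, abs_le.2 ⟨by linarith, by linarith⟩⟩
    rw [abs_mul, abs_mul, abs_of_nonneg (by linarith : 0 ≤ 1 - x ^ 2)]
    have := abs_le.2 hx
    have a0 := abs_nonneg x
    norm_num
    nlinarith
  · have : 1 ≤ x ^ 2 := by
      by_contra hc
      push Not at hc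
      exact hx ⟨by nlinarith, by nlinarith⟩
    unfold chi chi1 chi2
    rw [max_eq_left (by linarith), min_eq_right this]
    norm_num

lemma chi_c : Continuous chi ∧ Continuous chi1 ∧ Continuous chi2 := by
  unfold chi chi1 chi2
  refine ⟨by fun_prop, by fun_prop, by fun_prop⟩

lemma chi_d {x : ℝ} (hx : x ∈ Ioo (-1 : ℝ) 1) :
    HasDerivAt chi (chi1 x) x ∧ HasDerivAt chi1 (chi2 x) x := by
  have hn : ∀ᶠ y in 𝓝 x, y ∈ Icc (-1 : ℝ) 1 := by
    filter_upwards [Ioo_mem_nhds hx.1 hx.2] with y hy using ⟨hy.1.le, hy.2.le⟩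
  obtain ⟨_, e2, e3⟩ := chi_eq ⟨hx.1.le, hx.2.le⟩
  have d0 : HasDerivAt (fun y : ℝ => 1 - y ^ 2) (-(2 * x)) x := by
    simpa using ((hasDerivAt_id x).pow 2).const_sub 1
  constructor
  · rw [e2]
    refine HasDerivAt.congr_of_eventuallyEq ((d0.pow 2).congr_deriv ?_)
      (hn.mono fun y hy => (chi_eq hy).1)
    push_cast; ring
  · rw [e3]
    have d1 : HasDerivAt (fun y : ℝ => -4 * y) (-4) x := by
      simpa using (hasDerivAt_id x).const_mul (-4)
    refine HasDerivAt.congr_of_eventuallyEq ((d1.mul d0).congr_deriv ?_)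
      (hn.mono fun y hy => (chi_eq hy).2.1)
    ring

section core
variable {U Ux Uxx Ut A Ax : ℝ → ℝ → ℝ}

lemma CoreS.vs (h : CoreS U Ux Uxx Ut A Ax) : VS (fun x t => chi x * U x t)
    (fun x t => chi1 x * U x t + chi x * Ux x t)
    (fun x t => chi2 x * U x t + 2 * chi1 x * Ux x t + chi x * Uxx x t)
    (fun x t => chi x * Ut x t) A Ax 200 := by
  obtain ⟨k0, k1, k2⟩ := chi_c
  have c0 := h.cU; have c1 := h.cUx; have c2 := h.cUxx; have c3 := h.cUt
  have bd : ∀ x t, |chi x * U x t| ≤ 1 ∧ |chi1 x * U x t + chi x * Ux x t| ≤ 5 ∧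
      |chi2 x * U x t + 2 * chi1 x * Ux x t + chi x * Uxx x t| ≤ 17 ∧ |chi x * Ut x t| ≤ 1 := by
    intro x t
    obtain ⟨b0, b1, b2, b3⟩ := h.b x t
    obtain ⟨x0, x1, x2, x3⟩ := chi_bd x
    have x1' : |chi x| ≤ 1 := by rwa [abs_of_nonneg x0]
    have m : ∀ p q B : ℝ, |p| ≤ B → |q| ≤ 1 → |p * q| ≤ B := fun p q B h1 h2 => by
      rw [abs_mul]
      calc |p| * |q| ≤ B * 1 := mul_le_mul h1 h2 (abs_nonneg _) ((abs_nonneg _).trans h1)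
        _ = B := mul_one B
    have m1 := m _ _ _ x1' b0
    have m2 := m _ _ _ x2 b0
    have m3 := m _ _ _ x1' b1
    have m4 := m _ _ _ x3 b0
    have m5 := m _ _ _ x2 b1
    have m6 := m _ _ _ x1' b2
    have m7 := m _ _ _ x1' b3
    refine ⟨m1, ?_, ?_, m7⟩
    · exact (abs_add_le _ _).trans (by linarith)
    · rw [mul_assoc]
      refine (abs_add_three _ _ _).trans ?_
      rw [abs_mul 2, abs_two]; linarith
  refine ⟨by fun_prop, by fun_prop, by fun_prop, by fun_prop, h.cA, h.cAx, ?_, ?_, h.dA, h.bA,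
    h.bAx, by norm_num, ?_, ?_, ?_⟩
  · intro t ht
    have c0 := cfix c0 t; have c1 := cfix c1 t; have c2 := cfix c2 t
    have z1 := chi_eq (x := 1) (by norm_num)
    have z2 := chi_eq (x := -1) (by norm_num)
    refine ⟨by fun_prop, by fun_prop, by fun_prop, ?_, ?_, ?_, ?_, ?_, ?_⟩
    · intro x hx; exact (chi_d hx).1.mul (h.dx x hx t ht)
    · intro x hx
      refine (((chi_d hx).2.mul (h.dx x hx t ht)).add
        ((chi_d hx).1.mul (h.dxx x hx t ht))).congr_deriv (by ring)
    all_goals simp [z1, z2]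
  · intro x hx t ht; exact (h.dt x hx t ht).const_mul _
  · intro x t
    obtain ⟨a1, a2, a3, a4⟩ := bd x t
    exact ⟨by linarith, by linarith, by linarith, by linarith⟩
  · intro x hx t ht
    obtain ⟨a1, a2, a3, a4⟩ := bd x t
    have hA := h.bA x hx t ht
    have hA2 : |A x t| ≤ 2 := by
      have : |t| ≤ 1 := abs_le.2 ⟨ht.1.le, by linarith [ht.2]⟩
      have := abs_le.1 hA
      exact abs_le.2 ⟨by linarith, by linarith⟩
    refine (abs_sub _ _).trans ?_
    rw [abs_mul (A x t)]
    nlinarith [abs_nonneg (A x t)]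
  · intro x hx t ht
    have hx1 : x ∈ Icc (-1 : ℝ) 1 := ⟨by linarith [hx.1], by linarith [hx.2]⟩
    have hA := h.bA x hx1 t ht
    have hA2 : |A x t| ≤ 101 / 100 := by
      have : |t| ≤ 1 := abs_le.2 ⟨ht.1.le, by linarith [ht.2]⟩
      have := abs_le.1 hA
      exact abs_le.2 ⟨by linarith, by linarith⟩
    have he := h.e x hx1 t ht
    obtain ⟨x0, x1, x2, x3⟩ := chi_bd x
    have xl : 9 / 16 ≤ chi x := by
      rw [(chi_eq hx1).1]
      have : x ^ 2 ≤ 1 / 4 := by nlinarith [hx.1, hx.2]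
      nlinarith
    have u1 : |U x t| ≤ 2 * |chi x * U x t| := by
      rw [abs_mul, abs_of_nonneg x0]; nlinarith [abs_nonneg (U x t)]
    have u2 : |Ux x t| ≤ 2 * |chi1 x * U x t + chi x * Ux x t| + 8 * |U x t| := by
      have : |chi x * Ux x t| ≤ |chi1 x * U x t + chi x * Ux x t| + |chi1 x * U x t| := by
        have := abs_sub (chi1 x * U x t + chi x * Ux x t) (chi1 x * U x t)
        rwa [add_sub_cancel_left] at this
      rw [abs_mul, abs_of_nonneg x0] at this
      have h4 : |chi1 x * U x t| ≤ 4 * |U x t| := by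
        rw [abs_mul]; exact mul_le_mul_of_nonneg_right x2 (abs_nonneg _)
      nlinarith [abs_nonneg (Ux x t)]
    have e1 : chi x * Ut x t - A x t * (chi2 x * U x t + 2 * chi1 x * Ux x t + chi x * Uxx x t)
      = chi x * (Ut x t - A x t * Uxx x t) - A x t * (chi2 x * U x t + 2 * chi1 x * Ux x t) := by
      ring
    rw [e1]
    have p1 : |chi x * (Ut x t - A x t * Uxx x t)| ≤ (|Ux x t| + |U x t|) / 100 := by
      rw [abs_mul, abs_of_nonneg x0]
      exact (mul_le_of_le_one_left (abs_nonneg _) x1).trans he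
    have p2 : |chi2 x * U x t + 2 * chi1 x * Ux x t| ≤ 8 * |U x t| + 8 * |Ux x t| := by
      refine (abs_add_le _ _).trans ?_
      rw [abs_mul, abs_mul, abs_mul, abs_two]
      nlinarith [abs_nonneg (U x t), abs_nonneg (Ux x t)]
    have p3 : |A x t * (chi2 x * U x t + 2 * chi1 x * Ux x t)| ≤
        101 / 100 * (8 * |U x t| + 8 * |Ux x t|) := by
      rw [abs_mul]
      exact mul_le_mul hA2 p2 (abs_nonneg _) (by norm_num)
    have := abs_sub (chi x * (Ut x t - A x t * Uxx x t))
      (A x t * (chi2 x * U x t + 2 * chi1 x * Ux x t))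
    have n1 := abs_nonneg (chi x * U x t)
    have n2 := abs_nonneg (chi1 x * U x t + chi x * Ux x t)
    linarith

/-- lower bound for `H` -/
lemma CoreS.Hlow (h : CoreS U Ux Uxx Ut A Ax) {xa xb κ δ : ℝ} (hab : xa < xb)
    (ha : -(1 / 8) ≤ xa) (hb : xb ≤ 1 / 8) (hκ : 0 < κ)
    (hU : ∀ x ∈ Icc xa xb, ∀ t ∈ Ioo (-δ) 0, κ ≤ |U x t|) :
    ∃ κ' > 0, ∀ t ∈ Ioo (-δ) 0, κ' * Real.exp (1 / (256 * t)) ≤ Hf (fun x t => chi x * U x t) t := by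
  refine ⟨(xb - xa) * (κ / 2) ^ 2, mul_pos (by linarith) (by positivity), fun t ht => ?_⟩
  have hc : Continuous (fun x => (chi x * U x t) ^ 2 * Eg x t) := by
    have := cfix h.cU t; have := chi_c.1; have := Eg_cont t; fun_prop
  have s1 : ∫ x in xa..xb, (chi x * U x t) ^ 2 * Eg x t ≤ Hf (fun x t => chi x * U x t) t := by
    unfold Hf
    apply intervalIntegral.integral_mono_interval (by linarith) hab.le (by linarith)
    · exact MeasureTheory.ae_of_all _ fun x => by have := Eg_pos x t; positivity
    · exact hc.intervalIntegrable _ _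
  refine le_trans ?_ s1
  have s2 : ∫ x in xa..xb, (κ / 2) ^ 2 * Real.exp (1 / (256 * t)) =
    (xb - xa) * (κ / 2) ^ 2 * Real.exp (1 / (256 * t)) := by
    rw [intervalIntegral.integral_const, smul_eq_mul]; ring
  rw [← s2]
  apply intervalIntegral.integral_mono_on hab.le (by simp) (hc.intervalIntegrable _ _)
  intro x hx
  have hx2 : x ^ 2 ≤ 1 / 64 := by nlinarith [hx.1, hx.2]
  have hx1 : x ∈ Icc (-1 : ℝ) 1 := ⟨by linarith [hx.1], by linarith [hx.2]⟩
  have xl : 1 / 2 ≤ chi x := by rw [(chi_eq hx1).1]; nlinarith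
  have hu := hU x hx t ht
  have : Real.exp (1 / (256 * t)) ≤ Eg x t := by
    unfold Eg
    apply Real.exp_le_exp.2
    have e : 1 / (256 * t) = (1 / 64) / (4 * t) := by have := ht.2.ne; field_simp; norm_num
    rw [e]
    exact div_le_div_of_nonpos_of_le (by linarith [ht.2]) hx2
  apply mul_le_mul _ this (Real.exp_pos _).le (sq_nonneg _)
  rw [← sq_abs (chi x * U x t), abs_mul, abs_of_nonneg (by linarith : 0 ≤ chi x)]
  apply pow_le_pow_left₀ (by positivity)
  nlinarith

/-- upper bound for `H` at a multiple zero -/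
lemma CoreS.Hup (h : CoreS U Ux Uxx Ut A Ax) {C : ℝ}
    (hU : ∀ x ∈ Icc (-1 : ℝ) 1, ∀ t ∈ Ioo (-1 : ℝ) 0, |U x t| ≤ C * (x ^ 2 + -t)) :
    ∃ K > 0, ∀ t ∈ Ioo (-1 : ℝ) 0,
      Hf (fun x t => chi x * U x t) t ≤ K * ((-t) ^ 2 * Real.sqrt (-t)) := by
  refine ⟨C ^ 2 * 200 * Real.sqrt (8 * Real.pi) + 1, by positivity, fun t ht => ?_⟩
  have hc : Continuous (fun x => (chi x * U x t) ^ 2 * Eg x t) := by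
    have := cfix h.cU t; have := chi_c.1; have := Eg_cont t; fun_prop
  have h0 : 0 < -t := by linarith [ht.2]
  set b : ℝ := 1 / (8 * (-t)) with hb
  have hb0 : 0 < b := by positivity
  have key : ∀ x ∈ Icc (-1 : ℝ) 1, (chi x * U x t) ^ 2 * Eg x t ≤
      C ^ 2 * 200 * (-t) ^ 2 * Real.exp (-b * x ^ 2) := by
    intro x hx
    set z := b * x ^ 2 with hz
    have hz0 : 0 ≤ z := by positivity
    have hxz : x ^ 2 = 8 * (-t) * z := by rw [hz, hb]; have := h0.ne'; have := ht.2.ne; field_simp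
    have eE : Eg x t = Real.exp (-z) * Real.exp (-z) := by
      unfold Eg
      rw [← Real.exp_add]
      congr 1
      rw [hxz]; have := ht.2.ne; field_simp; ring
    have q1 : (chi x * U x t) ^ 2 ≤ (C * (x ^ 2 + -t)) ^ 2 := by
      rw [← sq_abs (chi x * U x t)]
      apply pow_le_pow_left₀ (abs_nonneg _)
      rw [abs_mul, abs_of_nonneg (chi_bd x).1]
      exact (mul_le_of_le_one_left (abs_nonneg _) (chi_bd x).2.1).trans (hU x hx t ht)
    have q2 : (8 * z + 1) ^ 2 * Real.exp (-z) ≤ 200 := by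
      have := Real.quadratic_le_exp_of_nonneg hz0
      rw [Real.exp_neg, ← div_eq_mul_inv, div_le_iff₀ (Real.exp_pos _)]
      nlinarith
    rw [eE, ← mul_assoc, neg_mul, ← hz]
    apply mul_le_mul_of_nonneg_right _ (Real.exp_pos _).le
    calc (chi x * U x t) ^ 2 * Real.exp (-z) ≤ (C * (x ^ 2 + -t)) ^ 2 * Real.exp (-z) :=
          mul_le_mul_of_nonneg_right q1 (Real.exp_pos _).le
      _ = C ^ 2 * (-t) ^ 2 * ((8 * z + 1) ^ 2 * Real.exp (-z)) := by rw [hxz]; ring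
      _ ≤ C ^ 2 * (-t) ^ 2 * 200 := by gcongr
      _ = _ := by ring
  have s1 : Hf (fun x t => chi x * U x t) t ≤
      C ^ 2 * 200 * (-t) ^ 2 * ∫ x in (-1 : ℝ)..1, Real.exp (-b * x ^ 2) := by
    unfold Hf
    rw [← intervalIntegral.integral_const_mul]
    apply intervalIntegral.integral_mono_on (by norm_num) (hc.intervalIntegrable _ _) _ key
    exact Continuous.intervalIntegrable (by fun_prop) _ _
  have s2 : ∫ x in (-1 : ℝ)..1, Real.exp (-b * x ^ 2) ≤ Real.sqrt (8 * Real.pi) * Real.sqrt (-t) := by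
    rw [intervalIntegral.integral_of_le (by norm_num), ← Real.sqrt_mul (by positivity)]
    refine (MeasureTheory.setIntegral_le_integral (integrable_exp_neg_mul_sq hb0)
      (MeasureTheory.ae_of_all _ fun x => (Real.exp_pos _).le)).trans ?_
    rw [integral_gaussian]
    apply Real.sqrt_le_sqrt
    apply le_of_eq
    rw [hb]; field_simp
  calc _ ≤ _ := s1
    _ ≤ C ^ 2 * 200 * (-t) ^ 2 * (Real.sqrt (8 * Real.pi) * Real.sqrt (-t)) := by gcongr
    _ ≤ _ := by
      have : 0 ≤ (-t) ^ 2 * Real.sqrt (-t) := by positivity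
      nlinarith

end core

open Set Filter Topology

noncomputable def ga (y : ℝ) : ℝ := Real.exp (-(y ^ 2 / 4))

lemma ga_pos (y : ℝ) : 0 < ga y := Real.exp_pos _
lemma ga_c : Continuous ga := by unfold ga; fun_prop
lemma ga_le (y : ℝ) : ga y ≤ 1 := Real.exp_le_one_iff.2 (by have := sq_nonneg y; linarith)
lemma ga_d (y : ℝ) : HasDerivAt ga (-(y / 2) * ga y) y := by
  have h : HasDerivAt (fun y : ℝ => -(y ^ 2 / 4)) (-(y / 2)) y := by
    refine (((hasDerivAt_id y).pow 2).div_const 4).neg.congr_deriv ?_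
    simp; ring
  refine h.exp.congr_deriv ?_
  unfold ga; ring

lemma ga_int (p q : ℝ) (hpq : p ≤ q) : ∫ y in p..q, ga y ≤ 4 := by
  have e : ∀ y, ga y = Real.exp (-(1/4) * y ^ 2) := fun y => by unfold ga; congr 1; ring
  simp_rw [e]
  rw [intervalIntegral.integral_of_le hpq]
  refine (MeasureTheory.setIntegral_le_integral (integrable_exp_neg_mul_sq (by norm_num))
      (MeasureTheory.ae_of_all _ fun x => (Real.exp_pos _).le)).trans ?_
  rw [integral_gaussian]
  apply Real.sqrt_le_iff.2 ⟨by norm_num, ?_⟩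
  have := Real.pi_le_four
  rw [div_le_iff₀ (by norm_num)]; linarith

structure WS (w w1 w2 : ℝ → ℝ) (l lam δ : ℝ) : Prop where
  hl : 0 < l
  c0 : Continuous w
  c1 : Continuous w1
  c2 : Continuous w2
  d0 : ∀ y ∈ Ioo (-l) l, HasDerivAt w (w1 y) y
  d1 : ∀ y ∈ Ioo (-l) l, HasDerivAt w1 (w2 y) y
  z0 : w l = 0
  z0' : w (-l) = 0
  z1 : w1 l = 0
  z1' : w1 (-l) = 0
  n0 : ∫ y in (-l)..l, w y ^ 2 * ga y = 1
  n1 : ∫ y in (-l)..l, w1 y ^ 2 * ga y = lam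
  n2 : ∫ y in (-l)..l, (w2 y - y / 2 * w1 y + lam * w y) ^ 2 * ga y ≤ δ

lemma sub_int {f : ℝ → ℝ} (hf : Continuous f) (h0 : ∀ x, 0 ≤ f x) {a b p q : ℝ} (h1 : a ≤ p)
    (h2 : p ≤ q) (h3 : q ≤ b) : ∫ x in p..q, f x ≤ ∫ x in a..b, f x :=
  intervalIntegral.integral_mono_interval h1 h2 h3 (MeasureTheory.ae_of_all _ h0)
    (hf.intervalIntegrable _ _)

section ws
variable {w w1 w2 : ℝ → ℝ} {l lam δ : ℝ}

lemma WS.lam0 (h : WS w w1 w2 l lam δ) : 0 ≤ lam := by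
  rw [← h.n1]
  exact intervalIntegral.integral_nonneg (by have := h.hl; linarith) fun x _ => by
    have := ga_pos x; positivity

lemma WS.ftc (h : WS w w1 w2 l lam δ) {F F' : ℝ → ℝ} (hF : Continuous F) (hF' : Continuous F')
    (hd : ∀ x ∈ Ioo (-l) l, HasDerivAt F (F' x) x) {p q : ℝ} (hp : -l ≤ p) (hpq : p ≤ q)
    (hq : q ≤ l) : ∫ x in p..q, F' x = F q - F p :=
  intervalIntegral.integral_eq_sub_of_hasDerivAt_of_le hpq hF.continuousOn
    (fun x hx => hd x ⟨hp.trans_lt hx.1, hx.2.trans_le hq⟩) (hF'.intervalIntegrable _ _)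

lemma WS.tail (h : WS w w1 w2 l lam δ) :
    ∫ y in (-l)..l, y ^ 2 * w y ^ 2 * ga y ≤ 4 + 16 * lam := by
  have c0 := h.c0; have c1 := h.c1; have := ga_c; have hl := h.hl
  have e := h.ftc (F := fun y => y * w y ^ 2 * ga y)
    (F' := fun y => w y ^ 2 * ga y + 2 * y * w y * w1 y * ga y - y ^ 2 / 2 * w y ^ 2 * ga y)
    (by fun_prop) (by fun_prop) (fun y hy => by
      refine (((hasDerivAt_id y).mul ((h.d0 y hy).pow 2)).mul (ga_d y)).congr_deriv ?_
      simp; ring) le_rfl (by linarith) le_rfl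
  rw [h.z0, h.z0'] at e
  have m := int_le3 (F := fun y => 1 / 4 * (y ^ 2 * w y ^ 2 * ga y)) (f := fun y => w y ^ 2 * ga y)
    (g := fun y => w1 y ^ 2 * ga y) (k := fun y => w y ^ 2 * ga y + 2 * y * w y * w1 y * ga y - y ^ 2 / 2 * w y ^ 2 * ga y)
    (a := 1) (b := 4) (c := -1) (p := -l) (q := l) (by linarith) (by fun_prop) (by fun_prop)
    (by fun_prop) (by fun_prop) (fun y _ => by
      have := ga_pos y
      have : 0 ≤ (1/2 * y * w y - 2 * w1 y) ^ 2 * ga y := by positivity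
      nlinarith)
  rw [e, h.n0, h.n1, intervalIntegral.integral_const_mul] at m
  linarith

lemma WS.sup (h : WS w w1 w2 l lam δ) {y : ℝ} (hy : y ∈ Icc (-l) l) :
    w y ^ 2 * ga y ≤ 10 * (lam + 1) := by
  have c0 := h.c0; have c1 := h.c1; have := ga_c; have hl := h.hl
  have e := h.ftc (F := fun y => w y ^ 2 * ga y)
    (F' := fun y => 2 * w y * w1 y * ga y - y / 2 * w y ^ 2 * ga y)
    (by fun_prop) (by fun_prop) (fun y hy => by
      refine (((h.d0 y hy).pow 2).mul (ga_d y)).congr_deriv ?_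
      simp; ring) le_rfl hy.1 hy.2
  have s := sub_int (f := fun y => (2 * w y ^ 2 + w1 y ^ 2 + 1 / 4 * y ^ 2 * w y ^ 2) * ga y)
    (by fun_prop) (fun x => by have := ga_pos x; positivity) le_rfl hy.1 hy.2
  have m : ∫ y in (-l)..y, (2 * w y * w1 y * ga y - y / 2 * w y ^ 2 * ga y) ≤
     ∫ y in (-l)..y, (2 * w y ^ 2 + w1 y ^ 2 + 1 / 4 * y ^ 2 * w y ^ 2) * ga y := by
    apply intervalIntegral.integral_mono_on hy.1 (Continuous.intervalIntegrable (by fun_prop) _ _)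
      (Continuous.intervalIntegrable (by fun_prop) _ _)
    intro y _
    have := ga_pos y
    have h1 : 0 ≤ (w y - w1 y) ^ 2 * ga y := by positivity
    have h2 : 0 ≤ (1 + 1 / 2 * y) ^ 2 * w y ^ 2 * ga y := by positivity
    have h3 : 0 ≤ w y ^ 2 * ga y := by positivity
    have h4 : 0 ≤ y ^ 2 * w y ^ 2 * ga y := by positivity
    nlinarith
  have q := int_eq3 (F := fun y => (2 * w y ^ 2 + w1 y ^ 2 + 1 / 4 * y ^ 2 * w y ^ 2) * ga y)
    (f := fun y => w y ^ 2 * ga y)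
    (g := fun y => w1 y ^ 2 * ga y) (k := fun y => y ^ 2 * w y ^ 2 * ga y)
    (a := 2) (b := 1) (c := 1 / 4) (p := -l) (q := l) (by fun_prop) (by fun_prop)
    (by fun_prop) (by fun_prop) (fun y => by ring)
  rw [h.n0, h.n1] at q
  have t := h.tail
  have l0 := h.lam0
  simp only [h.z0'] at e
  linarith

/-- Gronwall -/
lemma WS.gron (h : WS w w1 w2 l lam δ) {Λ K y y0 : ℝ} (hΛ : lam ≤ Λ) (hy : -l ≤ y)
    (hyy : y ≤ y0) (hy0 : y0 ≤ l) (hK : -K ≤ y) (hK0 : y0 ≤ K) :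
    w y ^ 2 + w1 y ^ 2 ≤ Real.exp ((2 + K + Λ) * (2 * K)) *
      (w y0 ^ 2 + w1 y0 ^ 2 + Real.exp (K ^ 2 / 4) * δ) := by
  have c0 := h.c0; have c1 := h.c1; have c2 := h.c2; have := ga_c; have hl := h.hl
  have l0 := h.lam0
  set B := 2 + K + Λ with hB
  have hKK : 0 ≤ K := by linarith
  have hB0 : 0 ≤ B := by linarith
  have e := h.ftc (F := fun y => Real.exp (B * y) * (w y ^ 2 + w1 y ^ 2))
    (F' := fun y => Real.exp (B * y) * (B * (w y ^ 2 + w1 y ^ 2) + 2 * w y * w1 y + 2 * w1 y * w2 y))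
    (by fun_prop) (by fun_prop) (fun y hy => by
      have d := ((hasDerivAt_id y).const_mul B).exp
      refine (d.mul (((h.d0 y hy).pow 2).add ((h.d1 y hy).pow 2))).congr_deriv ?_
      simp; ring) hy hyy hy0
  set ee := fun y => w2 y - y / 2 * w1 y + lam * w y with hee
  have ce : Continuous ee := by fun_prop
  have m : ∫ s in y..y0, -(Real.exp (B * y0) * Real.exp (K ^ 2 / 4)) * (ee s ^ 2 * ga s) ≤
    ∫ s in y..y0, Real.exp (B * s) * (B * (w s ^ 2 + w1 s ^ 2) + 2 * w s * w1 s + 2 * w1 s * w2 s) := by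
    apply intervalIntegral.integral_mono_on hyy (Continuous.intervalIntegrable (by fun_prop) _ _)
      (Continuous.intervalIntegrable (by fun_prop) _ _)
    intro s hs
    have p1 : Real.exp (B * s) ≤ Real.exp (B * y0) := Real.exp_le_exp.2 (by nlinarith [hs.2])
    have hsK : |s| ≤ K := abs_le.2 ⟨hK.trans hs.1, hs.2.trans hK0⟩
    have p2 : 1 ≤ Real.exp (K ^ 2 / 4) * ga s := by
      unfold ga
      rw [← Real.exp_add]
      apply Real.one_le_exp
      have : s ^ 2 ≤ K ^ 2 := sq_le_sq' (by linarith [(abs_le.1 hsK).1]) (by linarith [(abs_le.1 hsK).2])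
      linarith
    have e2 : w2 s = ee s + s / 2 * w1 s - lam * w s := by simp only [hee]; ring
    have p3 : -(ee s ^ 2) ≤ B * (w s ^ 2 + w1 s ^ 2) + 2 * w s * w1 s + 2 * w1 s * w2 s := by
      rw [e2, hB]
      have a1 : 0 ≤ (K + s) * w1 s ^ 2 := mul_nonneg (by linarith [(abs_le.1 hsK).1]) (sq_nonneg _)
      have a2 : 0 ≤ (Λ - lam) * (w s ^ 2 + w1 s ^ 2) := mul_nonneg (by linarith) (by positivity)
      have a3 : 0 ≤ lam * (w s - w1 s) ^ 2 := by positivity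
      have a4 : 0 ≤ K * w s ^ 2 := by positivity
      nlinarith [sq_nonneg (w s + w1 s), sq_nonneg (ee s + w1 s), sq_nonneg (w s)]
    have p4 : Real.exp (B * s) * ee s ^ 2 ≤ Real.exp (B * y0) * Real.exp (K ^ 2 / 4) * (ee s ^ 2 * ga s) := by
      calc Real.exp (B * s) * ee s ^ 2 ≤ Real.exp (B * y0) * ee s ^ 2 := by gcongr
        _ = Real.exp (B * y0) * ee s ^ 2 * 1 := by ring
        _ ≤ Real.exp (B * y0) * ee s ^ 2 * (Real.exp (K ^ 2 / 4) * ga s) := by gcongr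
        _ = _ := by ring
    have p5 := mul_le_mul_of_nonneg_left p3 (Real.exp_pos (B * s)).le
    linarith
  rw [e, intervalIntegral.integral_const_mul] at m
  have s := sub_int (f := fun s => ee s ^ 2 * ga s) (by fun_prop)
    (fun x => by have := ga_pos x; positivity) hy hyy hy0
  have n2 := h.n2
  have s2 : ∫ s in y..y0, ee s ^ 2 * ga s ≤ δ := s.trans n2
  have r1 : Real.exp (B * y) * (w y ^ 2 + w1 y ^ 2) ≤ Real.exp (B * y0) *
     (w y0 ^ 2 + w1 y0 ^ 2 + Real.exp (K ^ 2 / 4) * δ) := by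
    have := mul_le_mul_of_nonneg_left s2 (by positivity : 0 ≤ Real.exp (B * y0) * Real.exp (K ^ 2 / 4))
    linarith
  have hδ : 0 ≤ δ := le_trans (intervalIntegral.integral_nonneg hyy fun x _ => by
    have := ga_pos x; positivity) s2
  have r2 : Real.exp (B * y0) ≤ Real.exp (B * y) * Real.exp (B * (2 * K)) := by
    rw [← Real.exp_add]; apply Real.exp_le_exp.2; nlinarith
  have r3 := r1.trans (mul_le_mul_of_nonneg_right r2
    (by positivity : 0 ≤ w y0 ^ 2 + w1 y0 ^ 2 + Real.exp (K ^ 2 / 4) * δ))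
  rw [mul_assoc] at r3
  exact le_of_mul_le_mul_left r3 (Real.exp_pos _)

end ws

open Set Filter Topology


lemma hlp_y4 {Λ y0 : ℝ} (hΛ : 0 ≤ Λ) (hy : 0 < y0) (h : 32 * (Λ + 1) ≤ y0 ^ 2) : 4 ≤ y0 := by nlinarith
lemma hlp_sq {a b : ℝ} (h : |a| ≤ b) : a ^ 2 ≤ b ^ 2 := sq_le_sq' (abs_le.1 h).1 (abs_le.1 h).2
lemma hlp_sq2 {a : ℝ} (h0 : 0 ≤ a) (h : a ≤ 1) : a ^ 2 ≤ a := by nlinarith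
lemma hlp_r {μ Λ I0 I1 z : ℝ} (hμ0 : 0 ≤ μ) (hΛ : 0 ≤ Λ)
    (b7 : I1 ≤ 2 * (μ * (1 + (1 + Λ ^ 2) / 2) + 1 / 2 * μ + (Λ + 1) * μ))
    (b4 : I0 ≤ μ + z) (b8 : z ≤ 1 / 2 * I1) : I0 ≤ (7 + 2 * Λ + Λ ^ 2) * μ := by
  nlinarith [mul_nonneg hμ0 (sq_nonneg Λ), mul_nonneg hμ0 hΛ]
lemma hlp_e {w w1 e a b g : ℝ} (hg : 0 < g) (hb : a ≤ b) :
    w1 ^ 2 * g ≤ 1 * (w1 ^ 2 * g + w * (e - a * w) * g) + 1 / 2 * (e ^ 2 * g) + (b + 1 / 2) * (w ^ 2 * g) := by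
  have k1 : 0 ≤ (w + e) ^ 2 * g := by positivity
  have k2 : 0 ≤ (b - a) * (w ^ 2 * g) := mul_nonneg (by linarith) (by positivity)
  linarith

section ws
variable {w w1 w2 : ℝ → ℝ} {l lam δ : ℝ}

lemma ga_int1 {p q : ℝ} (hp : 2 ≤ p) (hpq : p ≤ q) : ∫ y in p..q, ga y ≤ 1 := by
  have := ga_c
  have e : ∫ y in p..q, (y / 2) * ga y = ga p - ga q := by
    rw [intervalIntegral.integral_eq_sub_of_hasDerivAt (f := fun y => - ga y)
      (fun x _ => (ga_d x).neg.congr_deriv (by ring))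
      (Continuous.intervalIntegrable (by fun_prop) _ _)]
    ring
  have m : ∫ y in p..q, ga y ≤ ∫ y in p..q, (y / 2) * ga y := by
    apply intervalIntegral.integral_mono_on hpq (Continuous.intervalIntegrable (by fun_prop) _ _)
      (Continuous.intervalIntegrable (by fun_prop) _ _)
    intro y hy
    have := ga_pos y
    nlinarith [hy.1]
  have := ga_le p
  have := ga_pos q
  linarith

lemma WS.w1b (h : WS w w1 w2 l lam δ) {y0 θ : ℝ} (hθ : 0 < θ) (hy0 : 2 ≤ y0) (hyl : y0 ≤ l) :
    |w1 y0| * ga y0 ≤ θ + (δ + lam ^ 2 * ∫ y in y0..l, w y ^ 2 * ga y) / (2 * θ) := by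
  have c0 := h.c0; have c1 := h.c1; have c2 := h.c2; have := ga_c; have hl := h.hl
  set ee := fun y => w2 y - y / 2 * w1 y + lam * w y with hee
  have ce : Continuous ee := by fun_prop
  have e := h.ftc (F := fun y => w1 y * ga y) (F' := fun y => (ee y - lam * w y) * ga y)
    (by fun_prop) (by fun_prop) (fun y hy => by
      refine ((h.d1 y hy).mul (ga_d y)).congr_deriv ?_
      simp only [hee]; ring) (by linarith : -l ≤ y0) hyl le_rfl
  have e2 : |w1 y0| * ga y0 = |∫ y in y0..l, (ee y - lam * w y) * ga y| := by
    rw [e, h.z1, zero_mul, zero_sub, abs_neg, abs_mul, abs_of_pos (ga_pos y0)]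
  rw [e2]
  refine (intervalIntegral.abs_integral_le_integral_abs hyl).trans ?_
  refine (int_le3 (f := ga) (g := fun y => ee y ^ 2 * ga y) (k := fun y => w y ^ 2 * ga y)
    (a := θ) (b := 1 / (2 * θ)) (c := lam ^ 2 / (2 * θ)) hyl (by fun_prop) (by fun_prop)
    (by fun_prop) (by fun_prop) ?_).trans ?_
  · intro y _
    have hg := ga_pos y
    rw [abs_mul, abs_of_pos hg]
    have k : ∀ a : ℝ, |a| ≤ θ / 2 + a ^ 2 / (2 * θ) := fun a => by
      have : θ / 2 + a ^ 2 / (2 * θ) = (θ ^ 2 + a ^ 2) / (2 * θ) := by field_simp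
      rw [this, le_div_iff₀ (by positivity)]
      nlinarith [sq_nonneg (θ - |a|), sq_abs a]
    have k1 := k (ee y)
    have k2 := k (lam * w y)
    have k3 := abs_sub (ee y) (lam * w y)
    have : |ee y - lam * w y| ≤ θ + 1 / (2 * θ) * ee y ^ 2 + lam ^ 2 / (2 * θ) * w y ^ 2 := by
      have : (lam * w y) ^ 2 / (2 * θ) = lam ^ 2 / (2 * θ) * w y ^ 2 := by ring
      have : ee y ^ 2 / (2 * θ) = 1 / (2 * θ) * ee y ^ 2 := by ring
      linarith
    have := mul_le_mul_of_nonneg_right this hg.le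
    linarith
  · have g1 := mul_le_mul_of_nonneg_left (ga_int1 hy0 hyl) hθ.le
    have s := (sub_int (f := fun s => ee s ^ 2 * ga s) (by fun_prop)
      (fun x => by have := ga_pos x; positivity) (by linarith : -l ≤ y0) hyl le_rfl).trans h.n2
    have g2 := mul_le_mul_of_nonneg_left s (by positivity : 0 ≤ 1 / (2 * θ))
    have : (δ + lam ^ 2 * ∫ y in y0..l, w y ^ 2 * ga y) / (2 * θ) = 1 / (2 * θ) * δ +
      lam ^ 2 / (2 * θ) * ∫ y in y0..l, w y ^ 2 * ga y := by ring
    linarith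

set_option maxHeartbeats 1000000 in
lemma WS.right (h : WS w w1 w2 l lam δ) {Λ y0 μ : ℝ} (hΛ : lam ≤ Λ) (hδ : δ ≤ μ) (hμ : μ ≤ 1)
    (hy0 : 0 < y0) (hyR : 32 * (Λ + 1) ≤ y0 ^ 2) (hyl : y0 ≤ l) (hw : |w y0| ≤ μ) :
    ∫ y in y0..l, w y ^ 2 * ga y ≤ (7 + 2 * Λ + Λ ^ 2) * μ := by
  have c0 := h.c0; have c1 := h.c1; have c2 := h.c2; have := ga_c; have hl := h.hl
  have l0 := h.lam0
  have hy4 : 4 ≤ y0 := hlp_y4 (l0.trans hΛ) hy0 hyR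
  set ee := fun y => w2 y - y / 2 * w1 y + lam * w y with hee
  have ce : Continuous ee := by fun_prop
  have hb := h.w1b one_pos (by linarith : 2 ≤ y0) hyl
  set I0 := ∫ y in y0..l, w y ^ 2 * ga y with hI0
  set I1 := ∫ y in y0..l, w1 y ^ 2 * ga y with hI1
  have hμ0 : 0 ≤ μ := (abs_nonneg _).trans hw
  have I01 : I0 ≤ 1 := by
    rw [← h.n0]
    exact sub_int (by fun_prop) (fun x => by have := ga_pos x; positivity) (by linarith) hyl le_rfl
  have I00 : 0 ≤ I0 := intervalIntegral.integral_nonneg hyl fun x _ => by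
    have := ga_pos x; positivity
  have I10 : 0 ≤ I1 := intervalIntegral.integral_nonneg hyl fun x _ => by
    have := ga_pos x; positivity
  have s := (sub_int (f := fun s => ee s ^ 2 * ga s) (by fun_prop)
      (fun x => by have := ga_pos x; positivity) (by linarith : -l ≤ y0) hyl le_rfl).trans h.n2
  -- energy
  have e1 := h.ftc (F := fun y => w y * w1 y * ga y)
    (F' := fun y => w1 y ^ 2 * ga y + w y * (ee y - lam * w y) * ga y)
    (by fun_prop) (by fun_prop) (fun y hy => by
      refine (((h.d0 y hy).mul (h.d1 y hy)).mul (ga_d y)).congr_deriv ?_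
      simp only [hee, Pi.mul_apply]; ring) (by linarith : -l ≤ y0) hyl le_rfl
  have e2 := int_le3 (F := fun y => w1 y ^ 2 * ga y) (f := fun y => w1 y ^ 2 * ga y + w y * (ee y - lam * w y) * ga y)
    (g := fun y => ee y ^ 2 * ga y) (k := fun y => w y ^ 2 * ga y) (a := 1) (b := 1 / 2)
    (c := Λ + 1 / 2) hyl (by fun_prop) (by fun_prop) (by fun_prop) (by fun_prop) (fun y _ => by
      have hg := ga_pos y
      exact hlp_e hg hΛ)
  rw [e1, h.z0, zero_mul, zero_mul, ← hI0, ← hI1] at e2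
  have b1 : -(w y0 * w1 y0 * ga y0) ≤ μ * (1 + (1 + Λ ^ 2) / 2) := by
    have : |w y0 * w1 y0 * ga y0| ≤ μ * (1 + (1 + Λ ^ 2) / 2) := by
      rw [abs_mul, abs_mul, abs_of_pos (ga_pos y0), mul_assoc]
      apply mul_le_mul hw _ (by have := ga_pos y0; positivity) hμ0
      refine hb.trans ?_
      have : lam ^ 2 * I0 ≤ Λ ^ 2 * 1 := mul_le_mul (pow_le_pow_left₀ l0 hΛ 2) I01 I00 (by positivity)
      linarith
    linarith [neg_abs_le (w y0 * w1 y0 * ga y0)]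
  -- Hardy
  have e3 := h.ftc (F := fun y => w y ^ 2 * ga y)
    (F' := fun y => 2 * w y * w1 y * ga y - y / 2 * w y ^ 2 * ga y)
    (by fun_prop) (by fun_prop) (fun y hy => by
      refine (((h.d0 y hy).pow 2).mul (ga_d y)).congr_deriv ?_
      simp; ring) (by linarith : -l ≤ y0) hyl le_rfl
  have e4 := int_le3 (F := fun y => w y ^ 2 * ga y) (f := fun y => 2 * w y * w1 y * ga y - y / 2 * w y ^ 2 * ga y)
    (g := fun y => w1 y ^ 2 * ga y) (k := fun y => w y ^ 2 * ga y) (a := -(4 / y0)) (b := 16 / y0 ^ 2)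
    (c := 0) hyl (by fun_prop) (by fun_prop) (by fun_prop) (by fun_prop) (fun y hy => by
      have hg := ga_pos y
      have k3 : 4 / y0 * y0 = 4 := by field_simp
      have k4 : 16 / y0 ^ 2 = (4 / y0) ^ 2 := by rw [div_pow]; norm_num
      have k0 : 0 ≤ 4 / y0 := by positivity
      rw [k4]
      generalize 4 / y0 = z at *
      have k1 : 0 ≤ (w y - z * w1 y) ^ 2 * ga y := by positivity
      have k2 : 0 ≤ z * ((y - y0) * (w y ^ 2 * ga y)) :=
        mul_nonneg k0 (mul_nonneg (by linarith [hy.1]) (by positivity))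
      have k5 : z * ((y - y0) * (w y ^ 2 * ga y)) = z * y * (w y ^ 2 * ga y) - 4 * (w y ^ 2 * ga y) := by
        linear_combination (-(w y ^ 2 * ga y)) * k3
      rw [k5] at k2
      linarith)
  rw [e3, h.z0, ← hI0, ← hI1] at e4
  have b2 : 4 / y0 * (w y0 ^ 2 * ga y0) ≤ μ := by
    have p1 : w y0 ^ 2 ≤ μ ^ 2 := by rw [← sq_abs]; exact pow_le_pow_left₀ (abs_nonneg _) hw 2
    have p2 : w y0 ^ 2 * ga y0 ≤ μ ^ 2 * 1 := mul_le_mul p1 (ga_le _) (ga_pos _).le (by positivity)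
    have p3 : 4 / y0 ≤ 1 := by rw [div_le_one hy0]; exact hy4
    have p4 : 4 / y0 * (w y0 ^ 2 * ga y0) ≤ 1 * (μ ^ 2 * 1) :=
      mul_le_mul p3 p2 (by have := ga_pos y0; positivity) zero_le_one
    have := hlp_sq2 hμ0 hμ
    linarith
  have hΛ0 : 0 ≤ Λ := l0.trans hΛ
  have b3 : 16 / y0 ^ 2 * I1 ≤ 1 / (2 * (Λ + 1)) * I1 := by
    apply mul_le_mul_of_nonneg_right _ I10
    rw [div_le_div_iff₀ (by positivity) (by positivity)]
    linarith
  have b4 : I0 ≤ μ + 1 / (2 * (Λ + 1)) * I1 := by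
    have : (-(4 / y0)) * (0 ^ 2 * ga l - w y0 ^ 2 * ga y0) = 4 / y0 * (w y0 ^ 2 * ga y0) := by ring
    linarith
  have b5 : (Λ + 1) * I0 ≤ (Λ + 1) * μ + 1 / 2 * I1 := by
    have := mul_le_mul_of_nonneg_left b4 (by positivity : 0 ≤ Λ + 1)
    have e : (Λ + 1) * (μ + 1 / (2 * (Λ + 1)) * I1) = (Λ + 1) * μ + 1 / 2 * I1 := by field_simp
    linarith
  have b6 : I1 ≤ μ * (1 + (1 + Λ ^ 2) / 2) + 1 / 2 * μ + (Λ + 1) * I0 - 1 / 2 * I0 := by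
    have : (1:ℝ) * (0 - w y0 * w1 y0 * ga y0) = -(w y0 * w1 y0 * ga y0) := by ring
    linarith
  have b7 : I1 ≤ 2 * (μ * (1 + (1 + Λ ^ 2) / 2) + 1 / 2 * μ + (Λ + 1) * μ) := by linarith
  have b8 : 1 / (2 * (Λ + 1)) * I1 ≤ 1 / 2 * I1 := by
    apply mul_le_mul_of_nonneg_right _ I10
    rw [div_le_div_iff₀ (by positivity) (by positivity)]
    linarith
  exact hlp_r hμ0 hΛ0 b7 b4 b8

set_option maxHeartbeats 1000000 in
lemma lemW {Λ K : ℝ} (hΛ : 0 ≤ Λ) (hK : 8 * (Λ + 1) ≤ K) : ∃ μ > 0, ∀ w w1 w2 : ℝ → ℝ,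
    ∀ l lam δ : ℝ, WS w w1 w2 l lam δ → δ ≤ μ → lam ≤ Λ → ∀ y0, 0 < y0 → 32 * (Λ + 1) ≤ y0 ^ 2 →
      y0 ≤ K → y0 ≤ l → μ ≤ |w y0| := by
  set M1 := 7 + 2 * Λ + Λ ^ 2 with hM1
  set M2 := 1 + (1 + Λ ^ 2 * M1) / 2 with hM2
  set G := Real.exp (K ^ 2 / 4) with hG
  set X := Real.exp ((2 + K + Λ) * (2 * K)) with hX
  set M3 := X * (1 + (M2 * G) ^ 2 + G) with hM3
  have hG0 : 0 < G := Real.exp_pos _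
  have hX0 : 0 < X := Real.exp_pos _
  have hM10 : 0 < M1 := by positivity
  have hM20 : 0 < M2 := by positivity
  have hM30 : 0 < M3 := by positivity
  obtain ⟨ν, hν0, hν1, hν2⟩ : ∃ ν : ℝ, 0 < ν ∧ ν ≤ 1 ∧ ν * (4 * M3 + M1) ≤ 1 / 2 :=
    ⟨min 1 (1 / 2 / (4 * M3 + M1)), by positivity, min_le_left _ _, by
      rw [← le_div_iff₀ (by positivity)]; exact min_le_right _ _⟩
  refine ⟨ν ^ 2, by positivity, ?_⟩
  intro w w1 w2 l lam δ h hδ hlam y0 hy0 hyR hyK hyl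
  by_contra hcon
  push Not at hcon
  have c0 := h.c0; have c1 := h.c1; have c2 := h.c2; have := ga_c; have hl := h.hl
  have l0 := h.lam0
  have hν21 : ν ^ 2 ≤ 1 := pow_le_one₀ hν0.le hν1
  have I0b := h.right hlam hδ hν21 hy0 hyR hyl hcon.le
  have hy4 : 4 ≤ y0 := hlp_y4 hΛ hy0 hyR
  have hb := h.w1b hν0 (by linarith : 2 ≤ y0) hyl
  have I00 : 0 ≤ ∫ y in y0..l, w y ^ 2 * ga y := intervalIntegral.integral_nonneg hyl fun x _ => by
    have := ga_pos x; positivity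
  set I0 := ∫ y in y0..l, w y ^ 2 * ga y with hI0
  rw [← hM1] at I0b
  have hb2 : |w1 y0| * ga y0 ≤ ν * M2 := by
    refine hb.trans ?_
    have : lam ^ 2 * I0 ≤ Λ ^ 2 * (M1 * ν ^ 2) :=
      mul_le_mul (pow_le_pow_left₀ l0 hlam 2) I0b I00 (by positivity)
    have h2 : (δ + lam ^ 2 * I0) / (2 * ν) ≤ ν * ((1 + Λ ^ 2 * M1) / 2) := by
      rw [div_le_iff₀ (by positivity)]
      have : ν * ((1 + Λ ^ 2 * M1) / 2) * (2 * ν) = ν ^ 2 + Λ ^ 2 * (M1 * ν ^ 2) := by ring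
      linarith
    rw [hM2]; linarith
  have hgG : 1 ≤ G * ga y0 := by
    rw [hG]; unfold ga
    rw [← Real.exp_add]
    apply Real.one_le_exp
    have : y0 ^ 2 ≤ K ^ 2 := pow_le_pow_left₀ hy0.le hyK 2
    linarith
  have hb3 : |w1 y0| ≤ ν * (M2 * G) := by
    calc |w1 y0| = |w1 y0| * 1 := by ring
      _ ≤ |w1 y0| * (G * ga y0) := by gcongr
      _ = |w1 y0| * ga y0 * G := by ring
      _ ≤ ν * M2 * G := by gcongr
      _ = _ := by ring
  have hF : w y0 ^ 2 + w1 y0 ^ 2 + G * δ ≤ ν ^ 2 * (1 + (M2 * G) ^ 2 + G) := by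
    have p1 : w y0 ^ 2 ≤ ν ^ 2 := by
      rw [← sq_abs]
      have : |w y0| ≤ ν := hcon.le.trans (hlp_sq2 hν0.le hν1)
      exact pow_le_pow_left₀ (abs_nonneg _) this 2
    have p2 : w1 y0 ^ 2 ≤ (ν * (M2 * G)) ^ 2 := by
      rw [← sq_abs]; exact pow_le_pow_left₀ (abs_nonneg _) hb3 2
    have p3 : G * δ ≤ G * ν ^ 2 := by gcongr
    linarith
  set K2 := 8 * (Λ + 1) with hK2
  have key : ∀ y ∈ Icc (-l) y0, w y ^ 2 * ga y ≤ (ν ^ 2 * M3) * ga y + 1 / K2 ^ 2 * (y ^ 2 * w y ^ 2 * ga y)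
      + 0 * ga y := by
    intro y hy
    have hg := ga_pos y
    have hK20 : 0 < K2 := by positivity
    by_cases hyK2 : -K2 ≤ y
    · have := h.gron hlam hy.1 hy.2 hyl (by linarith : -K ≤ y) hyK
      have q : w y ^ 2 ≤ ν ^ 2 * M3 := by
        have : X * (w y0 ^ 2 + w1 y0 ^ 2 + G * δ) ≤ X * (ν ^ 2 * (1 + (M2 * G) ^ 2 + G)) := by gcongr
        have e : ν ^ 2 * M3 = X * (ν ^ 2 * (1 + (M2 * G) ^ 2 + G)) := by rw [hM3]; ring
        rw [e]
        linarith [sq_nonneg (w1 y)]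
      have q2 := mul_le_mul_of_nonneg_right q hg.le
      have : 0 ≤ 1 / K2 ^ 2 * (y ^ 2 * w y ^ 2 * ga y) := by positivity
      linarith
    · push Not at hyK2
      have : K2 ^ 2 ≤ y ^ 2 := by rw [← neg_sq y]; exact pow_le_pow_left₀ hK20.le (by linarith) 2
      have q : 1 ≤ 1 / K2 ^ 2 * y ^ 2 := by
        rw [one_div, inv_mul_eq_div, one_le_div (by positivity)]; exact this
      have q2 := mul_le_mul_of_nonneg_right q (by positivity : 0 ≤ w y ^ 2 * ga y)
      have : 0 ≤ (ν ^ 2 * M3) * ga y := by positivity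
      linarith
  have m := int_le3 (by linarith : -l ≤ y0) (by fun_prop) (by fun_prop) (by fun_prop) (by fun_prop) key
  have g4 := ga_int (-l) y0 (by linarith)
  have t1 := (sub_int (f := fun y => y ^ 2 * w y ^ 2 * ga y) (by fun_prop)
    (fun x => by have := ga_pos x; positivity) (le_refl (-l)) (by linarith) hyl).trans h.tail
  have sp := intervalIntegral.integral_add_adjacent_intervals
    (Continuous.intervalIntegrable (by fun_prop : Continuous fun y => w y ^ 2 * ga y) (-l) y0)
    (Continuous.intervalIntegrable (by fun_prop : Continuous fun y => w y ^ 2 * ga y) y0 l) (μ := MeasureTheory.volume)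
  rw [h.n0, ← hI0] at sp
  have t2 : 1 / K2 ^ 2 * ∫ y in (-l)..y0, y ^ 2 * w y ^ 2 * ga y ≤ 1 / 4 := by
    rw [one_div, inv_mul_eq_div, div_le_iff₀ (by positivity)]
    refine t1.trans ?_
    rw [hK2]
    linarith [sq_nonneg Λ]
  have t3 : ν ^ 2 * M3 * ∫ y in (-l)..y0, ga y ≤ ν ^ 2 * M3 * 4 := by gcongr
  have : ν ^ 2 * (4 * M3 + M1) ≤ 1 / 2 := by
    have : ν ^ 2 * (4 * M3 + M1) ≤ ν * (4 * M3 + M1) :=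
      mul_le_mul_of_nonneg_right (hlp_sq2 hν0.le hν1) (by positivity)
    linarith
  linarith

end ws

open Set Filter Topology

lemma hlp_ab {a θ : ℝ} (hθ : 0 < θ) : |a| ≤ θ / 2 + a ^ 2 / (2 * θ) := by
  have : θ / 2 + a ^ 2 / (2 * θ) = (θ ^ 2 + a ^ 2) / (2 * θ) := by field_simp
  rw [this, le_div_iff₀ (by positivity)]
  nlinarith [sq_nonneg (θ - |a|), sq_abs a]

lemma ga_sq_int {l : ℝ} (hl : 0 < l) : ∫ y in (-l)..l, y ^ 2 * ga y ≤ 8 := by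
  have := ga_c
  have e : ∫ y in (-l)..l, (1 * ga y - 1 / 2 * (y ^ 2 * ga y)) = l * ga l - (-l) * ga (-l) := by
    rw [intervalIntegral.integral_eq_sub_of_hasDerivAt (f := fun y => y * ga y)
      (fun x _ => ((hasDerivAt_id x).mul (ga_d x)).congr_deriv (by simp; ring))
      (Continuous.intervalIntegrable (by fun_prop) _ _)]
  rw [intervalIntegral.integral_sub (Continuous.intervalIntegrable (by fun_prop) _ _)
    (Continuous.intervalIntegrable (by fun_prop) _ _), intervalIntegral.integral_const_mul,
    intervalIntegral.integral_const_mul] at e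
  have h4 := ga_int (-l) l (by linarith)
  have := mul_pos hl (ga_pos l)
  have := mul_pos hl (ga_pos (-l))
  linarith

lemma at_int {p q y1 r : ℝ} (hr : 0 < r) :
    ∫ y in p..q, 2 / (1 + ((y - y1) / r) ^ 2) ≤ 8 * r := by
  have c : Continuous fun y : ℝ => 2 / (1 + ((y - y1) / r) ^ 2) :=
    Continuous.div (by fun_prop) (by fun_prop) (fun y => by positivity)
  rw [intervalIntegral.integral_eq_sub_of_hasDerivAt
    (f := fun y => 2 * r * Real.arctan ((y - y1) / r)) (fun x _ => ?_) (c.intervalIntegrable _ _)]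
  · have h1 := Real.arctan_lt_pi_div_two ((q - y1) / r)
    have h2 := Real.neg_pi_div_two_lt_arctan ((p - y1) / r)
    have h3 := Real.pi_le_four
    have : Real.arctan ((q - y1) / r) - Real.arctan ((p - y1) / r) ≤ 4 := by linarith
    have := mul_le_mul_of_nonneg_left this (by positivity : 0 ≤ 2 * r)
    linarith
  · have d := ((((hasDerivAt_id x).sub_const y1).div_const r).arctan).const_mul (2 * r)
    refine d.congr_deriv ?_
    simp only [id]
    field_simp

lemma hlp_pt {w g y y1 r S S1 K : ℝ} (hg : 0 < g) (hr : 0 < r) (hS : 0 ≤ S) (hK : 0 < K)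
    (b1 : w ^ 2 * g ≤ S1) (b2 : |y| ≤ K → |w| ≤ S) (s : ℝ) (hs : s = |w| * |y - y1|) :
    w ^ 2 * g ≤ 1 / K ^ 2 * (y ^ 2 * w ^ 2 * g) + S1 * (2 / (1 + ((y - y1) / r) ^ 2)) +
      S * ((1 + K) / r + 1) / (1 + |y1|) * (s * g) := by
  have S10 : 0 ≤ S1 := le_trans (by positivity) b1
  have n1 : 0 ≤ 1 / K ^ 2 * (y ^ 2 * w ^ 2 * g) := by positivity
  have n2 : 0 ≤ S1 * (2 / (1 + ((y - y1) / r) ^ 2)) := by positivity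
  have n3 : 0 ≤ S * ((1 + K) / r + 1) / (1 + |y1|) * (s * g) := by rw [hs]; positivity
  by_cases hy : |y| ≤ K
  · by_cases hn : |y - y1| ≤ r
    · have : 1 ≤ 2 / (1 + ((y - y1) / r) ^ 2) := by
        rw [le_div_iff₀ (by positivity)]
        have : |(y - y1) / r| ≤ 1 := by rw [abs_div, abs_of_pos hr, div_le_one hr]; exact hn
        have := hlp_sq this
        linarith
      have := mul_le_mul_of_nonneg_left this S10
      linarith
    · push Not at hn
      have k1 : 1 + |y1| ≤ ((1 + K) / r + 1) * |y - y1| := by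
        have h1 : |y1| ≤ |y| + |y - y1| := by
          have := abs_sub y (y - y1); rwa [sub_sub_cancel] at this
        have h2 : 1 + K ≤ (1 + K) / r * |y - y1| := by
          rw [div_mul_eq_mul_div, le_div_iff₀ hr]
          exact mul_le_mul_of_nonneg_left hn.le (by linarith)
        linarith
      have k2 : w ^ 2 ≤ S * |w| := by
        rw [← sq_abs, sq]; exact mul_le_mul_of_nonneg_right (b2 hy) (abs_nonneg _)
      have k3 : w ^ 2 * g ≤ S * |w| * g := mul_le_mul_of_nonneg_right k2 hg.le
      have k4 : S * |w| * g ≤ S * ((1 + K) / r + 1) / (1 + |y1|) * (s * g) := by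
        rw [hs, div_mul_eq_mul_div, le_div_iff₀ (by positivity)]
        have := mul_le_mul_of_nonneg_left k1 (by positivity : 0 ≤ S * |w| * g)
        linarith
      linarith
  · push Not at hy
    have : K ^ 2 ≤ y ^ 2 := by rw [← sq_abs y]; exact pow_le_pow_left₀ hK.le hy.le 2
    have q : 1 ≤ 1 / K ^ 2 * y ^ 2 := by
      rw [one_div, inv_mul_eq_div, one_le_div (by positivity)]; exact this
    have q2 := mul_le_mul_of_nonneg_right q (by positivity : 0 ≤ w ^ 2 * g)
    linarith

section ws
variable {w w1 w2 : ℝ → ℝ} {l lam δ : ℝ}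

lemma WS.orth (h : WS w w1 w2 l lam δ) {ν : ℝ} (hν : 0 < ν) (hδ : δ ≤ ν ^ 2) (hl9 : 9 / 10 ≤ lam) :
    |∫ y in (-l)..l, w y * ga y| ≤ 13 * ν ∧ |∫ y in (-l)..l, y * (w y * ga y)| ≤ 13 * ν := by
  have c0 := h.c0; have c1 := h.c1; have c2 := h.c2; have := ga_c; have hl := h.hl
  set ee := fun y => w2 y - y / 2 * w1 y + lam * w y with hee
  have ce : Continuous ee := by fun_prop
  have hll : -l ≤ l := by linarith
  have n2 : ∫ y in (-l)..l, ee y ^ 2 * ga y ≤ ν ^ 2 := h.n2.trans hδ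
  have e1 := h.ftc (F := fun y => w1 y * ga y) (F' := fun y => (ee y - lam * w y) * ga y)
    (by fun_prop) (by fun_prop) (fun y hy => by
      refine ((h.d1 y hy).mul (ga_d y)).congr_deriv ?_
      simp only [hee]; ring) le_rfl hll le_rfl
  have e2 := h.ftc (F := fun y => y * w1 y * ga y - w y * ga y)
    (F' := fun y => y * (ee y - lam * w y) * ga y + y / 2 * w y * ga y)
    (by fun_prop) (by fun_prop) (fun y hy => by
      refine ((((hasDerivAt_id y).mul (h.d1 y hy)).mul (ga_d y)).sub
        ((h.d0 y hy).mul (ga_d y))).congr_deriv ?_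
      simp only [hee, Pi.mul_apply, id]; ring) le_rfl hll le_rfl
  rw [h.z1, h.z1'] at e1
  rw [h.z1, h.z1', h.z0, h.z0'] at e2
  have s1 := int_eq3 (F := fun y => (ee y - lam * w y) * ga y) (f := fun y => ee y * ga y)
    (g := fun y => w y * ga y) (k := fun y => w y) (a := 1) (b := -lam) (c := 0) (p := -l) (q := l)
    (by fun_prop) (by fun_prop) (by fun_prop) (by fun_prop) (fun y => by ring)
  have s2 := int_eq3 (F := fun y => y * (ee y - lam * w y) * ga y + y / 2 * w y * ga y)
    (f := fun y => y * (ee y * ga y))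
    (g := fun y => y * (w y * ga y)) (k := fun y => w y) (a := 1) (b := -(lam - 1 / 2)) (c := 0)
    (p := -l) (q := l)
    (by fun_prop) (by fun_prop) (by fun_prop) (by fun_prop) (fun y => by ring)
  rw [e1] at s1
  rw [e2] at s2
  have b1 : |∫ y in (-l)..l, ee y * ga y| ≤ 5 * ν := by
    refine (intervalIntegral.abs_integral_le_integral_abs hll).trans ?_
    refine (int_le3 (f := ga) (g := fun y => ee y ^ 2 * ga y) (k := fun y => w y)
      (a := ν / 2) (b := 1 / (2 * ν)) (c := 0) hll (by fun_prop) (by fun_prop)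
      (by fun_prop) (by fun_prop) (fun y _ => ?_)).trans ?_
    · have hg := ga_pos y
      rw [abs_mul, abs_of_pos hg]
      have := mul_le_mul_of_nonneg_right (hlp_ab (a := ee y) hν) hg.le
      refine this.trans (le_of_eq (by ring))
    · have g1 := mul_le_mul_of_nonneg_left (ga_int (-l) l hll) (by positivity : 0 ≤ ν / 2)
      have g2 := mul_le_mul_of_nonneg_left n2 (by positivity : 0 ≤ 1 / (2 * ν))
      have : 1 / (2 * ν) * ν ^ 2 = ν / 2 := by field_simp
      linarith
  have b2 : |∫ y in (-l)..l, y * (ee y * ga y)| ≤ 5 * ν := by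
    refine (intervalIntegral.abs_integral_le_integral_abs hll).trans ?_
    refine (int_le3 (f := fun y => y ^ 2 * ga y) (g := fun y => ee y ^ 2 * ga y) (k := fun y => w y)
      (a := ν / 2) (b := 1 / (2 * ν)) (c := 0) hll (by fun_prop) (by fun_prop)
      (by fun_prop) (by fun_prop) (fun y _ => ?_)).trans ?_
    · have hg := ga_pos y
      rw [abs_mul, abs_mul, abs_of_pos hg]
      have h1 : |y| * |ee y| ≤ ν / 2 * y ^ 2 + 1 / (2 * ν) * ee y ^ 2 := by
        have e : ν / 2 * y ^ 2 + 1 / (2 * ν) * ee y ^ 2 = ((ν * y) ^ 2 + ee y ^ 2) / (2 * ν) := by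
          field_simp
        rw [e, le_div_iff₀ (by positivity), mul_pow, ← sq_abs y, ← sq_abs (ee y), ← mul_pow]
        linarith [sq_nonneg (ν * |y| - |ee y|)]
      have := mul_le_mul_of_nonneg_right h1 hg.le
      linarith
    · have g1 := mul_le_mul_of_nonneg_left (ga_sq_int hl) (by positivity : 0 ≤ ν / 2)
      have g2 := mul_le_mul_of_nonneg_left n2 (by positivity : 0 ≤ 1 / (2 * ν))
      have : 1 / (2 * ν) * ν ^ 2 = ν / 2 := by field_simp
      linarith
  have f1 : lam * (∫ y in (-l)..l, w y * ga y) = ∫ y in (-l)..l, ee y * ga y := by linarith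
  have f2 : (lam - 1 / 2) * (∫ y in (-l)..l, y * (w y * ga y)) = ∫ y in (-l)..l, y * (ee y * ga y) := by
    linarith
  rw [← f1, abs_mul, abs_of_nonneg (by linarith)] at b1
  rw [← f2, abs_mul, abs_of_nonneg (by linarith)] at b2
  have q1 := mul_le_mul_of_nonneg_right hl9 (abs_nonneg (∫ y in (-l)..l, w y * ga y))
  have q2 := mul_le_mul_of_nonneg_right (by linarith : 4 / 10 ≤ lam - 1 / 2)
    (abs_nonneg (∫ y in (-l)..l, y * (w y * ga y)))
  exact ⟨by linarith, by linarith⟩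

lemma twoSign {Λ : ℝ} (hΛ : 0 ≤ Λ) : ∃ μ > 0, ∀ w w1 w2 : ℝ → ℝ, ∀ l lam δ : ℝ,
    WS w w1 w2 l lam δ → δ ≤ μ → lam ≤ Λ → 9 / 10 ≤ lam → ∀ y1 σ : ℝ, |σ| = 1 →
      (∀ y ∈ Icc (-l) l, 0 ≤ σ * w y * (y - y1)) → False := by
  set K := 8 * (Λ + 1) with hK
  have hK0 : 0 < K := by positivity
  set S1 := 10 * (Λ + 1) with hS1
  have hS10 : 0 < S1 := by positivity
  set S := Real.sqrt (S1 * Real.exp (K ^ 2 / 4)) with hS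
  have hS0 : 0 < S := Real.sqrt_pos.2 (by positivity)
  set r := 1 / (32 * S1) with hr
  have hr0 : 0 < r := by positivity
  set M := S * ((1 + K) / r + 1) with hM
  have hM0 : 0 < M := by positivity
  obtain ⟨ν, hν0, hν2⟩ : ∃ ν : ℝ, 0 < ν ∧ ν * (13 * M) ≤ 1 / 4 :=
    ⟨1 / 4 / (13 * M), by positivity, by rw [← le_div_iff₀ (by positivity)]⟩
  refine ⟨ν ^ 2, by positivity, ?_⟩
  intro w w1 w2 l lam δ h hδ hlam hl9 y1 σ hσ hsgn
  have c0 := h.c0; have := ga_c; have hl := h.hl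
  have l0 := h.lam0
  have hll : -l ≤ l := by linarith
  obtain ⟨o1, o2⟩ := h.orth hν0 hδ hl9
  have key := int_le3 (F := fun y => w y ^ 2 * ga y) (f := fun y => y ^ 2 * w y ^ 2 * ga y)
    (g := fun y => 2 / (1 + ((y - y1) / r) ^ 2)) (k := fun y => σ * w y * (y - y1) * ga y)
    (a := 1 / K ^ 2) (b := S1) (c := M / (1 + |y1|)) hll (by fun_prop) (by fun_prop)
    (Continuous.div (by fun_prop) (by fun_prop) (fun y => by positivity)) (by fun_prop)
    (fun y hy => by
      refine hlp_pt (ga_pos y) hr0 hS0.le hK0 ((h.sup hy).trans ?_) (fun hyK => ?_) _ ?_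
      · rw [hS1]; linarith
      · apply Real.abs_le_sqrt
        have h1 : w y ^ 2 * ga y ≤ S1 := (h.sup hy).trans (by rw [hS1]; linarith)
        have h2 : 1 ≤ ga y * Real.exp (K ^ 2 / 4) := by
          unfold ga
          rw [← Real.exp_add]
          apply Real.one_le_exp
          have := hlp_sq hyK
          linarith
        calc w y ^ 2 = w y ^ 2 * 1 := by ring
          _ ≤ w y ^ 2 * (ga y * Real.exp (K ^ 2 / 4)) := by gcongr
          _ = w y ^ 2 * ga y * Real.exp (K ^ 2 / 4) := by ring
          _ ≤ _ := by gcongr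
      · rw [← abs_of_nonneg (hsgn y hy), abs_mul, abs_mul, hσ, one_mul])
  have e := int_eq3 (F := fun y => σ * w y * (y - y1) * ga y) (f := fun y => y * (w y * ga y))
    (g := fun y => w y * ga y) (k := fun y => w y) (a := σ) (b := -σ * y1) (c := 0) (p := -l) (q := l)
    (by fun_prop) (by fun_prop) (by fun_prop) (by fun_prop) (fun y => by ring)
  set A1 := ∫ y in (-l)..l, w y * ga y
  set A2 := ∫ y in (-l)..l, y * (w y * ga y)
  have t1 := h.tail
  have t2 := at_int (p := -l) (q := l) (y1 := y1) hr0
  rw [h.n0, e] at key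
  have k1 : σ * A2 + -σ * y1 * A1 + 0 * (∫ y in (-l)..l, w y) ≤ 13 * ν * (1 + |y1|) := by
    have a1 : σ * A2 ≤ 13 * ν := (le_abs_self _).trans (by rw [abs_mul, hσ, one_mul]; exact o2)
    have a2 : -σ * y1 * A1 ≤ |y1| * (13 * ν) := (le_abs_self _).trans (by
      rw [abs_mul, abs_mul, abs_neg, hσ, one_mul]; exact mul_le_mul_of_nonneg_left o1 (abs_nonneg _))
    linarith
  have k2 := mul_le_mul_of_nonneg_left k1 (by positivity : 0 ≤ M / (1 + |y1|))
  have k3 : M / (1 + |y1|) * (13 * ν * (1 + |y1|)) = ν * (13 * M) := by field_simp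
  have k4 := mul_le_mul_of_nonneg_left t2 hS10.le
  have k5 : S1 * (8 * r) = 1 / 4 := by rw [hr]; field_simp; norm_num
  have k6 : 1 / K ^ 2 * ∫ y in (-l)..l, y ^ 2 * w y ^ 2 * ga y ≤ 1 / 4 := by
    rw [one_div, inv_mul_eq_div, div_le_iff₀ (by positivity)]
    refine t1.trans ?_
    rw [hK]
    linarith [sq_nonneg Λ]
  linarith

end ws

open Set Filter Topology

lemma int_scale {r : ℝ} (hr : 0 < r) (f : ℝ → ℝ) :
    ∫ y in (-(1 / r))..(1 / r), f (r * y) = (1 / r) * ∫ x in (-1 : ℝ)..1, f x := by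
  rw [intervalIntegral.integral_comp_mul_left f hr.ne']
  have e1 : r * -(1 / r) = -1 := by field_simp
  have e2 : r * (1 / r) = 1 := by field_simp
  rw [e1, e2, smul_eq_mul, one_div]

lemma int_scale2 {r : ℝ} (hr : 0 < r) (F f : ℝ → ℝ) (e : ∀ y, F y = f (r * y)) :
    ∫ y in (-(1 / r))..(1 / r), F y = (1 / r) * ∫ x in (-1 : ℝ)..1, f x := by
  rw [← int_scale hr f, intervalIntegral.integral_congr (fun y _ => e y)]

lemma Eg_ga {r t y : ℝ} (hr : 0 < r) (ht : t = -r ^ 2) : Eg (r * y) t = ga y := by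
  unfold Eg ga
  congr 1
  rw [ht]
  field_simp

lemma VS.ws {v vx vxx vt A Ax : ℝ → ℝ → ℝ} {C t : ℝ} (h : VS v vx vxx vt A Ax C) {r g : ℝ}
    (ht : t ∈ Ioo (-1 : ℝ) 0)
    (hr : 0 < r) (htr : t = -r ^ 2) (hg : 0 < g) (hgH : g ^ 2 * r = Hf v t) :
    WS (fun y => v (r * y) t / g) (fun y => r * vx (r * y) t / g)
      (fun y => r ^ 2 * vxx (r * y) t / g) (1 / r) (Nf v vx t) (t ^ 2 * Vf v vx vxx t) := by
  have hp := h.ps t ht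
  have hlr : r * (1 / r) = 1 := by field_simp
  have hlr' : r * -(1 / r) = -1 := by field_simp
  have hH : 0 < Hf v t := by rw [← hgH]; positivity
  have hy : ∀ y ∈ Ioo (-(1 / r)) (1 / r), r * y ∈ Ioo (-1 : ℝ) 1 := by
    intro y hy
    constructor
    · rw [← hlr']; exact mul_lt_mul_of_pos_left hy.1 hr
    · rw [← hlr]; exact mul_lt_mul_of_pos_left hy.2 hr
  have hd : ∀ y : ℝ, HasDerivAt (fun y => r * y) r y := fun y => by
    simpa using (hasDerivAt_id y).const_mul r
  refine ⟨by positivity, ?_, ?_, ?_, ?_, ?_, ?_, ?_, ?_, ?_, ?_, ?_, ?_⟩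
  · have := hp.c0; fun_prop
  · have := hp.c1; fun_prop
  · have := hp.c2; fun_prop
  · intro y hyy
    refine (((hp.d0 _ (hy y hyy)).comp y (hd y)).div_const g).congr_deriv (by ring)
  · intro y hyy
    refine ((((hp.d1 _ (hy y hyy)).comp y (hd y)).const_mul r).div_const g).congr_deriv (by ring)
  · have := hp.z0; simp only [hlr, this]; simp
  · have := hp.z0'; simp only [hlr', this]; simp
  · have := hp.z1; simp only [hlr, this]; simp
  · have := hp.z1'; simp only [hlr', this]; simp
  · have e : ∀ y, (fun y => (v (r * y) t / g) ^ 2 * ga y) y = (fun x => 1 / g ^ 2 * (v x t ^ 2 * Eg x t)) (r * y) := by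
      intro y; simp only [Eg_ga hr htr]; ring
    rw [int_scale2 hr _ (fun x => 1 / g ^ 2 * (v x t ^ 2 * Eg x t)) e, intervalIntegral.integral_const_mul]
    change 1 / r * (1 / g ^ 2 * Hf v t) = 1
    rw [← hgH]; field_simp
  · have e : ∀ y, (fun y => (r * vx (r * y) t / g) ^ 2 * ga y) y = (fun x => r ^ 2 / g ^ 2 * (vx x t ^ 2 * Eg x t)) (r * y) := by
      intro y; simp only [Eg_ga hr htr]; ring
    rw [int_scale2 hr _ (fun x => r ^ 2 / g ^ 2 * (vx x t ^ 2 * Eg x t)) e, intervalIntegral.integral_const_mul]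
    change 1 / r * (r ^ 2 / g ^ 2 * Hf vx t) = - t * Hf vx t / Hf v t
    rw [← hgH, htr]; field_simp
  · have e : ∀ y, (fun y => (r ^ 2 * vxx (r * y) t / g - y / 2 * (r * vx (r * y) t / g)
        + Nf v vx t * (v (r * y) t / g)) ^ 2 * ga y) y =
        (fun x => t ^ 2 / g ^ 2 * ((fL vx vxx x t + Hf vx t / Hf v t * v x t) ^ 2 * Eg x t)) (r * y) := by
      intro y; simp only [Eg_ga hr htr]
      have : r ^ 2 * vxx (r * y) t / g - y / 2 * (r * vx (r * y) t / g)
        + Nf v vx t * (v (r * y) t / g) =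
         (-t) / g * (fL vx vxx (r * y) t + Hf vx t / Hf v t * v (r * y) t) := by
        unfold fL Nf
        rw [htr]; field_simp; ring
      rw [this]; ring
    rw [int_scale2 hr _ (fun x => t ^ 2 / g ^ 2 * ((fL vx vxx x t + Hf vx t / Hf v t * v x t) ^ 2 * Eg x t)) e, intervalIntegral.integral_const_mul]
    apply le_of_eq
    unfold Vf
    rw [← hgH]; field_simp

open Set Filter Topology

lemma min_xx {f f1 : ℝ → ℝ} {x f2 : ℝ} (h0 : ∀ᶠ y in 𝓝 x, f x ≤ f y)
    (h1 : ∀ᶠ y in 𝓝 x, HasDerivAt f (f1 y) y) (h2 : HasDerivAt f1 f2 x) :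
    f1 x = 0 ∧ 0 ≤ f2 := by
  have hm : IsLocalMin f x := h0
  have e : f1 x = 0 := hm.hasDerivAt_eq_zero h1.self_of_nhds
  refine ⟨e, ?_⟩
  by_contra hn
  push Not at hn
  have hs := (hasDerivAt_iff_tendsto_slope.1 h2).eventually (gt_mem_nhds hn)
  rw [eventually_nhdsWithin_iff] at hs
  obtain ⟨d, hd, hb⟩ := Metric.eventually_nhds_iff.1 ((h0.and h1).and hs)
  have hlt : f (x + d / 2) < f x := by
    have := strictAntiOn_of_deriv_neg (D := Icc x (x + d / 2)) (f := f) (convex_Icc _ _)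
      (fun y hy => ((hb (y := y) (by rw [Real.dist_eq, abs_lt]; constructor <;> linarith [hy.1, hy.2])).1.2).continuousAt.continuousWithinAt)
      (fun y hy => by
        rw [interior_Icc] at hy
        have hh := hb (y := y) (by rw [Real.dist_eq, abs_lt]; constructor <;> linarith [hy.1, hy.2])
        rw [hh.1.2.deriv]
        have h3 := hh.2 (by simpa using hy.1.ne')
        rw [slope_def_field, e, sub_zero] at h3
        have h4 : 0 < y - x := by linarith [hy.1]
        by_contra h5
        push Not at h5
        have := div_nonneg h5 h4.le
        linarith)
    exact this ⟨le_refl _, by linarith⟩ ⟨by linarith, le_refl _⟩ (by linarith)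
  have := (hb (y := x + d / 2) (by rw [Real.dist_eq, abs_lt]; constructor <;> linarith)).1.1
  linarith

lemma min_t {g : ℝ → ℝ} {t g1 : ℝ} (h0 : ∀ᶠ s in 𝓝[<] t, g t ≤ g s) (h1 : HasDerivAt g g1 t) :
    g1 ≤ 0 := by
  have hss : Iio t ⊆ {t}ᶜ := fun s hs => ne_of_lt hs
  have h2 := (hasDerivAt_iff_tendsto_slope.1 h1).mono_left (nhdsWithin_mono t hss)
  refine le_of_tendsto h2 ?_
  filter_upwards [h0, self_mem_nhdsWithin] with s hs hst
  rw [slope_def_field]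
  exact div_nonpos_of_nonneg_of_nonpos (by linarith) (by have : s < t := hst; linarith)

lemma mp_general {K : Set (ℝ × ℝ)} (hK : IsCompact K) {z zx zxx zt : ℝ → ℝ → ℝ} {k : ℝ}
    (hz : ContinuousOn (fun q : ℝ × ℝ => z q.1 q.2) K)
    (H : ∀ x t, (x, t) ∈ K → z x t < 0 → (∀ᶠ y in 𝓝 x, (y, t) ∈ K) ∧
      (∀ᶠ s in 𝓝[<] t, (x, s) ∈ K) ∧ (∀ᶠ y in 𝓝 x, HasDerivAt (fun y => z y t) (zx y t) y) ∧
      HasDerivAt (fun y => zx y t) (zxx x t) x ∧ HasDerivAt (fun s => z x s) (zt x t) t ∧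
      (zx x t = 0 → 0 ≤ zxx x t → k * z x t < zt x t)) :
    ∀ q ∈ K, 0 ≤ z q.1 q.2 := by
  intro q hq
  have hc : ContinuousOn (fun q : ℝ × ℝ => Real.exp (-k * q.2) * z q.1 q.2) K := by
    refine ContinuousOn.mul ?_ hz
    fun_prop
  obtain ⟨⟨x, t⟩, hp, hmin⟩ := hK.exists_isMinOn ⟨q, hq⟩ hc
  have hmin' : ∀ p ∈ K, Real.exp (-k * t) * z x t ≤ Real.exp (-k * p.2) * z p.1 p.2 :=
    fun p hp => hmin hp
  by_contra hn
  push Not at hn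
  have hneg : z x t < 0 := by
    by_contra h0
    push Not at h0
    have h1 := hmin' q hq
    have h2 : 0 ≤ Real.exp (-k * t) * z x t := mul_nonneg (Real.exp_pos _).le h0
    have h3 : Real.exp (-k * q.2) * z q.1 q.2 < 0 := mul_neg_of_pos_of_neg (Real.exp_pos _) hn
    linarith
  obtain ⟨h1, h2, h3, h4, h5, h6⟩ := H x t hp hneg
  have hx := min_xx (f := fun y => z y t) (f1 := fun y => zx y t) (x := x) (by
    filter_upwards [h1] with y hy
    exact le_of_mul_le_mul_left (hmin' _ hy) (Real.exp_pos _)) h3 h4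
  have h7 := h6 hx.1 hx.2
  have hd : HasDerivAt (fun s => Real.exp (-k * s) * z x s)
      (Real.exp (-k * t) * (zt x t - k * z x t)) t := by
    have e1 : HasDerivAt (fun s => -k * s) (-k) t := by
      simpa using (hasDerivAt_id t).const_mul (-k)
    refine (e1.exp.mul h5).congr_deriv (by ring)
  have h8 := min_t (by
    filter_upwards [h2] with s hs
    exact hmin' _ hs) hd
  have : 0 < Real.exp (-k * t) * (zt x t - k * z x t) := mul_pos (Real.exp_pos _) (by linarith)
  linarith

section
variable {U Ux Uxx Ut A Ax : ℝ → ℝ → ℝ}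

lemma CoreS.barrier (h : CoreS U Ux Uxx Ut A Ax) {K : Set (ℝ × ℝ)} (hK : IsCompact K)
    (hsub : ∀ x t, (x, t) ∈ K → x ∈ Ioo (-1 : ℝ) 1 ∧ t ∈ Ioo (-1 : ℝ) 0) {s : ℝ} (hs : |s| = 1)
    {β βx βxx βt : ℝ → ℝ → ℝ} (hβc : Continuous (fun q : ℝ × ℝ => β q.1 q.2))
    (hd1 : ∀ x t, HasDerivAt (fun y => β y t) (βx x t) x)
    (hd2 : ∀ x t, HasDerivAt (fun y => βx y t) (βxx x t) x)
    (hd3 : ∀ x t, HasDerivAt (fun r => β x r) (βt x t) t)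
    (hβ : ∀ x t, (x, t) ∈ K → βt x t ≤ A x t * βxx x t - (|βx x t| + |β x t|) / 100)
    (hint : ∀ x t, (x, t) ∈ K → s * U x t < β x t → (∀ᶠ y in 𝓝 x, (y, t) ∈ K) ∧
      (∀ᶠ r in 𝓝[<] t, (x, r) ∈ K)) : ∀ x t, (x, t) ∈ K → β x t ≤ s * U x t := by
  have hss : s = 1 ∨ s = -1 := by
    rcases abs_cases s with ⟨h1, _⟩ | ⟨h1, _⟩
    · left; linarith
    · right; linarith
  have hsm : ∀ y, |s * y| = |y| := fun y => by rw [abs_mul, hs, one_mul]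
  have key := mp_general hK (z := fun x t => s * U x t - β x t) (zx := fun x t => s * Ux x t - βx x t)
    (zxx := fun x t => s * Uxx x t - βxx x t) (zt := fun x t => s * Ut x t - βt x t) (k := 1)
    (by have := h.cU; fun_prop) ?_
  · intro x t hxt
    have := key _ hxt
    simp only at this
    linarith
  · intro x t hxt hz
    obtain ⟨hx, ht⟩ := hsub x t hxt
    obtain ⟨g1, g2⟩ := hint x t hxt (by linarith)
    refine ⟨g1, g2, ?_, ?_, ?_, ?_⟩
    · filter_upwards [Ioo_mem_nhds hx.1 hx.2] with y hy
      exact ((h.dx y hy t ht).const_mul s).sub (hd1 y t)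
    · exact ((h.dxx x hx t ht).const_mul s).sub (hd2 x t)
    · exact ((h.dt x (Ioo_subset_Icc_self hx) t ht).const_mul s).sub (hd3 x t)
    · intro e1 e2
      have hA := abs_le.1 (h.bA x (Ioo_subset_Icc_self hx) t ht)
      have hA0 : 0 < A x t := by
        have : |t| ≤ 1 := by rw [abs_le]; constructor <;> linarith [ht.1, ht.2]
        linarith [hA.1]
      have he := h.e x (Ioo_subset_Icc_self hx) t ht
      have hb := hβ x t hxt
      have e3 : |Ux x t| = |βx x t| := by rw [← hsm (Ux x t)]; congr 1; linarith
      have e4 : |U x t| ≤ |β x t| - (s * U x t - β x t) := by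
        rw [← hsm (U x t)]
        have : s * U x t = β x t + (s * U x t - β x t) := by ring
        rw [this]
        refine (abs_add_le _ _).trans ?_
        rw [abs_of_neg hz]; linarith
      have e5 : s * (Ut x t - A x t * Uxx x t) ≥ - ((|Ux x t| + |U x t|) / 100) := by
        have := hsm (Ut x t - A x t * Uxx x t)
        have h2 := neg_abs_le (s * (Ut x t - A x t * Uxx x t))
        linarith
      have e6 : A x t * βxx x t ≤ A x t * (s * Uxx x t) := mul_le_mul_of_nonneg_left (by linarith) hA0.le
      have e7 : s * (Ut x t - A x t * Uxx x t) = s * Ut x t - A x t * (s * Uxx x t) := by ring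
      rw [e3] at e5
      linarith
end

open Set Filter Topology

lemma rect_in {xa xb ta tb x t : ℝ} (hx : x ∈ Ioo xa xb) (ht : t ∈ Ioc ta tb) :
    (∀ᶠ y in 𝓝 x, (y, t) ∈ Icc xa xb ×ˢ Icc ta tb) ∧
      (∀ᶠ r in 𝓝[<] t, (x, r) ∈ Icc xa xb ×ˢ Icc ta tb) := by
  constructor
  · filter_upwards [Ioo_mem_nhds hx.1 hx.2] with y hy
    exact ⟨Ioo_subset_Icc_self hy, Ioc_subset_Icc_self ht⟩
  · filter_upwards [Ioo_mem_nhdsLT ht.1] with r hr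
    exact ⟨Ioo_subset_Icc_self hx, hr.1.le, hr.2.le.trans ht.2⟩

lemma fill_alg {c S S' S'' g G A bx b : ℝ} (hc : 0 < c) (hS : 0 < S) (hG : 0 < G) (hg : 0 ≤ g)
    (hgG : g ≤ G)
    (hA : A ≤ 2) (h1 : S' = 4 * (c + S)) (h2 : S'' = 10 * (S' + c))
    (hbx : bx ≤ S' * G) (hb : b ≤ g * (c + S' / 4 + S'')) :
    -(g * 0) - G * S'' ≤ A * (-2 * S' * G) - (bx + b) / 100 := by
  have e1 : A * (S' * G) ≤ 2 * (S' * G) := mul_le_mul_of_nonneg_right hA (by rw [h1]; positivity)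
  have hp : 0 ≤ c + S' / 4 + S'' := by rw [h2, h1]; positivity
  have e2 : g * (c + S' / 4 + S'') ≤ G * (c + S' / 4 + S'') := mul_le_mul_of_nonneg_right hgG hp
  have e3 : 0 ≤ G * c := by positivity
  have e4 : 0 ≤ G * S' := by rw [h1]; positivity
  rw [h2] at *
  linarith

section
variable {U Ux Uxx Ut A Ax : ℝ → ℝ → ℝ}

lemma CoreS.A2 (h : CoreS U Ux Uxx Ut A Ax) {x t : ℝ} (hx : x ∈ Ioo (-1 : ℝ) 1)
    (ht : t ∈ Ioo (-1 : ℝ) 0) : A x t ≤ 2 ∧ 1 / 2 ≤ A x t := by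
  have hA := abs_le.1 (h.bA x (Ioo_subset_Icc_self hx) t ht)
  have : |t| ≤ 1 := by rw [abs_le]; constructor <;> linarith [ht.1, ht.2]
  constructor <;> linarith [hA.1, hA.2]

lemma CoreS.fill (h : CoreS U Ux Uxx Ut A Ax) {s c S g r xc t' t1 η : ℝ} (hs : |s| = 1)
    (hc : 0 < c) (hS : 0 < S) (hg : 0 < g) (hr : 0 < r) (ht' : t' = -r ^ 2) (hr1 : r < 1)
    (hb1 : -1 < xc - r / 2) (hb2 : xc + r / 2 < 1)
    (h1 : t' ≤ t1) (h10 : t1 < 0) (hη : t1 - t' ≤ η * r ^ 2)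
    (hη1 : η * (100 * (c + S)) ≤ c)
    (h0 : ∀ x ∈ Icc (xc - r / 2) (xc + r / 2), c * g ≤ s * U x t')
    (hSU : ∀ x ∈ Icc (xc - r / 2) (xc + r / 2), ∀ t ∈ Icc t' t1, |U x t| ≤ S * g) :
    c / 2 * g ≤ s * U xc t1 := by
  have hsm : ∀ y, |s * y| = |y| := fun y => by rw [abs_mul, hs, one_mul]
  obtain ⟨S', hS'⟩ : ∃ S', S' = 4 * (c + S) := ⟨_, rfl⟩
  obtain ⟨S'', hS''⟩ : ∃ S'', S'' = 10 * (S' + c) := ⟨_, rfl⟩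
  have hS'0 : 0 < S' := by rw [hS']; positivity
  have hS''0 : 0 < S'' := by rw [hS'']; positivity
  have hr2 : 0 < r ^ 2 := by positivity
  have hr21 : r ^ 2 < 1 := by nlinarith
  have key := h.barrier (K := Icc (xc - r / 2) (xc + r / 2) ×ˢ Icc t' t1)
    (isCompact_Icc.prod isCompact_Icc) (s := s)
    (β := fun x t => g * (c - S' * ((x - xc) ^ 2 / r ^ 2) - S'' * ((t - t') / r ^ 2)))
    (βx := fun x t => g * (- S' * (2 * (x - xc) / r ^ 2)))
    (βxx := fun x t => g * (- S' * (2 / r ^ 2)))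
    (βt := fun x t => g * (- S'' * (1 / r ^ 2)))
    ?_ hs (by fun_prop) ?_ ?_ ?_ ?_ ?_ xc t1 ⟨⟨by linarith, by linarith⟩, h1, le_refl _⟩
  · have e1 : (t1 - t') / r ^ 2 ≤ η := by rw [div_le_iff₀ hr2]; exact hη
    have e2 : S'' * ((t1 - t') / r ^ 2) ≤ S'' * η := mul_le_mul_of_nonneg_left e1 hS''0.le
    have e3 : S'' * η ≤ c / 2 := by
      have : 0 ≤ η := by
        refine le_trans (div_nonneg (by linarith) hr2.le) e1
      have h3 : S'' ≤ 50 * (c + S) := by rw [hS'', hS']; linarith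
      have := mul_le_mul_of_nonneg_right h3 this
      linarith
    have e4 : g * (c - S'' * ((t1 - t') / r ^ 2)) ≥ g * (c / 2) :=
      mul_le_mul_of_nonneg_left (by linarith) hg.le
    simp only [sub_self] at key
    norm_num at key
    linarith
  · rintro x t ⟨hx, ht⟩
    refine ⟨⟨by linarith [hx.1], by linarith [hx.2]⟩, by linarith [ht.1], by linarith [ht.2]⟩
  · intro x t
    have e1 : HasDerivAt (fun y => (y - xc) ^ 2 / r ^ 2) (2 * (x - xc) / r ^ 2) x := by
      refine ((((hasDerivAt_id x).sub_const xc).pow 2).div_const (r ^ 2)).congr_deriv ?_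
      simp
    refine ((((e1.const_mul S').const_sub c).sub_const _).const_mul g).congr_deriv (by ring)
  · intro x t
    have e1 : HasDerivAt (fun y => 2 * (y - xc) / r ^ 2) (2 / r ^ 2) x := by
      refine ((((hasDerivAt_id x).sub_const xc).const_mul 2).div_const (r ^ 2)).congr_deriv ?_
      simp
    exact (e1.const_mul (-S')).const_mul g
  · intro x t
    have e1 : HasDerivAt (fun y => (y - t') / r ^ 2) (1 / r ^ 2) t :=
      ((hasDerivAt_id t).sub_const t').div_const (r ^ 2)
    refine (((e1.const_mul S'').const_sub _).const_mul g).congr_deriv (by ring)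
  · rintro x t ⟨hx, ht⟩
    have hx' : x ∈ Ioo (-1 : ℝ) 1 := ⟨by linarith [hx.1], by linarith [hx.2]⟩
    have hA := (h.A2 hx' (t := t) ⟨by linarith [ht.1], by linarith [ht.2]⟩).1
    have hxa : |x - xc| ≤ r / 2 := by rw [abs_le]; constructor <;> linarith [hx.1, hx.2]
    have hq := hlp_sq hxa
    have e1 : (x - xc) ^ 2 / r ^ 2 ≤ 1 / 4 := by rw [div_le_iff₀ hr2]; linarith
    have e1' : 0 ≤ (x - xc) ^ 2 / r ^ 2 := by positivity
    have e2 : (t - t') / r ^ 2 ≤ 1 := by rw [div_le_one hr2]; linarith [ht.2]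
    have e2' : 0 ≤ (t - t') / r ^ 2 := div_nonneg (by linarith [ht.1]) hr2.le
    have := fill_alg hc hS (g := g) (G := g / r ^ 2) (A := A x t) (by positivity) hg.le
      (by rw [le_div_iff₀ hr2]; nlinarith) hA hS' hS''
      (bx := |g * (- S' * (2 * (x - xc) / r ^ 2))|)
      (b := |g * (c - S' * ((x - xc) ^ 2 / r ^ 2) - S'' * ((t - t') / r ^ 2))|)
      (by
        have : g * (- S' * (2 * (x - xc) / r ^ 2)) = (g / r ^ 2) * S' * 2 * (-(x - xc)) := by ring
        rw [this, abs_mul, abs_neg, abs_of_pos (by positivity)]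
        have : g / r ^ 2 * S' * 2 * |x - xc| ≤ g / r ^ 2 * S' * 2 * (1 / 2) :=
          mul_le_mul_of_nonneg_left (by linarith) (by positivity)
        linarith)
      (by
        rw [abs_mul, abs_of_pos hg]
        refine mul_le_mul_of_nonneg_left ?_ hg.le
        have f1 : S' * ((x - xc) ^ 2 / r ^ 2) ≤ S' * (1 / 4) := mul_le_mul_of_nonneg_left e1 hS'0.le
        have f2 : 0 ≤ S' * ((x - xc) ^ 2 / r ^ 2) := mul_nonneg hS'0.le e1'
        have f3 : S'' * ((t - t') / r ^ 2) ≤ S'' * 1 := mul_le_mul_of_nonneg_left e2 hS''0.le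
        have f4 : 0 ≤ S'' * ((t - t') / r ^ 2) := mul_nonneg hS''0.le e2'
        rw [abs_le]
        constructor <;> linarith)
    have r1 : g * (- S'' * (1 / r ^ 2)) = -(g * 0) - g / r ^ 2 * S'' := by ring
    have r2 : g * (- S' * (2 / r ^ 2)) = -2 * S' * (g / r ^ 2) := by ring
    simp only [r1, r2]
    exact this
  · rintro x t ⟨hx, ht⟩ hlt
    have hSx := hSU x hx t ht
    rw [← hsm, abs_le] at hSx
    have f4 : 0 ≤ S'' * ((t - t') / r ^ 2) := mul_nonneg hS''0.le (div_nonneg (by linarith [ht.1]) hr2.le)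
    have f2 : 0 ≤ S' * ((x - xc) ^ 2 / r ^ 2) := by positivity
    have ends : (x - xc) ^ 2 = r ^ 2 / 4 → False := by
      intro he
      have e : (x - xc) ^ 2 / r ^ 2 = 1 / 4 := by rw [he]; field_simp
      rw [e] at hlt
      have : g * (c - S' * (1 / 4) - S'' * ((t - t') / r ^ 2)) ≤ g * (-S) :=
        mul_le_mul_of_nonneg_left (by rw [hS']; linarith) hg.le
      linarith [hSx.1]
    apply rect_in
    · constructor
      · refine lt_of_le_of_ne hx.1 fun he => ends (by rw [← he]; ring)
      · refine lt_of_le_of_ne hx.2 fun he => ends (by rw [he]; ring)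
    · refine ⟨lt_of_le_of_ne ht.1 fun he => ?_, ht.2⟩
      have h3 := h0 x hx
      rw [he] at h3
      have : g * (c - S' * ((x - xc) ^ 2 / r ^ 2) - S'' * ((t - t') / r ^ 2)) ≤ g * c :=
        mul_le_mul_of_nonneg_left (by linarith) hg.le
      linarith
end

open Set Filter Topology

lemma bar2_alg1 {N ε M Q R A K1 W bx b : ℝ} (hN : 0 ≤ N) (hε : 0 < ε) (hM : 0 < M) (hQ : 0 < Q)
    (hR : 0 < R) (hRQ : R ≤ Q) (hA1 : A ≤ 2) (hA2 : 1 / 2 ≤ A) (hK : K1 = 4 * (N + 4) ^ 2)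
    (hW : 0 ≤ W) (hbx : bx ≤ ε * (N + 3) * R + 2 * M * (N + 4) * R) (hb : b ≤ ε * R + M * R) :
    -(M * K1 * R) ≤ A * (ε * ((N + 3) * (N + 2)) * Q - M * ((N + 4) * (N + 3)) * R + M * W)
      - (bx + b) / 100 := by
  have e1 : 1 / 2 * (ε * ((N + 3) * (N + 2)) * Q) ≤ A * (ε * ((N + 3) * (N + 2)) * Q) :=
    mul_le_mul_of_nonneg_right hA2 (by positivity)
  have e2 : A * (M * ((N + 4) * (N + 3)) * R) ≤ 2 * (M * ((N + 4) * (N + 3)) * R) :=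
    mul_le_mul_of_nonneg_right hA1 (by positivity)
  have e3 : 0 ≤ A * (M * W) := by have : 0 ≤ A := by linarith
                                  positivity
  have e4 : ε * (N + 4) * R ≤ ε * (N + 4) * Q := mul_le_mul_of_nonneg_left hRQ (by positivity)
  have e5 : 0 ≤ ε * Q * N := by positivity
  have e6 : 0 ≤ ε * Q * N ^ 2 := by positivity
  have e7 : 0 ≤ M * R * N := by positivity
  have e8 : 0 ≤ M * R * N ^ 2 := by positivity
  have e9 : 0 ≤ M * R := by positivity
  have e10 : 0 ≤ ε * Q := by positivity
  rw [hK]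
  linarith

section
variable {U Ux Uxx Ut A Ax : ℝ → ℝ → ℝ}

lemma bar2_alg2 {N ε M P x τ : ℝ} (hN : 0 ≤ N) (hε : 0 < ε) (hM : 0 < M) (hP : 0 < P)
    (hx : 0 < x) (hx1 : x < 1) (h0 : 0 ≤ τ) (h1 : τ ≤ x ^ 2 / 2) :
    |ε * ((N + 3) * (P * x ^ 2)) - M * ((N + 4) * (P * x ^ 3) - τ * ((N + 2) * (P * x)))| ≤
      ε * (N + 3) * (P * x ^ 2) + 2 * M * (N + 4) * (P * x ^ 2) ∧
    |ε * (P * x ^ 3) - M * (P * x ^ 4 - τ * (P * x ^ 2))| ≤ ε * (P * x ^ 2) + M * (P * x ^ 2) := by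
  have k1 : P * x ^ 3 ≤ P * x ^ 2 := mul_le_mul_of_nonneg_left (pow_le_pow_of_le_one hx.le hx1.le (by norm_num)) hP.le
  have k2 : P * x ^ 4 ≤ P * x ^ 2 := mul_le_mul_of_nonneg_left (pow_le_pow_of_le_one hx.le hx1.le (by norm_num)) hP.le
  have k3 : τ * (P * x) ≤ x ^ 2 / 2 * (P * x) := mul_le_mul_of_nonneg_right h1 (by positivity)
  have k4 : τ * (P * x ^ 2) ≤ x ^ 2 / 2 * (P * x ^ 2) := mul_le_mul_of_nonneg_right h1 (by positivity)
  have k5 : 0 ≤ τ * (P * x) := by positivity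
  have k6 : 0 ≤ τ * (P * x ^ 2) := by positivity
  have p2 : 0 < P * x ^ 2 := by positivity
  have p3 : 0 < P * x ^ 3 := by positivity
  have p4 : 0 < P * x ^ 4 := by positivity
  constructor
  · have m1 : 0 ≤ (N + 4) * (P * x ^ 3) - τ * ((N + 2) * (P * x)) := by
      have : (N + 2) * (τ * (P * x)) ≤ (N + 2) * (x ^ 2 / 2 * (P * x)) :=
        mul_le_mul_of_nonneg_left k3 (by linarith)
      have h5 : 0 ≤ N * (P * x ^ 3) := by positivity
      linarith
    have m2 : (N + 4) * (P * x ^ 3) - τ * ((N + 2) * (P * x)) ≤ (N + 4) * (P * x ^ 2) := by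
      have h5 : (N + 4) * (P * x ^ 3) ≤ (N + 4) * (P * x ^ 2) := mul_le_mul_of_nonneg_left k1 (by linarith)
      have h6 : 0 ≤ (N + 2) * (τ * (P * x)) := by positivity
      linarith
    have m3 := mul_nonneg hM.le m1
    have m4 := mul_le_mul_of_nonneg_left m2 hM.le
    have m5 : 0 ≤ ε * ((N + 3) * (P * x ^ 2)) := by positivity
    have m6 : 0 ≤ M * ((N + 4) * (P * x ^ 2)) := by positivity
    rw [abs_le]
    constructor <;> linarith
  · have m1 : 0 ≤ P * x ^ 4 - τ * (P * x ^ 2) := by linarith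
    have m3 := mul_nonneg hM.le m1
    have m4 : M * (P * x ^ 4 - τ * (P * x ^ 2)) ≤ M * (P * x ^ 2) :=
      mul_le_mul_of_nonneg_left (by linarith) hM.le
    have m5 : 0 ≤ ε * (P * x ^ 3) := by positivity
    have m6 := mul_le_mul_of_nonneg_left k1 hε.le
    have m7 : 0 ≤ M * (P * x ^ 2) := by positivity
    rw [abs_le]
    constructor <;> linarith

lemma CoreS.bar2t (h : CoreS U Ux Uxx Ut A Ax) {s ε ρ Y K1 M t'' : ℝ} {n : ℕ} (hs : |s| = 1)
    (hε : 0 < ε) (hρ : 0 < ρ) (hρ1 : ρ < 1) (hY : 0 < Y) (hK : K1 = 4 * ((n : ℝ) + 4) ^ 2)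
    (hYK : 2 * K1 ≤ Y ^ 2) (hM : M * ρ ^ (n + 4) = 2 * (1 + ε)) (ht'' : t'' < 0)
    (hpar : ∀ x ∈ Ioc 0 ρ, ε * x ^ (n + 3) ≤ s * U x (-(x ^ 2 / Y ^ 2))) {x : ℝ}
    (hx : x ∈ Ioo 0 ρ) (hxt : -t'' ≤ x ^ 2 / Y ^ 2) :
    x ^ (n + 3) * (ε - M * x) ≤ s * U x t'' := by
  have hsm : ∀ y, |s * y| = |y| := fun y => by rw [abs_mul, hs, one_mul]
  have hM0 : 0 < M := by
    have : 0 < M * ρ ^ (n + 4) := by rw [hM]; positivity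
    exact pos_of_mul_pos_left this (by positivity)
  have hK0 : 0 < K1 := by rw [hK]; positivity
  have hY2 : 1 < Y ^ 2 := by
    have : (0 : ℝ) ≤ n := by positivity
    have : 4 ≤ K1 := by rw [hK]; nlinarith
    linarith
  have hY20 : 0 < Y ^ 2 := by positivity
  have hKc : IsCompact {p : ℝ × ℝ | p.1 ∈ Icc 0 ρ ∧ p.2 ∈ Icc (-1) t'' ∧ -p.2 ≤ p.1 ^ 2 / Y ^ 2} := by
    have h1 : IsClosed {p : ℝ × ℝ | -p.2 ≤ p.1 ^ 2 / Y ^ 2} :=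
      isClosed_le (by fun_prop) (by fun_prop)
    have h2 := (isCompact_Icc (a := (0:ℝ)) (b := ρ)).prod (isCompact_Icc (a := (-1:ℝ)) (b := t''))
    refine (h2.inter_right h1).of_isClosed_subset ?_ ?_
    · have e : {p : ℝ × ℝ | p.1 ∈ Icc 0 ρ ∧ p.2 ∈ Icc (-1) t'' ∧ -p.2 ≤ p.1 ^ 2 / Y ^ 2} =
        (Icc 0 ρ ×ˢ Icc (-1) t'') ∩ {p : ℝ × ℝ | -p.2 ≤ p.1 ^ 2 / Y ^ 2} := by
        ext p; simp only [mem_setOf_eq, mem_inter_iff, mem_prod]; tauto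
      rw [e]; exact (h2.inter_right h1).isClosed
    · rintro p ⟨h3, h4, h5⟩
      exact ⟨⟨h3, h4⟩, h5⟩
  have facts : ∀ x t, (x, t) ∈ {p : ℝ × ℝ | p.1 ∈ Icc 0 ρ ∧ p.2 ∈ Icc (-1) t'' ∧ -p.2 ≤ p.1 ^ 2 / Y ^ 2} →
      0 < x ∧ x ≤ ρ ∧ -1 < t ∧ t ≤ t'' ∧ -t ≤ x ^ 2 / Y ^ 2 ∧ 0 ≤ K1 * (-t) ∧ K1 * (-t) ≤ x ^ 2 / 2 := by
    rintro x t ⟨h1, h2, h3⟩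
    simp only at h1 h2 h3
    have h4 : 0 < x ^ 2 / Y ^ 2 := by linarith [h2.2]
    have hx0 : 0 < x := by
      refine lt_of_le_of_ne h1.1 fun he => ?_
      rw [← he] at h4; simp at h4
    have hx2 : x ^ 2 < 1 := by nlinarith [h1.2]
    have h5 : x ^ 2 / Y ^ 2 < 1 := by rw [div_lt_one hY20]; linarith
    refine ⟨hx0, h1.2, by linarith, h2.2, h3, mul_nonneg hK0.le (by linarith [h2.2]), ?_⟩
    have h6 : K1 * (-t) ≤ K1 * (x ^ 2 / Y ^ 2) := mul_le_mul_of_nonneg_left h3 hK0.le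
    have h7 : K1 * (x ^ 2 / Y ^ 2) ≤ x ^ 2 / 2 := by
      rw [mul_div_assoc', div_le_iff₀ hY20]
      have := mul_le_mul_of_nonneg_right hYK (sq_nonneg x)
      linarith
    linarith
  have hn : (0 : ℝ) ≤ n := by positivity
  have key := h.barrier hKc (s := s)
    (β := fun x t => ε * x ^ (n + 3) - M * (x ^ (n + 4) + K1 * t * x ^ (n + 2)))
    (βx := fun x t => ε * (((n:ℝ) + 3) * x ^ (n + 2)) - M * (((n:ℝ) + 4) * x ^ (n + 3) + K1 * t * (((n:ℝ) + 2) * x ^ (n + 1))))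
    (βxx := fun x t => ε * (((n:ℝ) + 3) * (((n:ℝ) + 2) * x ^ (n + 1))) - M * (((n:ℝ) + 4) * (((n:ℝ) + 3) * x ^ (n + 2))
      + K1 * t * (((n:ℝ) + 2) * (((n:ℝ) + 1) * x ^ n))))
    (βt := fun x t => - M * (K1 * x ^ (n + 2)))
    ?_ hs (by fun_prop) ?_ ?_ ?_ ?_ ?_ x t'' ?_
  · refine le_trans ?_ key
    have : 0 ≤ M * (K1 * (-t'') * x ^ (n + 2)) := by
      have := hx.1
      have : 0 < - t'' := by linarith
      positivity
    have e : x ^ (n + 3) * (ε - M * x) = ε * x ^ (n + 3) - M * x ^ (n + 4) := by ring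
    rw [e]
    linarith
  · intro x t hxt
    obtain ⟨h1, h2, h3, h4, h5, h6, h7⟩ := facts x t hxt
    exact ⟨⟨by linarith, by linarith⟩, h3, by linarith⟩
  · intro x t
    have p2 := hasDerivAt_pow (n + 2) x
    have p3 := hasDerivAt_pow (n + 3) x
    have p4 := hasDerivAt_pow (n + 4) x
    refine ((p3.const_mul ε).sub ((p4.add (p2.const_mul (K1 * t))).const_mul M)).congr_deriv ?_
    push_cast
    simp
  · intro x t
    have p2 := hasDerivAt_pow (n + 2) x
    have p3 := hasDerivAt_pow (n + 3) x
    have p4 := hasDerivAt_pow (n + 1) x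
    refine (((p2.const_mul ((n:ℝ) + 3)).const_mul ε).sub (((p3.const_mul ((n:ℝ) + 4)).add
      ((p4.const_mul ((n:ℝ) + 2)).const_mul (K1 * t))).const_mul M)).congr_deriv ?_
    push_cast
    simp
  · intro x t
    have e : HasDerivAt (fun r : ℝ => K1 * r * x ^ (n + 2)) (K1 * x ^ (n + 2)) t := by
      simpa using ((hasDerivAt_id t).const_mul K1).mul_const (x ^ (n + 2))
    refine (((e.const_add (x ^ (n + 4))).const_mul M).const_sub (ε * x ^ (n + 3))).congr_deriv (by ring)
  · intro x t hxt
    obtain ⟨h1, h2, h3, h4, h5, h6, h7⟩ := facts x t hxt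
    have hx1 : x < 1 := by linarith
    have hA := h.A2 (x := x) (t := t) ⟨by linarith, by linarith⟩ ⟨h3, by linarith⟩
    have hP : 0 < x ^ n := by positivity
    obtain ⟨b1, b2⟩ := bar2_alg2 hn hε hM0 hP h1 hx1 h6 h7
    have := bar2_alg1 (A := A x t) hn hε hM0 (Q := x ^ n * x) (R := x ^ n * x ^ 2) (by positivity) (by positivity)
      (mul_le_mul_of_nonneg_left (by nlinarith) hP.le) hA.1 hA.2 hK
      (W := K1 * (-t) * (((n:ℝ) + 2) * (((n:ℝ) + 1) * x ^ n))) (by positivity) b1 b2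
    convert this using 1
    · ring
    · congr 1
      · ring
      · congr 2
        · congr 1; ring
        · congr 1; ring
  · intro x t hxt hlt
    obtain ⟨h1, h2, h3, h4, h5, h6, h7⟩ := facts x t hxt
    have hP : 0 < x ^ n := by positivity
    have k4 : K1 * (-t) * (x ^ n * x ^ 2) ≤ x ^ 2 / 2 * (x ^ n * x ^ 2) := mul_le_mul_of_nonneg_right h7 (by positivity)
    have e1 : x ^ (n + 4) / 2 ≤ x ^ (n + 4) + K1 * t * x ^ (n + 2) := by
      have r1 : x ^ (n + 4) = x ^ 2 * (x ^ n * x ^ 2) := by ring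
      have r2 : x ^ (n + 2) = x ^ n * x ^ 2 := by ring
      rw [r1, r2]; linarith
    have e2 := mul_le_mul_of_nonneg_left e1 hM0.le
    have hxρ : x < ρ := by
      refine lt_of_le_of_ne h2 fun he => ?_
      have hb := neg_abs_le (s * U x t)
      rw [hsm] at hb
      have hb2 := (h.b x t).1
      rw [he] at e2 hlt hb hb2
      have e3 : ε * ρ ^ (n + 3) ≤ ε * 1 := mul_le_mul_of_nonneg_left (pow_le_one₀ hρ.le hρ1.le) hε.le
      linarith
    have hpar2 : -t < x ^ 2 / Y ^ 2 := by
      refine lt_of_le_of_ne h5 fun he => ?_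
      have h8 := hpar x ⟨h1, h2⟩
      rw [← he, neg_neg] at h8
      have : 0 ≤ M * (x ^ (n + 4) / 2) := by positivity
      linarith
    constructor
    · have c1 : ∀ᶠ y in 𝓝 x, -t < y ^ 2 / Y ^ 2 :=
        (show ContinuousAt (fun y : ℝ => y ^ 2 / Y ^ 2) x by fun_prop).eventually (lt_mem_nhds hpar2)
      filter_upwards [Ioo_mem_nhds h1 hxρ, c1] with y hy hy2
      exact ⟨Ioo_subset_Icc_self hy, ⟨h3.le, h4⟩, hy2.le⟩
    · have : ∀ᶠ r in 𝓝[<] t, r ∈ Ioo (max (-1) (-(x ^ 2 / Y ^ 2))) t :=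
        Ioo_mem_nhdsLT (max_lt h3 (by linarith))
      filter_upwards [this] with r hr
      have := max_lt_iff.1 hr.1
      exact ⟨⟨h1.le, h2⟩, ⟨this.1.le, hr.2.le.trans h4⟩, by linarith [this.2]⟩
  · have hx2 : x ^ 2 / Y ^ 2 < 1 := by
      rw [div_lt_one hY20]; nlinarith [hx.1, hx.2]
    exact ⟨⟨hx.1.le, hx.2.le⟩, ⟨by simp only; linarith, le_refl _⟩, hxt⟩

lemma CoreS.bar2 (h : CoreS U Ux Uxx Ut A Ax) {s ε ρ Y K1 : ℝ} {n : ℕ} (hs : |s| = 1)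
    (hε : 0 < ε) (hρ : 0 < ρ) (hρ1 : ρ < 1) (hY : 0 < Y) (hK : K1 = 4 * ((n : ℝ) + 4) ^ 2)
    (hYK : 2 * K1 ≤ Y ^ 2)
    (hpar : ∀ x ∈ Ioc 0 ρ, ε * x ^ (n + 3) ≤ s * U x (-(x ^ 2 / Y ^ 2))) :
    ∃ ρ' > 0, ∀ x ∈ Ioo 0 ρ', U x 0 ≠ 0 := by
  obtain ⟨M, hM⟩ : ∃ M, M * ρ ^ (n + 4) = 2 * (1 + ε) :=
    ⟨2 * (1 + ε) / ρ ^ (n + 4), by field_simp⟩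
  have hM0 : 0 < M := by
    have : 0 < M * ρ ^ (n + 4) := by rw [hM]; positivity
    exact pos_of_mul_pos_left this (by positivity)
  refine ⟨min ρ (ε / M), by positivity, fun x hx h0 => ?_⟩
  have hx1 : x < ρ := hx.2.trans_le (min_le_left _ _)
  have hx2 : x < ε / M := hx.2.trans_le (min_le_right _ _)
  rw [lt_div_iff₀ hM0] at hx2
  have hpos : 0 < x ^ (n + 3) * (ε - M * x) := mul_pos (pow_pos hx.1 _) (by linarith)
  have hlim : Tendsto (fun t => s * U x t) (𝓝[<] 0) (𝓝 (s * U x 0)) :=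
    (((cfix' h.cU x).const_mul s).tendsto 0).mono_left nhdsWithin_le_nhds
  have hge : x ^ (n + 3) * (ε - M * x) ≤ s * U x 0 := by
    refine ge_of_tendsto hlim ?_
    have h4 : 0 < x ^ 2 / Y ^ 2 := by have := hx.1; positivity
    filter_upwards [Ioo_mem_nhdsLT (show -(x ^ 2 / Y ^ 2) < 0 by linarith)] with t ht
    exact h.bar2t hs hε hρ hρ1 hY hK hYK hM ht.2 hpar ⟨hx.1, hx1⟩ (by linarith [ht.1])
  rw [h0, mul_zero] at hge
  linarith
end

open Set Filter Topology

lemma const_sign {f : ℝ → ℝ} {S : Set ℝ} (hS : S.OrdConnected) (hf : ContinuousOn f S)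
    (h0 : ∀ x ∈ S, f x ≠ 0) : ∃ s : ℝ, |s| = 1 ∧ ∀ x ∈ S, s * f x = |f x| := by
  by_cases hp : ∃ a ∈ S, 0 < f a
  · obtain ⟨a, ha, hfa⟩ := hp
    refine ⟨1, by simp, fun x hx => ?_⟩
    have : 0 < f x := by
      by_contra hn
      push Not at hn
      obtain ⟨y, hy, hy0⟩ := hS.isPreconnected.intermediate_value hx ha hf ⟨hn, hfa.le⟩
      exact h0 y hy hy0
    rw [one_mul, abs_of_pos this]
  · push Not at hp
    refine ⟨-1, by simp, fun x hx => ?_⟩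
    rw [abs_of_nonpos (hp x hx)]; ring

noncomputable def gf (v : ℝ → ℝ → ℝ) (t : ℝ) : ℝ := Real.sqrt (Hf v t / Real.sqrt (-t))

lemma gf_sq {v : ℝ → ℝ → ℝ} {t r : ℝ} (hr : 0 < r) (ht : t = -r ^ 2) (hH : 0 < Hf v t) :
    0 < gf v t ∧ gf v t ^ 2 * r = Hf v t := by
  have e : Real.sqrt (-t) = r := by rw [ht, neg_neg]; exact Real.sqrt_sq hr.le
  unfold gf
  rw [e]
  refine ⟨by positivity, ?_⟩
  rw [Real.sq_sqrt (by positivity)]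
  field_simp

lemma gf_dbl {v vx vxx : ℝ → ℝ → ℝ} {t0 Nb t t' r r' : ℝ} (q : FQ v vx vxx t0 Nb) (hr : 0 < r)
    (hr' : 0 < r') (ht : t = -r ^ 2) (ht' : t' = -r' ^ 2) (h0 : t ∈ Ico t0 0) (h0' : t' ∈ Ico t0 0)
    (hle : t' ≤ t) (hrr : r' ≤ 2 * r) : gf v t ≤ 2 * gf v t' := by
  obtain ⟨g1, e1⟩ := gf_sq hr ht ((Real.exp_pos _).trans_le (q.hS t h0))
  obtain ⟨g2, e2⟩ := gf_sq hr' ht' ((Real.exp_pos _).trans_le (q.hS t' h0'))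
  have hd := q.dbl t' h0' t h0 hle
  rw [← e1, ← e2] at hd
  have h3 : gf v t' ^ 2 * r' ≤ gf v t' ^ 2 * (2 * r) := mul_le_mul_of_nonneg_left hrr (by positivity)
  have h4 : gf v t ^ 2 * r ≤ (2 * gf v t') ^ 2 * r := by linarith
  have h5 := le_of_mul_le_mul_right h4 hr
  exact le_of_sq_le_sq h5 (by positivity) 
where
  le_of_sq_le_sq {a b : ℝ} (h : a ^ 2 ≤ b ^ 2) (hb : 0 ≤ b) : a ≤ b := abs_le_of_sq_le_sq' h hb |>.2

lemma chi_half {x : ℝ} (hx : |x| ≤ 1 / 2) : 1 / 2 ≤ chi x := by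
  have h1 := abs_le.1 hx
  rw [(chi_eq (x := x) ⟨by linarith, by linarith⟩).1]
  have := hlp_sq hx
  nlinarith

section
variable {U Ux Uxx Ut A Ax vx vxx vt : ℝ → ℝ → ℝ} {C t0 Nb : ℝ}

lemma supU (h : VS (fun x t => chi x * U x t) vx vxx vt A Ax C)
    (q : FQ (fun x t => chi x * U x t) vx vxx t0 Nb) (hNb : 0 ≤ Nb) {K : ℝ} (hK : 0 ≤ K) :
    ∃ S > 0, ∀ t ∈ Ico t0 0, ∀ r > 0, t = -r ^ 2 → K * r ≤ 1 / 2 → ∀ x, |x| ≤ K * r →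
      |U x t| ≤ S * gf (fun x t => chi x * U x t) t := by
  refine ⟨2 * Real.sqrt (10 * (Nb + 1) * Real.exp (K ^ 2 / 4)), by positivity, ?_⟩
  intro t ht r hr htr hKr x hx
  obtain ⟨g1, e1⟩ := gf_sq hr htr ((Real.exp_pos _).trans_le (q.hS t ht))
  have hw := h.ws ⟨by linarith [q.ht0.1, ht.1], ht.2⟩ hr htr g1 e1
  set g := gf (fun x t => chi x * U x t) t with hg
  have hyK : |x / r| ≤ K := by rw [abs_div, abs_of_pos hr, div_le_iff₀ hr]; exact hx
  have hyl : |x / r| ≤ 1 / r := by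
    rw [abs_div, abs_of_pos hr]; gcongr; linarith
  have hs := hw.sup (y := x / r) (abs_le.1 hyl)
  have hxr : r * (x / r) = x := by field_simp
  simp only [hxr] at hs
  have hN := q.hN t ht
  have hga : Real.exp (-(K ^ 2 / 4)) ≤ ga (x / r) := by
    unfold ga
    rw [Real.exp_le_exp]
    have := hlp_sq hyK
    linarith
  have h1 : (chi x * U x t / g) ^ 2 * Real.exp (-(K ^ 2 / 4)) ≤ 10 * (Nb + 1) := by
    have := mul_le_mul_of_nonneg_left hga (sq_nonneg (chi x * U x t / g))
    linarith
  have h2 : (chi x * U x t / g) ^ 2 ≤ 10 * (Nb + 1) * Real.exp (K ^ 2 / 4) := by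
    rw [Real.exp_neg, ← div_eq_mul_inv, div_le_iff₀ (Real.exp_pos _)] at h1
    exact h1
  have h3 : |chi x * U x t / g| ≤ Real.sqrt (10 * (Nb + 1) * Real.exp (K ^ 2 / 4)) :=
    Real.abs_le_sqrt h2
  rw [abs_div, abs_of_pos g1, div_le_iff₀ g1, abs_mul, abs_of_nonneg (chi_bd x).1] at h3
  have h4 : 1 / 2 * |U x t| ≤ chi x * |U x t| :=
    mul_le_mul_of_nonneg_right (chi_half (by linarith)) (abs_nonneg _)
  linarith

lemma parab (h : CoreS U Ux Uxx Ut A Ax) (hv : VS (fun x t => chi x * U x t) vx vxx vt A Ax C)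
    (q : FQ (fun x t => chi x * U x t) vx vxx t0 Nb) (hNb : 0 ≤ Nb) {Y : ℝ}
    (hY : 1 + 32 * (Nb + 1) ≤ Y) {cH : ℝ} {p : ℕ} (hcH : 0 < cH)
    (hH : ∀ t ∈ Ico t0 (0:ℝ), cH * (-t) ^ p ≤ Hf (fun x t => chi x * U x t) t) :
    ∃ c > 0, ∃ ρ0 > 0, ρ0 ≤ 1 ∧ ∀ ρ ∈ Ioo 0 ρ0, c * ρ ^ p ≤ |U (Y * ρ) (-ρ ^ 2)| := by
  set v := fun x t => chi x * U x t with hvdef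
  obtain ⟨μ, hμ, hW⟩ := lemW (Λ := Nb) (K := Y + 1) hNb (by linarith)
  obtain ⟨S, hS, hsup⟩ := supU hv q hNb (K := 2 * (Y + 1)) (by linarith)
  obtain ⟨η, hη, hη1, hη2, hη3⟩ : ∃ η > 0, η ≤ 1 / 2 ∧ Y * η ≤ 1 / 2 ∧ η * (100 * (μ + 2 * S)) ≤ μ := by
    have hY0 : 0 < Y := by linarith
    refine ⟨min (1 / 2) (min (1 / (2 * Y)) (μ / (100 * (μ + 2 * S)))), by positivity, min_le_left _ _, ?_, ?_⟩
    · have : min (1 / 2) (min (1 / (2 * Y)) (μ / (100 * (μ + 2 * S)))) ≤ 1 / (2 * Y) :=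
        (min_le_right _ _).trans (min_le_left _ _)
      refine (mul_le_mul_of_nonneg_left this hY0.le).trans (le_of_eq ?_)
      field_simp
    · have : min (1 / 2) (min (1 / (2 * Y)) (μ / (100 * (μ + 2 * S)))) ≤ μ / (100 * (μ + 2 * S)) :=
        (min_le_right _ _).trans (min_le_right _ _)
      exact (le_div_iff₀ (by positivity)).1 this
  obtain ⟨t1, ht1, hgood⟩ := good_times q hμ hη (by linarith)
  have hY0 : 0 < Y := by linarith
  obtain ⟨ρ0, hρ0, hρa, hρb⟩ : ∃ ρ0 > 0, 2 * ρ0 ^ 2 ≤ -t1 ∧ 2 * (Y + 1) * (2 * ρ0) ≤ 1 / 2 := by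
    have h1 : 0 < -t1 := by linarith [ht1.2]
    refine ⟨min (Real.sqrt (-t1 / 2)) (1 / (8 * (Y + 1))), by positivity, ?_, ?_⟩
    · have h2 : (min (Real.sqrt (-t1 / 2)) (1 / (8 * (Y + 1)))) ^ 2 ≤ (Real.sqrt (-t1 / 2)) ^ 2 :=
        pow_le_pow_left₀ (by positivity) (min_le_left _ _) 2
      rw [Real.sq_sqrt (by positivity)] at h2
      linarith
    · have h2 := min_le_right (Real.sqrt (-t1 / 2)) (1 / (8 * (Y + 1)))
      rw [le_div_iff₀ (by positivity)] at h2
      linarith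
  have hρ01 : ρ0 ≤ 1 := by nlinarith
  refine ⟨μ / 2 * Real.sqrt cH, by positivity, ρ0, hρ0, hρ01, fun ρ hρ => ?_⟩
  have hρ2 : 0 < ρ ^ 2 := by have := hρ.1; positivity
  have hρ20 : ρ ^ 2 ≤ ρ0 ^ 2 := pow_le_pow_left₀ hρ.1.le hρ.2.le 2
  -- the window
  obtain ⟨T, hT, hTe⟩ : ∃ T, T ∈ Ico t1 0 ∧ (1 - η) * T = -ρ ^ 2 := by
    have h1 : 0 < 1 - η := by linarith
    refine ⟨-ρ ^ 2 / (1 - η), ⟨?_, div_neg_of_neg_of_pos (by linarith) h1⟩, by field_simp⟩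
    rw [le_div_iff₀ h1]
    have : (1 - η) * -t1 ≥ 1 / 2 * -t1 := mul_le_mul_of_nonneg_right (by linarith) (by linarith [ht1.2])
    linarith
  obtain ⟨t', ht', hV⟩ := hgood T hT
  rw [hTe] at ht'
  have ht'0 : t' < 0 := by linarith [ht'.2]
  have ht'm : t' ∈ Ico t0 0 := ⟨by linarith [ht1.1, hT.1, ht'.1], ht'0⟩
  have htm : -ρ ^ 2 ∈ Ico t0 0 := ⟨by linarith [ht'm.1, ht'.2], by linarith⟩
  have hwin : -ρ ^ 2 - t' ≤ η * (-t') := by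
    have : (1 - η) * T ≤ (1 - η) * t' := mul_le_mul_of_nonneg_left ht'.1.le (by linarith)
    linarith
  obtain ⟨r, hr, hrt⟩ : ∃ r > 0, t' = -r ^ 2 :=
    ⟨Real.sqrt (-t'), Real.sqrt_pos.2 (by linarith), by rw [Real.sq_sqrt (by linarith)]; ring⟩
  have hwin' : -ρ ^ 2 - t' ≤ η * r ^ 2 := by rw [hrt] at hwin ⊢; linarith
  have hρr : ρ ≤ r := by
    refine le_of_lt (lt_of_pow_lt_pow_left₀ 2 hr.le ?_)
    rw [hrt] at ht'; linarith [ht'.2]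
  have hrρ : (1 - η) * r ≤ ρ := by
    refine le_of_sq_le_sq ?_ hρ.1.le
    have h1 : (1 - η) * r ^ 2 ≤ ρ ^ 2 := by rw [hrt] at hwin'; linarith
    have h2 : (1 - η) * ((1 - η) * r ^ 2) ≤ 1 * ((1 - η) * r ^ 2) :=
      mul_le_mul_of_nonneg_right (by linarith) (mul_nonneg (by linarith) (by positivity))
    calc ((1 - η) * r) ^ 2 = (1 - η) * ((1 - η) * r ^ 2) := by ring
      _ ≤ ρ ^ 2 := by linarith
  have hr2ρ : r ≤ 2 * ρ := by
    have : 1 / 2 * r ≤ (1 - η) * r := mul_le_mul_of_nonneg_right (by linarith) hr.le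
    linarith
  have hrs : 2 * (Y + 1) * r ≤ 1 / 2 := by
    have : 2 * (Y + 1) * r ≤ 2 * (Y + 1) * (2 * ρ0) := mul_le_mul_of_nonneg_left (by linarith [hρ.2]) (by linarith)
    linarith
  have hYr : (Y + 1) * r ≤ 1 / 4 := by linarith
  have hr1 : r < 1 := by
    have : 1 * r ≤ (Y + 1) * r := mul_le_mul_of_nonneg_right (by linarith) hr.le
    linarith
  obtain ⟨g1, e1⟩ := gf_sq hr hrt ((Real.exp_pos _).trans_le (q.hS t' ht'm))
  have hws := hv.ws ⟨by linarith [q.ht0.1, ht'm.1], ht'0⟩ hr hrt g1 e1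
  obtain ⟨g, hg⟩ : ∃ g, g = gf v t' := ⟨_, rfl⟩
  rw [← hg] at g1 e1 hws
  -- lower bound at the good time
  have hlow : ∀ x ∈ Icc ((Y - 1) * r) ((Y + 1) * r), μ * g ≤ |U x t'| := by
    intro x hx
    have hxr : r * (x / r) = x := by field_simp
    have hy1 : Y - 1 ≤ x / r := (le_div_iff₀ hr).2 hx.1
    have hy2 : x / r ≤ Y + 1 := (div_le_iff₀ hr).2 hx.2
    have hm := hW _ _ _ _ _ _ hws hV (q.hN t' ht'm) (x / r) (by linarith) (by
        have h3 : (Y - 1) ^ 2 ≤ (x / r) ^ 2 := pow_le_pow_left₀ (by linarith) hy1 2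
        nlinarith) hy2 (by
        rw [div_le_div_iff_of_pos_right hr]; linarith [hx.2])
    simp only [hxr] at hm
    have hm2 : μ ≤ |chi x * U x t' / g| := hm
    rw [abs_div, abs_of_pos g1, le_div_iff₀ g1, abs_mul, abs_of_nonneg (chi_bd x).1] at hm2
    have := mul_le_mul_of_nonneg_right (chi_bd x).2.1 (abs_nonneg (U x t'))
    linarith
  obtain ⟨s, hs, hss⟩ := const_sign (S := Icc ((Y - 1) * r) ((Y + 1) * r)) ordConnected_Icc
    (cfix h.cU t').continuousOn (fun x hx h0 => by
      have := hlow x hx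
      rw [h0, abs_zero] at this
      have : 0 < μ * g := by positivity
      linarith)
  have hxcr : Y * r - r / 2 ≤ Y * ρ ∧ Y * ρ ≤ Y * r := by
    constructor
    · have a1 := mul_le_mul_of_nonneg_left hrρ hY0.le
      have a2 := mul_le_mul_of_nonneg_right hη2 hr.le
      linarith
    · exact mul_le_mul_of_nonneg_left hρr hY0.le
  have hsubx : ∀ x ∈ Icc (Y * ρ - r / 2) (Y * ρ + r / 2), x ∈ Icc ((Y - 1) * r) ((Y + 1) * r) :=
    fun x hx => ⟨by linarith [hx.1, hxcr.1], by linarith [hx.2, hxcr.2]⟩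
  have hY1r : 0 ≤ (Y - 1) * r := mul_nonneg (by linarith) hr.le
  have fin := h.fill (s := s) (c := μ) (S := 2 * S) (g := g) (r := r) (xc := Y * ρ) (t' := t')
    (t1 := -ρ ^ 2) (η := η) hs hμ (by positivity) g1 hr hrt hr1
    (by linarith [hxcr.1]) (by linarith [hxcr.2]) ht'.2.le (by linarith) hwin' hη3
    (fun x hx => by rw [hss x (hsubx x hx)]; exact hlow x (hsubx x hx))
    (fun x hx t ht => by
      obtain ⟨r2, hr2, hr2t⟩ : ∃ r2 > 0, t = -r2 ^ 2 :=
        ⟨Real.sqrt (-t), Real.sqrt_pos.2 (by linarith [ht.2]),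
          by rw [Real.sq_sqrt (by linarith [ht.2])]; ring⟩
      have htm2 : t ∈ Ico t0 0 := ⟨ht'm.1.trans ht.1, by linarith [ht.2]⟩
      have b1 : ρ ≤ r2 := le_of_sq_le_sq (by rw [hr2t] at ht; linarith [ht.2]) hr2.le
      have b2 : r2 ≤ r := le_of_sq_le_sq (by rw [hr2t, hrt] at ht; linarith [ht.1]) hr.le
      have b3 := gf_dbl q hr2 hr hr2t hrt htm2 ht'm ht.1 (by linarith)
      have hx2 := hsubx x hx
      have b4 := hsup t htm2 r2 hr2 hr2t
        ((mul_le_mul_of_nonneg_left b2 (by linarith)).trans hrs) x (by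
          rw [abs_of_nonneg (by linarith [hx2.1])]
          have : 2 * (Y + 1) * ρ ≤ 2 * (Y + 1) * r2 := mul_le_mul_of_nonneg_left b1 (by linarith)
          have : (Y + 1) * r ≤ (Y + 1) * (2 * ρ) := mul_le_mul_of_nonneg_left hr2ρ (by linarith)
          linarith [hx2.2])
      rw [← hg] at b3
      have b5 := mul_le_mul_of_nonneg_left b3 hS.le
      linarith)
  have habs : s * U (Y * ρ) (-ρ ^ 2) ≤ |U (Y * ρ) (-ρ ^ 2)| := by
    refine (le_abs_self _).trans (le_of_eq ?_)
    rw [abs_mul, hs, one_mul]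
  have hgl : Real.sqrt cH * ρ ^ p ≤ g := by
    refine le_of_sq_le_sq ?_ g1.le
    have k1 := hH t' ht'm
    rw [← e1] at k1
    have k2 : g ^ 2 * r ≤ g ^ 2 * 1 := mul_le_mul_of_nonneg_left hr1.le (by positivity)
    have k3 : (ρ ^ 2) ^ p ≤ (-t') ^ p := pow_le_pow_left₀ hρ2.le (by linarith [ht'.2]) p
    have k4 := mul_le_mul_of_nonneg_left k3 hcH.le
    rw [mul_pow, Real.sq_sqrt hcH.le, ← pow_mul, mul_comm p 2, pow_mul]
    linarith
  have := mul_le_mul_of_nonneg_left hgl (show 0 ≤ μ / 2 by positivity)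
  linarith
where
  le_of_sq_le_sq {a b : ℝ} (h : a ^ 2 ≤ b ^ 2) (hb : 0 ≤ b) : a ≤ b := abs_le_of_sq_le_sq' h hb |>.2
end

open Set Filter Topology

section
variable {U Ux Uxx Ut A Ax : ℝ → ℝ → ℝ}

lemma CoreS.isoR (h : CoreS U Ux Uxx Ut A Ax) {xa xb κ δ : ℝ} (hab : xa < xb)
    (ha : -(1 / 8) ≤ xa) (hb : xb ≤ 1 / 8) (hκ : 0 < κ) (hδ : 0 < δ)
    (hU : ∀ x ∈ Icc xa xb, ∀ t ∈ Ioo (-δ) 0, κ ≤ |U x t|) :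
    ∃ ρ > 0, ∀ x ∈ Ioo 0 ρ, U x 0 ≠ 0 := by
  have hv := h.vs
  obtain ⟨κ', hκ', hlow⟩ := h.Hlow hab ha hb hκ hU
  obtain ⟨t0, Nb, q⟩ := freq hv hκ' hδ hlow
  have hNb : 0 ≤ Nb := (Nf_nonneg q.ht0.2).trans (q.hN t0 ⟨le_refl _, q.ht0.2⟩)
  -- exponent first
  obtain ⟨cH, hcH, p0, hH⟩ := H_low hv q
  have step : ∀ Y, 1 + 32 * (Nb + 1) ≤ Y → ∃ c > 0, ∃ ρ0 > 0, ρ0 ≤ 1 ∧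
      ∀ ρ ∈ Ioo 0 ρ0, c * ρ ^ p0 ≤ |U (Y * ρ) (-ρ ^ 2)| := fun Y hY => parab h hv q hNb hY hcH hH
  obtain ⟨K1, hK1⟩ : ∃ K1 : ℝ, K1 = 4 * ((p0 : ℝ) + 4) ^ 2 := ⟨_, rfl⟩
  have hK0 : 0 < K1 := by rw [hK1]; positivity
  obtain ⟨Y, hYd⟩ : ∃ Y, Y = 1 + 32 * (Nb + 1) + 2 * K1 := ⟨_, rfl⟩
  have hY1 : 1 ≤ Y := by linarith
  obtain ⟨c, hc, ρ0, hρ0, hρ1, hP⟩ := step Y (by linarith)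
  have hY0 : 0 < Y := by linarith
  obtain ⟨s, hs, hss⟩ := const_sign (f := fun ρ => U (Y * ρ) (-ρ ^ 2)) (S := Ioo 0 ρ0) ordConnected_Ioo
    (by
      have : Continuous (fun ρ : ℝ => ((Y * ρ, -ρ ^ 2) : ℝ × ℝ)) := by fun_prop
      exact (h.cU.comp this).continuousOn)
    (fun ρ hρ h0 => by
      have h1 := hP ρ hρ
      rw [h0, abs_zero] at h1
      have : 0 < c * ρ ^ p0 := by have := hρ.1; positivity
      linarith)
  refine h.bar2 (s := s) (ε := c / Y ^ (p0 + 3)) (ρ := ρ0 / 2) (Y := Y) (n := p0) hs (by positivity)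
    (by linarith) (by linarith) hY0 hK1 (by nlinarith) ?_
  intro x hx
  have hxY : 0 < x / Y := div_pos hx.1 hY0
  have hxY2 : x / Y < ρ0 := by
    rw [div_lt_iff₀ hY0]
    have := mul_le_mul_of_nonneg_left hY1 hρ0.le
    linarith [hx.2]
  have h1 := hP (x / Y) ⟨hxY, hxY2⟩
  have h2 := hss (x / Y) ⟨hxY, hxY2⟩
  rw [← h2] at h1
  have e1 : Y * (x / Y) = x := by field_simp
  rw [e1, div_pow x Y 2] at h1
  have e2 : c / Y ^ (p0 + 3) * x ^ (p0 + 3) = c * (x / Y) ^ (p0 + 3) := by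
    rw [div_pow]; ring
  rw [e2]
  refine le_trans (mul_le_mul_of_nonneg_left ?_ hc.le) h1
  exact pow_le_pow_of_le_one hxY.le (by linarith) (by omega)

lemma CoreS.refl (h : CoreS U Ux Uxx Ut A Ax) : CoreS (fun x t => U (-x) t) (fun x t => -Ux (-x) t)
    (fun x t => Uxx (-x) t) (fun x t => Ut (-x) t) (fun x t => A (-x) t) (fun x t => -Ax (-x) t) := by
  have m1 : ∀ x ∈ Ioo (-1 : ℝ) 1, -x ∈ Ioo (-1 : ℝ) 1 := fun x hx => ⟨by linarith [hx.2], by linarith [hx.1]⟩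
  have m2 : ∀ x ∈ Icc (-1 : ℝ) 1, -x ∈ Icc (-1 : ℝ) 1 := fun x hx => ⟨by linarith [hx.2], by linarith [hx.1]⟩
  have hc : Continuous (fun q : ℝ × ℝ => ((-q.1, q.2) : ℝ × ℝ)) := by fun_prop
  have hd : ∀ x : ℝ, HasDerivAt (fun y : ℝ => -y) (-1) x := fun x => hasDerivAt_neg x
  refine ⟨h.cU.comp hc, (h.cUx.comp hc).neg, h.cUxx.comp hc, h.cUt.comp hc,
    fun t => (h.cA t).comp continuous_neg, fun t => ((h.cAx t).comp continuous_neg).neg, ?_, ?_, ?_, ?_, ?_, ?_, ?_, ?_⟩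
  · intro x hx t ht
    exact ((h.dx _ (m1 x hx) t ht).comp x (hd x)).congr_deriv (by ring)
  · intro x hx t ht
    exact ((h.dxx _ (m1 x hx) t ht).comp x (hd x)).neg.congr_deriv (by ring)
  · intro x hx t ht
    exact h.dt _ (m2 x hx) t ht
  · intro x hx t ht
    exact ((h.dA _ (m1 x hx) t ht).comp x (hd x)).congr_deriv (by ring)
  · intro x hx t ht
    exact h.bA _ (m2 x hx) t ht
  · intro x hx t ht
    rw [abs_neg]
    exact h.bAx _ (m2 x hx) t ht
  · intro x t
    have := h.b (-x) t
    simpa using this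
  · intro x hx t ht
    have := h.e _ (m2 x hx) t ht
    simpa using this

lemma CoreS.iso (h : CoreS U Ux Uxx Ut A Ax) {xa xb κ δ : ℝ} (hab : xa < xb)
    (ha : -(1 / 8) ≤ xa) (hb : xb ≤ 1 / 8) (hκ : 0 < κ) (hδ : 0 < δ)
    (hU : ∀ x ∈ Icc xa xb, ∀ t ∈ Ioo (-δ) 0, κ ≤ |U x t|) :
    ∃ ρ > 0, ∀ x, x ≠ 0 → |x| < ρ → U x 0 ≠ 0 := by
  obtain ⟨r1, h1, k1⟩ := h.isoR hab ha hb hκ hδ hU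
  obtain ⟨r2, h2, k2⟩ := h.refl.isoR (xa := -xb) (xb := -xa) (by linarith) (by linarith) (by linarith) hκ hδ
    (fun x hx t ht => hU (-x) ⟨by linarith [hx.2], by linarith [hx.1]⟩ t ht)
  refine ⟨min r1 r2, by positivity, fun x hx0 hx => ?_⟩
  have m1 := hx.trans_le (min_le_left _ _)
  have m2 := hx.trans_le (min_le_right _ _)
  rcases lt_or_gt_of_ne hx0 with h0 | h0
  · rw [abs_of_neg h0] at m2
    have := k2 (-x) ⟨by linarith, m2⟩
    simpa using this
  · rw [abs_of_pos h0] at m1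
    exact k1 x ⟨h0, m1⟩

lemma CoreS.noPat (h : CoreS U Ux Uxx Ut A Ax) {xa xb κ δ C δ' : ℝ} (hab : xa < xb)
    (ha : -(1 / 8) ≤ xa) (hb : xb ≤ 1 / 8) (hκ : 0 < κ) (hδ : 0 < δ)
    (hU : ∀ x ∈ Icc xa xb, ∀ t ∈ Ioo (-δ) 0, κ ≤ |U x t|)
    (hup : ∀ x ∈ Icc (-1 : ℝ) 1, ∀ t ∈ Ioo (-1 : ℝ) 0, |U x t| ≤ C * (x ^ 2 + -t)) (hδ' : 0 < δ') :
    ∃ t ∈ Ioo (-δ') 0, ∀ y σ : ℝ, |σ| = 1 → ¬ ∀ x ∈ Icc (-1 : ℝ) 1, 0 ≤ σ * U x t * (x - y) := by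
  have hv := h.vs
  obtain ⟨κ', hκ', hlow⟩ := h.Hlow hab ha hb hκ hU
  obtain ⟨t0, Nb, q⟩ := freq hv hκ' hδ hlow
  have hNb : 0 ≤ Nb := (Nf_nonneg q.ht0.2).trans (q.hN t0 ⟨le_refl _, q.ht0.2⟩)
  obtain ⟨K, hK, hHu⟩ := h.Hup hup
  obtain ⟨t1, ht1, hN9⟩ := N_low hv q hK (fun t ht => hHu t ⟨by linarith [q.ht0.1, ht.1], ht.2⟩)
  obtain ⟨μ, hμ, htwo⟩ := twoSign hNb
  obtain ⟨t2, ht2, hgood⟩ := good_times q hμ (η := 1 / 2) (by norm_num) (by norm_num)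
  have hmax : max (max t1 t2) (-δ' / 2) < 0 := max_lt (max_lt ht1.2 ht2.2) (by linarith)
  have a1 : t1 ≤ max (max t1 t2) (-δ' / 2) := (le_max_left _ _).trans (le_max_left _ _)
  have a2 : t2 ≤ max (max t1 t2) (-δ' / 2) := (le_max_right _ _).trans (le_max_left _ _)
  have a3 : -δ' / 2 ≤ max (max t1 t2) (-δ' / 2) := le_max_right _ _
  obtain ⟨t', ht', hV⟩ := hgood _ ⟨a2, hmax⟩
  have ht'0 : t' < 0 := by linarith [ht'.2]
  refine ⟨t', ⟨by linarith [ht'.1], ht'0⟩, fun y σ hσ hpat => ?_⟩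
  have ht'm : t' ∈ Ico t0 0 := ⟨by linarith [ht'.1, ht1.1], ht'0⟩
  obtain ⟨r, hr, hrt⟩ : ∃ r > 0, t' = -r ^ 2 :=
    ⟨Real.sqrt (-t'), Real.sqrt_pos.2 (by linarith), by rw [Real.sq_sqrt (by linarith)]; ring⟩
  obtain ⟨g1, e1⟩ := gf_sq hr hrt ((Real.exp_pos _).trans_le (q.hS t' ht'm))
  have hws := hv.ws ⟨by linarith [q.ht0.1, ht'm.1], ht'0⟩ hr hrt g1 e1
  refine htwo _ _ _ _ _ _ hws hV (q.hN t' ht'm) (hN9 t' ⟨by linarith [ht'.1], ht'0⟩) (y / r) σ hσ ?_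
  intro z hz
  have hlr : r * (1 / r) = 1 := by field_simp
  have hlr' : r * -(1 / r) = -1 := by field_simp
  have hp := hpat (r * z) ⟨by rw [← hlr']; exact mul_le_mul_of_nonneg_left hz.1 hr.le,
    by rw [← hlr]; exact mul_le_mul_of_nonneg_left hz.2 hr.le⟩
  have e : σ * (chi (r * z) * U (r * z) t' / gf (fun x t => chi x * U x t) t') * (z - y / r) =
    (chi (r * z) / (gf (fun x t => chi x * U x t) t' * r)) * (σ * U (r * z) t' * (r * z - y)) := by
    field_simp
  simp only [e]
  exact mul_nonneg (div_nonneg (chi_bd _).1 (by positivity)) hp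
end

open Set Filter Topology

lemma ode_chg {al al1 : ℝ → ℝ} {x1 x2 z : ℝ} (hz : z ∈ Ioo x1 x2)
    (hd : ∀ x ∈ Icc x1 x2, HasDerivAt al (al1 x) x) (hc : ContinuousOn al1 (Icc x1 x2))
    (hpos : ∀ x ∈ Icc x1 x2, 0 < al x) :
    ∃ d > 0, ∃ Xf : ℝ → ℝ, Xf 0 = z ∧
      ∀ y ∈ Ioo (-d) d, Xf y ∈ Ioo x1 x2 ∧ HasDerivAt Xf (Real.sqrt (al (Xf y))) y := by
  have hac : ContinuousOn al (Icc x1 x2) := fun x hx => (hd x hx).continuousAt.continuousWithinAt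
  have hC1 : ContDiffAt ℝ 1 (fun x => Real.sqrt (al x)) z := by
    rw [contDiffAt_one_iff]
    refine ⟨fun x => ContinuousLinearMap.smulRight (1 : ℝ →L[ℝ] ℝ) (al1 x / (2 * Real.sqrt (al x))), Icc x1 x2,
      Icc_mem_nhds hz.1 hz.2, ?_, ?_⟩
    · have h1 : ContinuousOn (fun x => al1 x / (2 * Real.sqrt (al x))) (Icc x1 x2) := by
        refine hc.div (continuousOn_const.mul hac.sqrt) fun x hx => ?_
        have := hpos x hx
        positivity
      exact (ContinuousLinearMap.smulRightL ℝ ℝ ℝ (1 : ℝ →L[ℝ] ℝ)).continuous.comp_continuousOn h1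
    · intro x hx
      exact ((hd x hx).sqrt (hpos x hx).ne').hasFDerivAt
  obtain ⟨Xf, h0, d, hd0, hX⟩ := hC1.exists_forall_mem_closedBall_exists_eq_forall_mem_Ioo_hasDerivAt₀ 0
  have hcont : ContinuousAt Xf 0 := (hX 0 ⟨by linarith, by linarith⟩).continuousAt
  have hev : ∀ᶠ y in 𝓝 0, Xf y ∈ Ioo x1 x2 := hcont.eventually (by rw [h0]; exact Ioo_mem_nhds hz.1 hz.2)
  obtain ⟨d2, hd2, hb⟩ := Metric.eventually_nhds_iff.1 hev
  refine ⟨min d d2, by positivity, Xf, h0, fun y hy => ⟨?_, ?_⟩⟩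
  · refine hb ?_
    rw [Real.dist_eq, sub_zero, abs_lt]
    exact ⟨by linarith [hy.1, min_le_right d d2], by linarith [hy.2, min_le_right d d2]⟩
  · exact hX y ⟨by linarith [hy.1, min_le_left d d2], by linarith [hy.2, min_le_left d d2]⟩

/-- solution on a closed rectangle -/
structure RSol (u ux uxx ut a ax : ℝ → ℝ → ℝ) (x1 x2 t1 t2 M : ℝ) : Prop where
  cu : ContinuousOn (fun q : ℝ × ℝ => u q.1 q.2) (Icc x1 x2 ×ˢ Icc t1 t2)
  cux : ContinuousOn (fun q : ℝ × ℝ => ux q.1 q.2) (Icc x1 x2 ×ˢ Icc t1 t2)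
  cuxx : ContinuousOn (fun q : ℝ × ℝ => uxx q.1 q.2) (Icc x1 x2 ×ˢ Icc t1 t2)
  cut : ContinuousOn (fun q : ℝ × ℝ => ut q.1 q.2) (Icc x1 x2 ×ˢ Icc t1 t2)
  dx : ∀ x ∈ Icc x1 x2, ∀ t ∈ Icc t1 t2, HasDerivAt (fun y => u y t) (ux x t) x
  dxx : ∀ x ∈ Icc x1 x2, ∀ t ∈ Icc t1 t2, HasDerivAt (fun y => ux y t) (uxx x t) x
  dt : ∀ x ∈ Icc x1 x2, ∀ t ∈ Icc t1 t2, HasDerivAt (fun s => u x s) (ut x t) t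
  da : ∀ x ∈ Icc x1 x2, ∀ t ∈ Icc t1 t2, HasDerivAt (fun y => a y t) (ax x t) x
  cax : ∀ t ∈ Icc t1 t2, ContinuousOn (fun x => ax x t) (Icc x1 x2)
  lt : ∀ x ∈ Icc x1 x2, ∀ t ∈ Icc t1 t2, ∀ t' ∈ Icc t1 t2, |a x t - a x t'| ≤ M * |t - t'|
  M1 : 1 ≤ M
  ba : ∀ x ∈ Icc x1 x2, ∀ t ∈ Icc t1 t2, 1 / M ≤ a x t ∧ a x t ≤ M ∧ |ax x t| ≤ M
  e : ∀ x ∈ Icc x1 x2, ∀ t ∈ Icc t1 t2, |ut x t - a x t * uxx x t| ≤ M * (|ux x t| + |u x t|)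

noncomputable def cl (y : ℝ) : ℝ := max (-1) (min 1 y)
noncomputable def ct (t : ℝ) : ℝ := max (-1) (min 0 t)

lemma cl_mem (y : ℝ) : cl y ∈ Icc (-1 : ℝ) 1 :=
  ⟨le_max_left _ _, max_le (by norm_num) (min_le_left _ _)⟩
lemma ct_mem (y : ℝ) : ct y ∈ Icc (-1 : ℝ) 0 :=
  ⟨le_max_left _ _, max_le (by norm_num) (min_le_left _ _)⟩
lemma cl_eq {y : ℝ} (h : y ∈ Icc (-1 : ℝ) 1) : cl y = y := by
  unfold cl; rw [min_eq_right h.2, max_eq_right h.1]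
lemma ct_eq {y : ℝ} (h : y ∈ Icc (-1 : ℝ) 0) : ct y = y := by
  unfold ct; rw [min_eq_right h.2, max_eq_right h.1]
lemma cl_c : Continuous cl := by unfold cl; fun_prop
lemma ct_c : Continuous ct := by unfold ct; fun_prop
lemma cl_d {f : ℝ → ℝ} {f1 x : ℝ} (hx : x ∈ Ioo (-1 : ℝ) 1) (h : HasDerivAt f f1 x) :
    HasDerivAt (fun y => f (cl y)) f1 x := by
  refine h.congr_of_eventuallyEq ?_
  filter_upwards [Ioo_mem_nhds hx.1 hx.2] with y hy
  rw [cl_eq (Ioo_subset_Icc_self hy)]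
lemma ct_d {f : ℝ → ℝ} {f1 x : ℝ} (hx : x ∈ Ioo (-1 : ℝ) 0) (h : HasDerivAt f f1 x) :
    HasDerivAt (fun y => f (ct y)) f1 x := by
  refine h.congr_of_eventuallyEq ?_
  filter_upwards [Ioo_mem_nhds hx.1 hx.2] with y hy
  rw [ct_eq (Ioo_subset_Icc_self hy)]

lemma core_b {u ux uxx ut a ax k ρ M C0 : ℝ} (hM : 1 ≤ M) (hC : 1 ≤ C0) (hρ : 0 < ρ) (hρ1 : ρ ≤ 1)
    (h0 : |u| ≤ C0) (h1 : |ux| ≤ C0) (h2 : |uxx| ≤ C0) (h3 : |ut| ≤ C0) (hk : 0 < k) (hkM : k ≤ M)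
    (ha : 0 < a) (haM : a ≤ M) (hax : |ax| ≤ M) :
    |u / (2 * M * C0)| ≤ 1 ∧ |ρ * k * ux / (2 * M * C0)| ≤ 1 ∧
    |ρ ^ 2 * (a * uxx + ax / 2 * ux) / (2 * M * C0)| ≤ 1 ∧ |ρ ^ 2 * ut / (2 * M * C0)| ≤ 1 := by
  have hB : 0 < 2 * M * C0 := by positivity
  have hMC : C0 ≤ M * C0 := le_mul_of_one_le_left (by linarith) hM
  have hMC0 : 0 ≤ M * C0 := by positivity
  have hρ2 : ρ ^ 2 ≤ 1 := by nlinarith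
  have key : ∀ r w : ℝ, 0 ≤ r → r ≤ 1 → |w| ≤ 2 * M * C0 → |r * w / (2 * M * C0)| ≤ 1 := by
    intro r w hr hr1 hw
    rw [abs_div, abs_of_pos hB, div_le_one hB, abs_mul, abs_of_nonneg hr]
    exact (mul_le_of_le_one_left (abs_nonneg _) hr1).trans hw
  have m1 : |k * ux| ≤ M * C0 := by
    rw [abs_mul, abs_of_pos hk]; exact mul_le_mul hkM h1 (abs_nonneg _) (by linarith)
  have m2 : |a * uxx| ≤ M * C0 := by
    rw [abs_mul, abs_of_pos ha]; exact mul_le_mul haM h2 (abs_nonneg _) (by linarith)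
  have m3 : |ax / 2 * ux| ≤ M * C0 := by
    rw [abs_mul]; refine mul_le_mul ?_ h1 (abs_nonneg _) (by linarith)
    rw [abs_div, abs_of_pos (by norm_num : (0:ℝ) < 2)]
    linarith [abs_nonneg ax]
  refine ⟨?_, ?_, ?_, ?_⟩
  · have := key 1 u (by norm_num) le_rfl (by linarith)
    rwa [one_mul] at this
  · have := key ρ (k * ux) hρ.le hρ1 (by linarith)
    rwa [← mul_assoc] at this
  · exact key _ _ (by positivity) hρ2 ((abs_add_le _ _).trans (by linarith))
  · exact key _ _ (by positivity) hρ2 (by linarith)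

lemma core_e {u ux uxx ut a a0 ax k ρ M B : ℝ} (hM : 1 ≤ M) (hB : 0 < B) (hρ : 0 < ρ) (hρ1 : ρ ≤ 1)
    (hρM : 200 * M ^ 5 * ρ ≤ 1) (hk : 1 / M ≤ k)
    (ha0 : 1 / M ≤ a0) (ha : 0 < a) (haM : a ≤ M) (hax : |ax| ≤ M)
    (he : |ut - a * uxx| ≤ M * (|ux| + |u|)) :
    |ρ ^ 2 * ut / B - a / a0 * (ρ ^ 2 * (a0 * uxx + ax / 2 * ux) / B)| ≤
      (|ρ * k * ux / B| + |u / B|) / 100 := by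
  have hM0 : 0 < M := by linarith
  have hk0 : 0 < k := lt_of_lt_of_le (by positivity) hk
  have ha00 : 0 < a0 := lt_of_lt_of_le (by positivity) ha0
  have e1 : ρ ^ 2 * ut / B - a / a0 * (ρ ^ 2 * (a0 * uxx + ax / 2 * ux) / B) =
      ρ ^ 2 / B * ((ut - a * uxx) - a / a0 * (ax / 2) * ux) := by field_simp; ring
  have e2 : |a / a0 * (ax / 2) * ux| ≤ M ^ 3 * |ux| := by
    rw [abs_mul]
    refine mul_le_mul_of_nonneg_right ?_ (abs_nonneg _)
    rw [abs_mul, abs_of_pos (by positivity)]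
    have f1 : a / a0 ≤ M * M := by
      rw [div_le_iff₀ ha00]
      have : M * M * (1 / M) ≤ M * M * a0 := mul_le_mul_of_nonneg_left ha0 (by positivity)
      have e : M * M * (1 / M) = M := by field_simp
      linarith
    have f2 : |ax / 2| ≤ M := by
      rw [abs_div, abs_of_pos (by norm_num : (0:ℝ) < 2)]; linarith [abs_nonneg ax]
    calc a / a0 * |ax / 2| ≤ M * M * M := mul_le_mul f1 f2 (abs_nonneg _) (by positivity)
      _ = M ^ 3 := by ring
  have e3 : |(ut - a * uxx) - a / a0 * (ax / 2) * ux| ≤ 2 * M ^ 3 * |ux| + M * |u| := by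
    have f1 := abs_sub (ut - a * uxx) (a / a0 * (ax / 2) * ux)
    have f2 : M ≤ M ^ 3 := le_self_pow₀ hM (by norm_num)
    have f3 := mul_le_mul_of_nonneg_right f2 (abs_nonneg ux)
    linarith
  have e4 : |ux| ≤ M * (k * |ux|) := by
    have : 1 / M * |ux| ≤ k * |ux| := mul_le_mul_of_nonneg_right hk (abs_nonneg _)
    have := mul_le_mul_of_nonneg_left this hM0.le
    have e : M * (1 / M * |ux|) = |ux| := by field_simp
    linarith
  rw [e1, abs_mul, abs_of_pos (by positivity), abs_div, abs_div, abs_of_pos hB, abs_mul,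
    abs_of_pos (mul_pos hρ hk0)]
  have p5 : M ^ 4 ≤ M ^ 5 := pow_le_pow_right₀ hM (by norm_num)
  have p6 : M ^ 1 ≤ M ^ 5 := pow_le_pow_right₀ hM (by norm_num)
  rw [pow_one] at p6
  have q5 := mul_le_mul_of_nonneg_right p5 hρ.le
  have q6 := mul_le_mul_of_nonneg_right p6 hρ.le
  have hρ2 : ρ * ρ ≤ ρ * 1 := mul_le_mul_of_nonneg_left hρ1 hρ.le
  have e5 : ρ * (2 * M ^ 3 * |ux| + M * |u|) ≤ (k * |ux|) / 100 + |u| / 100 := by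
    have g1 : 2 * M ^ 3 * |ux| ≤ 2 * M ^ 3 * (M * (k * |ux|)) := mul_le_mul_of_nonneg_left e4 (by positivity)
    have g2 := mul_le_mul_of_nonneg_left g1 hρ.le
    have g3 : (M ^ 4 * ρ) * (k * |ux|) ≤ 1 / 200 * (k * |ux|) :=
      mul_le_mul_of_nonneg_right (by linarith) (by positivity)
    have g4 : (M * ρ) * |u| ≤ 1 / 200 * |u| := mul_le_mul_of_nonneg_right (by linarith) (abs_nonneg _)
    have := abs_nonneg u
    have : ρ * (2 * M ^ 3 * (M * (k * |ux|))) = 2 * ((M ^ 4 * ρ) * (k * |ux|)) := by ring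
    linarith
  have e6 : ρ ^ 2 / B * (2 * M ^ 3 * |ux| + M * |u|) ≤ ρ / B * ((k * |ux|) / 100 + |u| / 100) := by
    have := mul_le_mul_of_nonneg_left e5 (show 0 ≤ ρ / B by positivity)
    calc _ = ρ / B * (ρ * (2 * M ^ 3 * |ux| + M * |u|)) := by ring
      _ ≤ _ := this
  have e7 := mul_le_mul_of_nonneg_left e3 (show 0 ≤ ρ ^ 2 / B by positivity)
  have e8 : ρ / B * (|u| / 100) ≤ 1 / B * (|u| / 100) := by gcongr
  have e9 : (ρ * k * |ux| / B + |u| / B) / 100 = ρ / B * (k * |ux| / 100) + 1 / B * (|u| / 100) := by ring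
  rw [e9]
  linarith

open Set Filter Topology

lemma sqrt_bd {a M : ℝ} (hM : 1 ≤ M) (h1 : 1 / M ≤ a) (h2 : a ≤ M) :
    1 / M ≤ Real.sqrt a ∧ Real.sqrt a ≤ M := by
  have hM0 : 0 < M := by linarith
  constructor
  · refine Real.le_sqrt_of_sq_le (le_trans ?_ h1)
    have : 1 / M ≤ 1 := by rw [div_le_one hM0]; exact hM
    have p : 0 < 1 / M := by positivity
    nlinarith
  · rw [Real.sqrt_le_left hM0.le]; nlinarith

lemma core_bA {a a0 M ρ t : ℝ} (hM : 1 ≤ M) (hρ : 0 < ρ) (hρ1 : ρ ≤ 1) (hρM : 200 * M ^ 5 * ρ ≤ 1)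
    (h0 : 1 / M ≤ a0) (hl : |a - a0| ≤ M * |ρ ^ 2 * t|) : |a / a0 - 1| ≤ |t| / 100 := by
  have hM0 : 0 < M := by linarith
  have ha0 : 0 < a0 := lt_of_lt_of_le (by positivity) h0
  have e : a / a0 - 1 = (a - a0) / a0 := by field_simp
  rw [e, abs_div, abs_of_pos ha0, div_le_iff₀ ha0]
  rw [abs_mul, abs_of_pos (by positivity : 0 < ρ ^ 2)] at hl
  have h1 : |t| / 100 * (1 / M) ≤ |t| / 100 * a0 := mul_le_mul_of_nonneg_left h0 (by positivity)
  have p : M ^ 2 ≤ M ^ 5 := pow_le_pow_right₀ hM (by norm_num)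
  have h2 : M ^ 2 * ρ ^ 2 ≤ 1 / 100 := by
    have : ρ ^ 2 ≤ ρ := by nlinarith
    calc M ^ 2 * ρ ^ 2 ≤ M ^ 5 * ρ := by gcongr
      _ ≤ 1 / 100 := by linarith
  have h3 : M * (ρ ^ 2 * |t|) ≤ |t| / 100 * (1 / M) := by
    rw [mul_one_div, le_div_iff₀ hM0]
    have := mul_le_mul_of_nonneg_right h2 (abs_nonneg t)
    linarith
  linarith

lemma core_bAx {a a0 ax ax0 k M ρ : ℝ} (hM : 1 ≤ M) (hρ : 0 < ρ) (hρM : 200 * M ^ 5 * ρ ≤ 1)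
    (h0 : 1 / M ≤ a0) (h1 : a0 ≤ M) (ha : 0 < a) (haM : a ≤ M) (hx : |ax| ≤ M) (hx0 : |ax0| ≤ M)
    (hk : 0 < k) (hkM : k ≤ M) : |(ax * (ρ * k) * a0 - a * (ax0 * (ρ * k))) / a0 ^ 2| ≤ 1 / 100 := by
  have hM0 : 0 < M := by linarith
  have ha0 : 0 < a0 := lt_of_lt_of_le (by positivity) h0
  rw [abs_div, abs_of_pos (by positivity : 0 < a0 ^ 2), div_le_iff₀ (by positivity)]
  have e : ax * (ρ * k) * a0 - a * (ax0 * (ρ * k)) = ρ * k * (ax * a0 - a * ax0) := by ring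
  rw [e, abs_mul, abs_of_pos (by positivity)]
  have q1 : |ax * a0| ≤ M * M := by
    rw [abs_mul, abs_of_pos ha0]; exact mul_le_mul hx h1 ha0.le hM0.le
  have q2 : |a * ax0| ≤ M * M := by
    rw [abs_mul, abs_of_pos ha]; exact mul_le_mul haM hx0 (abs_nonneg _) hM0.le
  have q3 := abs_sub (ax * a0) (a * ax0)
  have q4 : ρ * k * |ax * a0 - a * ax0| ≤ ρ * M * (2 * M ^ 2) := by
    gcongr
    linarith
  have q5 : 1 / M ^ 2 ≤ a0 ^ 2 := by
    have : (1 / M) ^ 2 ≤ a0 ^ 2 := by gcongr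
    rwa [div_pow, one_pow] at this
  have q6 : ρ * M * (2 * M ^ 2) ≤ 1 / 100 * (1 / M ^ 2) := by
    rw [mul_one_div, le_div_iff₀ (by positivity)]
    calc _ = 2 * (M ^ 5 * ρ) := by ring
      _ ≤ _ := by linarith
  linarith

lemma RSol.core {u ux uxx ut a ax : ℝ → ℝ → ℝ} {x1 x2 t1 t2 M τ d C0 ρ : ℝ} {Xf : ℝ → ℝ}
    (h : RSol u ux uxx ut a ax x1 x2 t1 t2 M) (hτ : τ ∈ Icc t1 t2)
    (hX : ∀ y ∈ Ioo (-d) d, Xf y ∈ Ioo x1 x2 ∧ HasDerivAt Xf (Real.sqrt (a (Xf y) τ)) y)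
    (hC1 : 1 ≤ C0) (hC : ∀ x ∈ Icc x1 x2, ∀ t ∈ Icc t1 t2,
      |u x t| ≤ C0 ∧ |ux x t| ≤ C0 ∧ |uxx x t| ≤ C0 ∧ |ut x t| ≤ C0)
    (hρ : 0 < ρ) (hρ1 : ρ ≤ 1) (hρM : 200 * M ^ 5 * ρ ≤ 1) (hρd : ρ < d) (hρt : t1 ≤ τ - ρ ^ 2) :
    ∃ Ux Uxx Ut A Ax, CoreS (fun y t => u (Xf (ρ * cl y)) (τ + ρ ^ 2 * ct t) / (2 * M * C0))
      Ux Uxx Ut A Ax ∧ Ux 0 0 = ρ * Real.sqrt (a (Xf 0) τ) * ux (Xf 0) τ / (2 * M * C0) := by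
  have hM := h.M1
  have hM0 : 0 < M := by linarith
  have hB : 0 < 2 * M * C0 := by positivity
  obtain ⟨P, hP⟩ : ∃ P : ℝ → ℝ, P = fun y => Xf (ρ * cl y) := ⟨_, rfl⟩
  obtain ⟨S, hS⟩ : ∃ S : ℝ → ℝ, S = fun t => τ + ρ ^ 2 * ct t := ⟨_, rfl⟩
  have hρm : ∀ y ∈ Icc (-1 : ℝ) 1, ρ * y ∈ Ioo (-d) d := by
    intro y hy
    have e1 : ρ * y ≤ ρ * 1 := mul_le_mul_of_nonneg_left hy.2 hρ.le
    have e2 : ρ * (-1) ≤ ρ * y := mul_le_mul_of_nonneg_left hy.1 hρ.le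
    exact ⟨by linarith, by linarith⟩
  have mP : ∀ y, P y ∈ Icc x1 x2 := fun y => by
    rw [hP]; exact Ioo_subset_Icc_self (hX _ (hρm _ (cl_mem y))).1
  have mS : ∀ t, S t ∈ Icc t1 t2 := fun t => by
    rw [hS]
    have m := ct_mem t
    have r2 : 0 < ρ ^ 2 := by positivity
    have e1 : ρ ^ 2 * ct t ≤ ρ ^ 2 * 0 := mul_le_mul_of_nonneg_left m.2 r2.le
    have e2 : ρ ^ 2 * (-1) ≤ ρ ^ 2 * ct t := mul_le_mul_of_nonneg_left m.1 r2.le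
    exact ⟨by simp only; linarith, by simp only; linarith [hτ.2]⟩
  have cP : Continuous P := by
    rw [hP]
    have c1 : ContinuousOn Xf (Ioo (-d) d) := fun y hy => (hX y hy).2.continuousAt.continuousWithinAt
    exact c1.comp_continuous (by have := cl_c; fun_prop) (fun y => hρm _ (cl_mem y))
  have cS : Continuous S := by rw [hS]; have := ct_c; fun_prop
  have cc : ∀ f : ℝ → ℝ → ℝ, ContinuousOn (fun q : ℝ × ℝ => f q.1 q.2) (Icc x1 x2 ×ˢ Icc t1 t2) →
      Continuous (fun q : ℝ × ℝ => f (P q.1) (S q.2)) := fun f hf =>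
    hf.comp_continuous (f := fun q : ℝ × ℝ => (P q.1, S q.2)) (by fun_prop) (fun q => ⟨mP _, mS _⟩)
  have c1 : ∀ f : ℝ → ℝ, ContinuousOn f (Icc x1 x2) → Continuous (fun y => f (P y)) := fun f hf =>
    hf.comp_continuous cP mP
  have ca : ∀ t ∈ Icc t1 t2, ContinuousOn (fun x => a x t) (Icc x1 x2) := fun t ht x hx =>
    (h.da x hx t ht).continuousAt.continuousWithinAt
  have apos : ∀ x ∈ Icc x1 x2, ∀ t ∈ Icc t1 t2, 0 < a x t := fun x hx t ht =>
    lt_of_lt_of_le (by positivity) (h.ba x hx t ht).1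
  obtain ⟨k, hk⟩ : ∃ k : ℝ → ℝ, k = fun y => Real.sqrt (a (P y) τ) := ⟨_, rfl⟩
  have kb : ∀ y, 1 / M ≤ k y ∧ k y ≤ M := fun y => by
    rw [hk]; exact sqrt_bd hM (h.ba _ (mP y) _ hτ).1 (h.ba _ (mP y) _ hτ).2.1
  have kpos : ∀ y, 0 < k y := fun y => lt_of_lt_of_le (by positivity) (kb y).1
  have kk : ∀ y, k y * k y = a (P y) τ := fun y => by
    rw [hk]; exact Real.mul_self_sqrt (apos _ (mP y) _ hτ).le
  have ck : Continuous k := by rw [hk]; exact (c1 _ (ca τ hτ)).sqrt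
  have dP : ∀ y ∈ Ioo (-1 : ℝ) 1, HasDerivAt P (ρ * k y) y := by
    intro y hy
    rw [hP]
    refine cl_d (f := fun y => Xf (ρ * y)) hy ?_
    have d1 : HasDerivAt (fun y : ℝ => ρ * y) (ρ * 1) y := (hasDerivAt_id y).const_mul ρ
    have d2 := HasDerivAt.comp y (hX _ (hρm _ (Ioo_subset_Icc_self hy))).2 d1
    refine d2.congr_deriv ?_
    rw [hk, hP]
    simp only
    rw [cl_eq (Ioo_subset_Icc_self hy)]
    ring
  have dS : ∀ t ∈ Ioo (-1 : ℝ) 0, HasDerivAt S (ρ ^ 2) t := by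
    intro t ht
    rw [hS]
    refine ct_d (f := fun t => τ + ρ ^ 2 * t) ht ?_
    simpa using ((hasDerivAt_id t).const_mul (ρ ^ 2)).const_add τ
  have dk : ∀ y ∈ Ioo (-1 : ℝ) 1, HasDerivAt k (ρ * ax (P y) τ / 2) y := by
    intro y hy
    have d1 : HasDerivAt (fun y => a (P y) τ) (ax (P y) τ * (ρ * k y)) y :=
      HasDerivAt.comp y (h.da (P y) (mP y) τ hτ) (dP y hy)
    have d2 := d1.sqrt (apos _ (mP y) _ hτ).ne'
    have e : Real.sqrt (a (P y) τ) = k y := by rw [hk]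
    rw [e] at d2
    have e2 : k = fun y => Real.sqrt (a (P y) τ) := hk
    have kp := kpos y
    rw [← e2] at d2
    refine d2.congr_deriv ?_
    field_simp
  have e00 : S 0 = τ ∧ P 0 = Xf 0 := by
    rw [hS, hP]
    simp only
    rw [ct_eq (by norm_num), cl_eq (by norm_num)]
    simp
  refine ⟨fun y t => ρ * k y * ux (P y) (S t) / (2 * M * C0),
    fun y t => ρ ^ 2 * (a (P y) τ * uxx (P y) (S t) + ax (P y) τ / 2 * ux (P y) (S t)) / (2 * M * C0),
    fun y t => ρ ^ 2 * ut (P y) (S t) / (2 * M * C0),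
    fun y t => a (P y) (S t) / a (P y) τ,
    fun y t => (ax (P y) (S t) * (ρ * k y) * a (P y) τ - a (P y) (S t) * (ax (P y) τ * (ρ * k y)))
      / (a (P y) τ) ^ 2, ?_, ?_⟩
  swap
  · simp only
    rw [e00.1, hk]
    simp only
    rw [e00.2]
  have eU : (fun y t => u (Xf (ρ * cl y)) (τ + ρ ^ 2 * ct t) / (2 * M * C0)) =
      fun y t => u (P y) (S t) / (2 * M * C0) := by rw [hP, hS]
  rw [eU]
  have ckt : Continuous (fun q : ℝ × ℝ => k q.1) := ck.comp continuous_fst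
  have caP := c1 _ (ca τ hτ)
  have caxP := c1 _ (h.cax τ hτ)
  constructor
  · exact (cc u h.cu).div_const _
  · exact ((continuous_const.mul ckt).mul (cc ux h.cux)).div_const _
  · have q1 : Continuous (fun q : ℝ × ℝ => a (P q.1) τ) := caP.comp continuous_fst
    have q2 : Continuous (fun q : ℝ × ℝ => ax (P q.1) τ) := caxP.comp continuous_fst
    exact (continuous_const.mul ((q1.mul (cc uxx h.cuxx)).add ((q2.div_const 2).mul (cc ux h.cux)))).div_const _
  · exact (continuous_const.mul (cc ut h.cut)).div_const _
  · intro t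
    exact (c1 _ (ca _ (mS t))).div caP (fun y => (apos _ (mP y) _ hτ).ne')
  · intro t
    refine Continuous.div ?_ (caP.pow 2) (fun y => pow_ne_zero 2 (apos _ (mP y) _ hτ).ne')
    exact (((c1 _ (h.cax _ (mS t))).mul (continuous_const.mul ck)).mul caP).sub
      ((c1 _ (ca _ (mS t))).mul (caxP.mul (continuous_const.mul ck)))
  · intro y hy t _
    have d1 : HasDerivAt (fun y => u (P y) (S t)) (ux (P y) (S t) * (ρ * k y)) y :=
      HasDerivAt.comp y (h.dx (P y) (mP y) (S t) (mS t)) (dP y hy)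
    exact (d1.div_const _).congr_deriv (by ring)
  · intro y hy t _
    have d1 : HasDerivAt (fun y => ux (P y) (S t)) (uxx (P y) (S t) * (ρ * k y)) y :=
      HasDerivAt.comp y (h.dxx (P y) (mP y) (S t) (mS t)) (dP y hy)
    refine ((((dk y hy).const_mul ρ).mul d1).div_const _).congr_deriv ?_
    rw [← kk y]
    ring
  · intro y _ t ht
    have d1 : HasDerivAt (fun t => u (P y) (S t)) (ut (P y) (S t) * ρ ^ 2) t :=
      HasDerivAt.comp t (h.dt (P y) (mP y) (S t) (mS t)) (dS t ht)
    exact (d1.div_const _).congr_deriv (by ring)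
  · intro y hy t _
    have d1 : HasDerivAt (fun y => a (P y) (S t)) (ax (P y) (S t) * (ρ * k y)) y :=
      HasDerivAt.comp y (h.da (P y) (mP y) (S t) (mS t)) (dP y hy)
    have d2 : HasDerivAt (fun y => a (P y) τ) (ax (P y) τ * (ρ * k y)) y :=
      HasDerivAt.comp y (h.da (P y) (mP y) τ hτ) (dP y hy)
    exact d1.div d2 (apos _ (mP y) _ hτ).ne'
  · intro y _ t ht
    refine core_bA hM hρ hρ1 hρM (h.ba _ (mP y) _ hτ).1 ?_
    have := h.lt (P y) (mP y) (S t) (mS t) τ hτ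
    have e : S t - τ = ρ ^ 2 * t := by rw [hS]; simp only; rw [ct_eq (Ioo_subset_Icc_self ht)]; ring
    rwa [e] at this
  · intro y _ t _
    have b0 := h.ba _ (mP y) _ hτ
    have b1 := h.ba _ (mP y) _ (mS t)
    exact core_bAx hM hρ hρM b0.1 b0.2.1 (apos _ (mP y) _ (mS t)) b1.2.1 b1.2.2 b0.2.2 (kpos y) (kb y).2
  · intro y t
    have b0 := h.ba _ (mP y) _ hτ
    obtain ⟨g0, g1, g2, g3⟩ := hC _ (mP y) _ (mS t)
    exact core_b hM hC1 hρ hρ1 g0 g1 g2 g3 (kpos y) (kb y).2 (apos _ (mP y) _ hτ) b0.2.1 b0.2.2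
  · intro y _ t _
    have b0 := h.ba _ (mP y) _ hτ
    have b1 := h.ba _ (mP y) _ (mS t)
    exact core_e hM hB hρ hρ1 hρM (kb y).1 b0.1 (apos _ (mP y) _ (mS t)) b1.2.1 b0.2.2 (h.e _ (mP y) _ (mS t))

open Set Filter Topology

lemma CoreS.up {U Ux Uxx Ut A Ax : ℝ → ℝ → ℝ} (h : CoreS U Ux Uxx Ut A Ax) (h0 : U 0 0 = 0)
    (h1 : Ux 0 0 = 0) : ∀ x ∈ Icc (-1 : ℝ) 1, ∀ t ∈ Ioo (-1 : ℝ) 0, |U x t| ≤ 1 * (x ^ 2 + -t) := by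
  have hcx : ∀ x, Continuous (fun t => U x t) := fun x => h.cU.comp (by fun_prop : Continuous fun t : ℝ => (x, t))
  have hcx1 : ∀ x, Continuous (fun t => Ux x t) := fun x => h.cUx.comp (by fun_prop : Continuous fun t : ℝ => (x, t))
  have hct : ∀ t, Continuous (fun x => U x t) := fun t => h.cU.comp (by fun_prop : Continuous fun x : ℝ => (x, t))
  have s1 : ∀ x ∈ Ioo (-1 : ℝ) 1, ∀ t ∈ Ioo (-1 : ℝ) 0, |U x t - U 0 t - x * Ux 0 t| ≤ x ^ 2 := by
    intro x hx t ht
    have ax1 : |x| < 1 := abs_lt.2 hx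
    have hsub : ∀ y ∈ Icc (-|x|) |x|, y ∈ Ioo (-1 : ℝ) 1 := fun y hy => ⟨by linarith [hy.1], by linarith [hy.2]⟩
    have m0 : (0 : ℝ) ∈ Icc (-|x|) |x| := ⟨by linarith [abs_nonneg x], abs_nonneg x⟩
    have mx : x ∈ Icc (-|x|) |x| := ⟨neg_abs_le x, le_abs_self x⟩
    have b1 : ∀ y ∈ Icc (-|x|) |x|, ‖Ux y t - Ux 0 t‖ ≤ |x| := by
      intro y hy
      have := (convex_Icc (-|x|) |x|).norm_image_sub_le_of_norm_hasDerivWithin_le (f := fun y => Ux y t)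
        (f' := fun y => Uxx y t) (C := 1) (fun y hy => (h.dxx y (hsub y hy) t ht).hasDerivWithinAt)
        (fun y hy => (h.b y t).2.2.1) m0 hy
      simp only [sub_zero, one_mul, Real.norm_eq_abs] at this
      rw [Real.norm_eq_abs]
      exact this.trans (abs_le.2 hy)
    have := (convex_Icc (-|x|) |x|).norm_image_sub_le_of_norm_hasDerivWithin_le
      (f := fun y => U y t - y * Ux 0 t)
      (f' := fun y => Ux y t - Ux 0 t) (C := |x|) (fun y hy => (((h.dx y (hsub y hy) t ht).sub
        ((hasDerivAt_id y).mul_const (Ux 0 t))).congr_deriv (by simp)).hasDerivWithinAt) b1 m0 mx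
    simp only [sub_zero, zero_mul, Real.norm_eq_abs] at this
    rw [← sq_abs x, sq]
    have e : U x t - U 0 t - x * Ux 0 t = U x t - x * Ux 0 t - U 0 t := by ring
    rwa [e]
  have s2 : ∀ x ∈ Ioo (-1 : ℝ) 1, |U x 0| ≤ x ^ 2 := by
    intro x hx
    have hc : IsClosed {t : ℝ | |U x t - U 0 t - x * Ux 0 t| ≤ x ^ 2} :=
      isClosed_le (by have := hcx x; have := hcx 0; have := hcx1 0; fun_prop) continuous_const
    have := closure_minimal (s := Ioo (-1 : ℝ) 0) (fun t ht => s1 x hx t ht) hc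
    rw [closure_Ioo (by norm_num)] at this
    have h9 : |U x 0 - U 0 0 - x * Ux 0 0| ≤ x ^ 2 := this (show (0 : ℝ) ∈ Icc (-1 : ℝ) 0 by norm_num)
    rwa [h0, h1, mul_zero, sub_zero, sub_zero] at h9
  have s3 : ∀ x ∈ Icc (-1 : ℝ) 1, |U x 0| ≤ x ^ 2 := by
    have hc : IsClosed {x : ℝ | |U x 0| ≤ x ^ 2} :=
      isClosed_le (by have := hct 0; fun_prop) (by fun_prop)
    have := closure_minimal (s := Ioo (-1 : ℝ) 1) (fun t ht => s2 t ht) hc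
    rw [closure_Ioo (by norm_num)] at this
    exact this
  intro x hx t ht
  have := norm_image_sub_le_of_norm_deriv_right_le_segment (f := fun s => U x s) (f' := fun s => Ut x s)
    (C := 1) (a := t) (b := 0) (hcx x).continuousOn
    (fun s hs => (h.dt x hx s ⟨by linarith [hs.1, ht.1], hs.2⟩).hasDerivWithinAt)
    (fun s _ => (h.b x s).2.2.2) 0 ⟨ht.2.le, le_refl _⟩
  simp only [Real.norm_eq_abs] at this
  have h3 := s3 x hx
  have h4 := abs_sub_abs_le_abs_sub (U x t) (U x 0)
  rw [abs_sub_comm] at h4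
  linarith

lemma CoreS.pt {U Ux Uxx Ut A Ax : ℝ → ℝ → ℝ} (h : CoreS U Ux Uxx Ut A Ax) {x0 : ℝ}
    (hx0 : |x0| < 1 / 8) (h0 : U x0 0 ≠ 0) : ∃ xa xb κ δ : ℝ, xa < xb ∧ -(1 / 8) ≤ xa ∧ xb ≤ 1 / 8 ∧
      0 < κ ∧ 0 < δ ∧ ∀ x ∈ Icc xa xb, ∀ t ∈ Ioo (-δ) 0, κ ≤ |U x t| := by
  have p : 0 < |U x0 0| := abs_pos.2 h0
  have hev : ∀ᶠ q : ℝ × ℝ in 𝓝 (x0, (0 : ℝ)), |U x0 0| / 2 < |U q.1 q.2| :=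
    h.cU.abs.continuousAt.eventually (lt_mem_nhds (by simp only; linarith))
  obtain ⟨r, hr, hb⟩ := Metric.eventually_nhds_iff.1 hev
  obtain ⟨r', hr', h1, h2⟩ : ∃ r' > 0, r' < r ∧ r' < 1 / 8 - |x0| := by
    obtain ⟨r', h1, h2⟩ := exists_between (show 0 < min r (1 / 8 - |x0|) from lt_min hr (by linarith))
    exact ⟨r', h1, lt_of_lt_of_le h2 (min_le_left _ _), lt_of_lt_of_le h2 (min_le_right _ _)⟩
  have n1 := neg_abs_le x0
  have n2 := le_abs_self x0
  refine ⟨x0 - r', x0 + r', |U x0 0| / 2, r, by linarith, by linarith, by linarith, by linarith, hr, ?_⟩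
  intro x hx t ht
  refine (hb (y := (x, t)) ?_).le
  rw [Prod.dist_eq]
  refine max_lt ?_ ?_
  · rw [Real.dist_eq, abs_lt]; constructor <;> simp only <;> linarith [hx.1, hx.2]
  · rw [Real.dist_eq, abs_lt]; constructor <;> simp only <;> linarith [ht.1, ht.2]

lemma bdd_C {f : ℝ → ℝ → ℝ} {K : Set (ℝ × ℝ)} (hK : IsCompact K)
    (hf : ContinuousOn (fun q : ℝ × ℝ => f q.1 q.2) K) : ∃ C, ∀ x t, (x, t) ∈ K → |f x t| ≤ C := by
  obtain ⟨C, hC⟩ := hK.exists_bound_of_continuousOn hf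
  exact ⟨C, fun x t hx => hC (x, t) hx⟩

lemma RSol.setup {u ux uxx ut a ax : ℝ → ℝ → ℝ} {x1 x2 t1 t2 M τ z : ℝ}
    (h : RSol u ux uxx ut a ax x1 x2 t1 t2 M) (hτ : τ ∈ Ioc t1 t2) (hz : z ∈ Ioo x1 x2) :
    ∃ (Xf : ℝ → ℝ) (ρ0 B : ℝ), 0 < ρ0 ∧ 0 < B ∧ Xf 0 = z ∧ StrictMonoOn Xf (Icc (-ρ0) ρ0) ∧
      ContinuousOn Xf (Icc (-ρ0) ρ0) ∧ ∀ ρ, 0 < ρ → ρ ≤ ρ0 → ∃ Ux Uxx Ut A Ax,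
        CoreS (fun y t => u (Xf (ρ * cl y)) (τ + ρ ^ 2 * ct t) / B) Ux Uxx Ut A Ax ∧
        (ux z τ = 0 → Ux 0 0 = 0) := by
  have hM := h.M1
  have hM0 : 0 < M := by linarith
  have hτ' := Ioc_subset_Icc_self hτ
  have apos : ∀ x ∈ Icc x1 x2, 0 < a x τ := fun x hx =>
    lt_of_lt_of_le (by positivity) (h.ba x hx τ hτ').1
  obtain ⟨d, hd, Xf, hX0, hX⟩ := ode_chg (al := fun x => a x τ) (al1 := fun x => ax x τ) hz
    (fun x hx => h.da x hx τ hτ') (h.cax τ hτ') apos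
  have hK : IsCompact (Icc x1 x2 ×ˢ Icc t1 t2) := isCompact_Icc.prod isCompact_Icc
  obtain ⟨C1, hC1⟩ := bdd_C hK h.cu
  obtain ⟨C2, hC2⟩ := bdd_C hK h.cux
  obtain ⟨C3, hC3⟩ := bdd_C hK h.cuxx
  obtain ⟨C4, hC4⟩ := bdd_C hK h.cut
  have hm : ∀ w ∈ [1, C1, C2, C3, C4], w ≤ 1 + |C1| + |C2| + |C3| + |C4| := by
    have := le_abs_self C1
    have := le_abs_self C2
    have := le_abs_self C3
    have := le_abs_self C4
    have := abs_nonneg C1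
    have := abs_nonneg C2
    have := abs_nonneg C3
    have := abs_nonneg C4
    intro w hw
    simp only [List.mem_cons, List.not_mem_nil, or_false] at hw
    rcases hw with rfl | rfl | rfl | rfl | rfl <;> linarith
  obtain ⟨C0, hC0⟩ : ∃ C0, C0 = 1 + |C1| + |C2| + |C3| + |C4| := ⟨_, rfl⟩
  rw [← hC0] at hm
  have hC01 : 1 ≤ C0 := hm 1 (by simp)
  obtain ⟨ρ0, hρ0, hρlt⟩ := exists_between
    (show 0 < min (min 1 (1 / (200 * M ^ 5))) (min d (τ - t1)) from
      lt_min (lt_min one_pos (by positivity)) (lt_min hd (by linarith [hτ.1])))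
  have q1 : ρ0 ≤ 1 := (hρlt.trans_le ((min_le_left _ _).trans (min_le_left _ _))).le
  have q2 : ρ0 ≤ 1 / (200 * M ^ 5) := (hρlt.trans_le ((min_le_left _ _).trans (min_le_right _ _))).le
  have q3 : ρ0 < d := hρlt.trans_le ((min_le_right _ _).trans (min_le_left _ _))
  have q4 : ρ0 ≤ τ - t1 := (hρlt.trans_le ((min_le_right _ _).trans (min_le_right _ _))).le
  rw [le_div_iff₀ (by positivity)] at q2
  have hs : ∀ y ∈ Icc (-ρ0) ρ0, y ∈ Ioo (-d) d := fun y hy => ⟨by linarith [hy.1], by linarith [hy.2]⟩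
  have hc : ContinuousOn Xf (Icc (-ρ0) ρ0) := fun y hy => (hX y (hs y hy)).2.continuousAt.continuousWithinAt
  refine ⟨Xf, ρ0, 2 * M * C0, hρ0, by positivity, hX0, ?_, hc, ?_⟩
  · refine strictMonoOn_of_deriv_pos (convex_Icc _ _) hc fun y hy => ?_
    rw [interior_Icc] at hy
    have := hX y (hs y (Ioo_subset_Icc_self hy))
    rw [this.2.deriv]
    exact Real.sqrt_pos.2 (apos _ (Ioo_subset_Icc_self this.1))
  · intro ρ hρ hρ2
    have e1 : 200 * M ^ 5 * ρ ≤ 1 := by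
      have : 200 * M ^ 5 * ρ ≤ 200 * M ^ 5 * ρ0 := mul_le_mul_of_nonneg_left hρ2 (by positivity)
      linarith
    have e2 : ρ ^ 2 ≤ ρ := by nlinarith
    obtain ⟨Ux, Uxx, Ut, A, Ax, hc, h0⟩ := h.core hτ' hX hC01 (fun x hx t ht =>
      ⟨(hC1 x t ⟨hx, ht⟩).trans (hm _ (by simp)), (hC2 x t ⟨hx, ht⟩).trans (hm _ (by simp)),
       (hC3 x t ⟨hx, ht⟩).trans (hm _ (by simp)), (hC4 x t ⟨hx, ht⟩).trans (hm _ (by simp))⟩)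
      hρ (hρ2.trans q1) e1 (by linarith) (by linarith)
    refine ⟨Ux, Uxx, Ut, A, Ax, hc, fun hu => ?_⟩
    rw [h0, hX0, hu]
    simp

lemma surj_near {Xf : ℝ → ℝ} {ρ0 e : ℝ} (hm : StrictMonoOn Xf (Icc (-ρ0) ρ0))
    (hc : ContinuousOn Xf (Icc (-ρ0) ρ0)) (he : 0 < e) (heρ : e ≤ ρ0) :
    ∃ r > 0, ∀ x, |x - Xf 0| < r → ∃ y ∈ Icc (-e) e, Xf y = x := by
  have m0 : (0 : ℝ) ∈ Icc (-ρ0) ρ0 := ⟨by linarith, by linarith⟩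
  have m1 : e ∈ Icc (-ρ0) ρ0 := ⟨by linarith, by linarith⟩
  have m2 : -e ∈ Icc (-ρ0) ρ0 := ⟨by linarith, by linarith⟩
  have h1 := hm m0 m1 he
  have h2 := hm m2 m0 (by linarith)
  have := intermediate_value_Icc (show -e ≤ e by linarith) (hc.mono (Icc_subset_Icc m2.1 m1.2))
  refine ⟨min (Xf e - Xf 0) (Xf 0 - Xf (-e)), lt_min (by linarith) (by linarith), fun x hx => ?_⟩
  have h3 := abs_lt.1 (hx.trans_le (min_le_left _ _))
  have h4 := abs_lt.1 (hx.trans_le (min_le_right _ _))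
  exact this ⟨by linarith [h4.1], by linarith [h3.2]⟩

lemma RSol.near {u ux uxx ut a ax : ℝ → ℝ → ℝ} {x1 x2 t1 t2 M τ z : ℝ}
    (h : RSol u ux uxx ut a ax x1 x2 t1 t2 M) (hτ : τ ∈ Ioc t1 t2) (hz : z ∈ Ioo x1 x2)
    (hcl : z ∈ closure {x | u x τ ≠ 0}) :
    ∃ (Xf : ℝ → ℝ) (ρ0 B : ℝ), 0 < ρ0 ∧ 0 < B ∧ Xf 0 = z ∧ StrictMonoOn Xf (Icc (-ρ0) ρ0) ∧
      ContinuousOn Xf (Icc (-ρ0) ρ0) ∧ ∀ ρ, 0 < ρ → ρ ≤ ρ0 → ∃ Ux Uxx Ut A Ax,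
        CoreS (fun y t => u (Xf (ρ * cl y)) (τ + ρ ^ 2 * ct t) / B) Ux Uxx Ut A Ax ∧
        (ux z τ = 0 → Ux 0 0 = 0) ∧ ∃ xa xb κ δ : ℝ, xa < xb ∧ -(1 / 8) ≤ xa ∧ xb ≤ 1 / 8 ∧
      0 < κ ∧ 0 < δ ∧ ∀ x ∈ Icc xa xb, ∀ t ∈ Ioo (-δ) 0,
        κ ≤ |u (Xf (ρ * cl x)) (τ + ρ ^ 2 * ct t) / B| := by
  obtain ⟨Xf, ρ0, B, hρ0, hB, hX0, hm, hc, H⟩ := h.setup hτ hz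
  refine ⟨Xf, ρ0, B, hρ0, hB, hX0, hm, hc, fun ρ hρ hρ2 => ?_⟩
  obtain ⟨Ux, Uxx, Ut, A, Ax, hC, h0⟩ := H ρ hρ hρ2
  refine ⟨Ux, Uxx, Ut, A, Ax, hC, h0, ?_⟩
  obtain ⟨r, hr, hs⟩ := surj_near hm hc (show 0 < ρ / 9 by positivity) (by linarith)
  obtain ⟨x, hx, hxr⟩ := Metric.mem_closure_iff.1 hcl r hr
  rw [Real.dist_eq, abs_sub_comm, ← hX0] at hxr
  obtain ⟨y, hy, rfl⟩ := hs x hxr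
  have ha : |y / ρ| < 1 / 8 := by
    rw [abs_div, abs_of_pos hρ, div_lt_iff₀ hρ]
    have := abs_le.2 hy
    linarith
  refine hC.pt ha ?_
  have e1 : cl (y / ρ) = y / ρ := cl_eq (by have := abs_lt.1 ha; exact ⟨by linarith [this.1], by linarith [this.2]⟩)
  have e2 : ct 0 = 0 := ct_eq (by norm_num)
  rw [e1, e2, mul_div_cancel₀ _ hρ.ne', mul_zero, add_zero]
  exact div_ne_zero hx hB.ne'

lemma RSol.isol {u ux uxx ut a ax : ℝ → ℝ → ℝ} {x1 x2 t1 t2 M τ z : ℝ}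
    (h : RSol u ux uxx ut a ax x1 x2 t1 t2 M) (hτ : τ ∈ Ioc t1 t2) (hz : z ∈ Ioo x1 x2)
    (hcl : z ∈ closure {x | u x τ ≠ 0}) : ∃ r > 0, ∀ x, x ≠ z → |x - z| < r → u x τ ≠ 0 := by
  obtain ⟨Xf, ρ, B, hρ, hB, hX0, hm, hc, H⟩ := h.near hτ hz hcl
  obtain ⟨Ux, Uxx, Ut, A, Ax, hC, h0, xa, xb, κ, δ, g1, g2, g3, g4, g5, g6⟩ := H ρ hρ le_rfl
  obtain ⟨r', hr', hi⟩ := hC.iso g1 g2 g3 g4 g5 g6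
  obtain ⟨r1, hr1, hr1'⟩ := exists_between (lt_min hr' one_pos)
  have k1 := lt_of_lt_of_le hr1' (min_le_left _ _)
  have k2 := lt_of_lt_of_le hr1' (min_le_right _ _)
  obtain ⟨r, hr, hs⟩ := surj_near hm hc (show 0 < ρ * r1 by positivity) (by nlinarith)
  refine ⟨r, hr, fun x hxz hx => ?_⟩
  rw [← hX0] at hx
  obtain ⟨y, hy, rfl⟩ := hs x hx
  have ha : |y / ρ| ≤ r1 := by
    rw [abs_div, abs_of_pos hρ, div_le_iff₀ hρ]
    have := abs_le.2 hy
    linarith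
  have hy0 : y ≠ 0 := fun hh => hxz (by rw [hh, hX0])
  have := hi (y / ρ) (div_ne_zero hy0 hρ.ne') (by linarith)
  have e1 : cl (y / ρ) = y / ρ := cl_eq (by have := abs_le.1 ha; exact ⟨by linarith [this.1], by linarith [this.2]⟩)
  have e2 : ct 0 = 0 := ct_eq (by norm_num)
  rw [e1, e2, mul_div_cancel₀ _ hρ.ne', mul_zero, add_zero] at this
  intro hu
  rw [hu, zero_div] at this
  exact this rfl

lemma sgn_tr {w X y x y' : ℝ} (h : 0 ≤ w * (X - y)) (h1 : y' < x → y < X) (h2 : x < y' → X < y) :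
    0 ≤ w * (x - y') := by
  rcases lt_trichotomy x y' with hx | hx | hx
  · have := h2 hx
    have hw : w ≤ 0 := by
      by_contra hn
      push Not at hn
      have := mul_neg_of_pos_of_neg hn (show X - y < 0 by linarith)
      linarith
    exact mul_nonneg_of_nonpos_of_nonpos hw (by linarith)
  · rw [hx]; simp
  · have := h1 hx
    have hw : 0 ≤ w := by
      by_contra hn
      push Not at hn
      have := mul_neg_of_neg_of_pos hn (show 0 < X - y by linarith)
      linarith
    exact mul_nonneg hw (by linarith)

lemma RSol.nopat {u ux uxx ut a ax : ℝ → ℝ → ℝ} {x1 x2 t1 t2 M τ z e δ : ℝ}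
    (h : RSol u ux uxx ut a ax x1 x2 t1 t2 M) (hτ : τ ∈ Ioc t1 t2) (hz : z ∈ Ioo x1 x2)
    (hcl : z ∈ closure {x | u x τ ≠ 0}) (h0 : u z τ = 0) (h1 : ux z τ = 0) (he : 0 < e) (hδ : 0 < δ) :
    ∃ t ∈ Ioo (τ - δ) τ, ∀ y σ, |σ| = 1 → ¬ ∀ x, |x - z| < e → 0 ≤ σ * u x t * (x - y) := by
  obtain ⟨Xf, ρ0, B, hρ0, hB, hX0, hm, hc, H⟩ := h.near hτ hz hcl
  have hc0 : ContinuousAt Xf 0 := hc.continuousAt (Icc_mem_nhds (by linarith) hρ0)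
  obtain ⟨d, hd, hdb⟩ := Metric.continuousAt_iff.1 hc0 e he
  obtain ⟨ρ, hρ, hρlt⟩ := exists_between
    (show 0 < min (min 1 ρ0) (min d δ) from lt_min (lt_min one_pos hρ0) (lt_min hd hδ))
  have q1 : ρ ≤ 1 := (hρlt.trans_le ((min_le_left _ _).trans (min_le_left _ _))).le
  have q2 : ρ ≤ ρ0 := (hρlt.trans_le ((min_le_left _ _).trans (min_le_right _ _))).le
  have q3 : ρ < d := hρlt.trans_le ((min_le_right _ _).trans (min_le_left _ _))
  have q4 : ρ < δ := hρlt.trans_le ((min_le_right _ _).trans (min_le_right _ _))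
  obtain ⟨Ux, Uxx, Ut, A, Ax, hC, h0', xa, xb, κ, δ', g1, g2, g3, g4, g5, g6⟩ := H ρ hρ q2
  have e1 : cl 0 = 0 := cl_eq (by norm_num)
  have e2 : ct 0 = 0 := ct_eq (by norm_num)
  have hup := hC.up (by simp only [e1, e2, mul_zero, add_zero]; rw [hX0, h0, zero_div]) (h0' h1)
  obtain ⟨t, ht, hn⟩ := hC.noPat g1 g2 g3 g4 g5 g6 hup one_pos
  have r2 : 0 < ρ ^ 2 := by positivity
  have r21 : ρ ^ 2 ≤ ρ := by nlinarith
  refine ⟨τ + ρ ^ 2 * t, ⟨?_, ?_⟩, ?_⟩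
  · have : ρ ^ 2 * (-1) ≤ ρ ^ 2 * t := mul_le_mul_of_nonneg_left ht.1.le r2.le
    linarith
  · have := mul_neg_of_pos_of_neg r2 ht.2
    linarith
  intro y σ hσ hpat
  have mm : ∀ x ∈ Icc (-1 : ℝ) 1, ρ * x ∈ Icc (-ρ) ρ := by
    intro x hx
    have f1 : ρ * x ≤ ρ * 1 := mul_le_mul_of_nonneg_left hx.2 hρ.le
    have f2 : ρ * (-1) ≤ ρ * x := mul_le_mul_of_nonneg_left hx.1 hρ.le
    exact ⟨by linarith, by linarith⟩
  have hsub : Icc (-ρ) ρ ⊆ Icc (-ρ0) ρ0 := Icc_subset_Icc (by linarith) q2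
  have hm' : ∀ x ∈ Icc (-1 : ℝ) 1, ∀ x' ∈ Icc (-1 : ℝ) 1, x < x' → Xf (ρ * x) < Xf (ρ * x') :=
    fun x hx x' hx' hl => hm (hsub (mm x hx)) (hsub (mm x' hx')) (mul_lt_mul_of_pos_left hl hρ)
  have n1 : (1 : ℝ) ∈ Icc (-1 : ℝ) 1 := by norm_num
  have n2 : (-1 : ℝ) ∈ Icc (-1 : ℝ) 1 := by norm_num
  obtain ⟨y', hy1, hy2⟩ : ∃ y', (∀ x ∈ Icc (-1 : ℝ) 1, y' < x → y < Xf (ρ * x)) ∧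
      (∀ x ∈ Icc (-1 : ℝ) 1, x < y' → Xf (ρ * x) < y) := by
    by_cases c1 : y ≤ Xf (ρ * (-1))
    · exact ⟨-1, fun x hx hl => lt_of_le_of_lt c1 (hm' _ n2 x hx hl), fun x hx hl => by linarith [hx.1]⟩
    by_cases c2 : Xf (ρ * 1) ≤ y
    · exact ⟨1, fun x hx hl => by linarith [hx.2], fun x hx hl => lt_of_lt_of_le (hm' x hx _ n1 hl) c2⟩
    push Not at c1 c2
    obtain ⟨v, hv, rfl⟩ := intermediate_value_Icc (show -ρ ≤ ρ by linarith) (hc.mono hsub)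
      (show y ∈ Icc _ _ from ⟨by rw [show -ρ = ρ * (-1) by ring]; exact c1.le, by rw [mul_one] at c2; exact c2.le⟩)
    have ev : ρ * (v / ρ) = v := mul_div_cancel₀ _ hρ.ne'
    have mv : v / ρ ∈ Icc (-1 : ℝ) 1 := by
      constructor
      · rw [le_div_iff₀ hρ]; linarith [hv.1]
      · rw [div_le_iff₀ hρ]; linarith [hv.2]
    refine ⟨v / ρ, fun x hx hl => ?_, fun x hx hl => ?_⟩
    · have := hm' _ mv x hx hl
      rwa [ev] at this
    · have := hm' x hx _ mv hl
      rwa [ev] at this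
  refine hn y' σ hσ fun x hx => ?_
  have e3 : ct t = t := ct_eq (Ioo_subset_Icc_self ht)
  simp only [cl_eq hx, e3]
  have := hpat (Xf (ρ * x)) (by
    have := @hdb (ρ * x) (by
      rw [Real.dist_eq, sub_zero]
      exact lt_of_le_of_lt (abs_le.2 (mm x hx)) q3)
    rwa [Real.dist_eq, hX0] at this)
  have h3 := sgn_tr this (hy1 x hx) (hy2 x hx)
  have : σ * (u (Xf (ρ * x)) (τ + ρ ^ 2 * t) / B) * (x - y') =
    (σ * u (Xf (ρ * x)) (τ + ρ ^ 2 * t) * (x - y')) / B := by ring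
  rw [this]
  exact div_nonneg h3 hB.le

open Set Filter Topology

section
variable {u ux uxx ut a ax : ℝ → ℝ → ℝ} {x1 x2 t1 t2 M : ℝ}

lemma RSol.mono (h : RSol u ux uxx ut a ax x1 x2 t1 t2 M) {y1 y2 r1 r2 : ℝ}
    (h1 : x1 ≤ y1) (h2 : y2 ≤ x2) (h3 : t1 ≤ r1) (h4 : r2 ≤ t2) :
    RSol u ux uxx ut a ax y1 y2 r1 r2 M := by
  have sx : Icc y1 y2 ⊆ Icc x1 x2 := Icc_subset_Icc h1 h2
  have st : Icc r1 r2 ⊆ Icc t1 t2 := Icc_subset_Icc h3 h4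
  have sp := Set.prod_mono sx st
  exact ⟨h.cu.mono sp, h.cux.mono sp, h.cuxx.mono sp, h.cut.mono sp,
    fun x hx t ht => h.dx x (sx hx) t (st ht), fun x hx t ht => h.dxx x (sx hx) t (st ht),
    fun x hx t ht => h.dt x (sx hx) t (st ht), fun x hx t ht => h.da x (sx hx) t (st ht),
    fun t ht => (h.cax t (st ht)).mono sx,
    fun x hx t ht t' ht' => h.lt x (sx hx) t (st ht) t' (st ht'), h.M1,
    fun x hx t ht => h.ba x (sx hx) t (st ht), fun x hx t ht => h.e x (sx hx) t (st ht)⟩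

lemma RSol.sgn (h : RSol u ux uxx ut a ax x1 x2 t1 t2 M) {s : ℝ} (hs : |s| = 1) :
    RSol (fun x t => s * u x t) (fun x t => s * ux x t) (fun x t => s * uxx x t)
      (fun x t => s * ut x t) a ax x1 x2 t1 t2 M := by
  refine ⟨continuousOn_const.mul h.cu, continuousOn_const.mul h.cux, continuousOn_const.mul h.cuxx,
    continuousOn_const.mul h.cut, fun x hx t ht => (h.dx x hx t ht).const_mul s,
    fun x hx t ht => (h.dxx x hx t ht).const_mul s, fun x hx t ht => (h.dt x hx t ht).const_mul s,
    h.da, h.cax, h.lt, h.M1, h.ba, fun x hx t ht => ?_⟩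
  have e : s * ut x t - a x t * (s * uxx x t) = s * (ut x t - a x t * uxx x t) := by ring
  rw [e, abs_mul, abs_mul, abs_mul, hs, one_mul, one_mul, one_mul]
  exact h.e x hx t ht

lemma RSol.cx (h : RSol u ux uxx ut a ax x1 x2 t1 t2 M) {t : ℝ} (ht : t ∈ Icc t1 t2) :
    ContinuousOn (fun x => u x t) (Icc x1 x2) := fun x hx =>
  (h.dx x hx t ht).continuousAt.continuousWithinAt

lemma RSol.ctt (h : RSol u ux uxx ut a ax x1 x2 t1 t2 M) {x : ℝ} (hx : x ∈ Icc x1 x2) :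
    ContinuousOn (fun t => u x t) (Icc t1 t2) := fun t ht =>
  (h.dt x hx t ht).continuousAt.continuousWithinAt

lemma RSol.clos (h : RSol u ux uxx ut a ax x1 x2 t1 t2 M) {t z : ℝ} (ht : t ∈ Ioc t1 t2)
    (hz : z ∈ Ioo x1 x2) (h2 : u x2 t ≠ 0) : z ∈ closure {x | u x t ≠ 0} := by
  have hcx := h.cx (Ioc_subset_Icc_self ht)
  by_contra hn
  obtain ⟨R, hR⟩ : ∃ R, R = sInf {x | x ∈ Icc z x2 ∧ u x t ≠ 0} := ⟨_, rfl⟩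
  have hne : {x | x ∈ Icc z x2 ∧ u x t ≠ 0}.Nonempty := ⟨x2, ⟨hz.2.le, le_refl _⟩, h2⟩
  have hbd : BddBelow {x | x ∈ Icc z x2 ∧ u x t ≠ 0} := ⟨z, fun x hx => hx.1.1⟩
  have hRc : R ∈ closure {x | x ∈ Icc z x2 ∧ u x t ≠ 0} := by rw [hR]; exact csInf_mem_closure hne hbd
  have hRc' : R ∈ closure {x | u x t ≠ 0} := closure_mono (fun x hx => hx.2) hRc
  have hzR : z ≤ R := by rw [hR]; exact le_csInf hne fun x hx => hx.1.1
  have hRx : R ≤ x2 := by rw [hR]; exact csInf_le hbd ⟨⟨hz.2.le, le_refl _⟩, h2⟩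
  have hzR' : z < R := lt_of_le_of_ne hzR (fun e => hn (by rw [e]; exact hRc'))
  have hzero : ∀ x ∈ Ico z R, u x t = 0 := by
    intro x hx
    by_contra hh
    have : R ≤ x := by rw [hR]; exact csInf_le hbd ⟨⟨hx.1, by linarith [hx.2]⟩, hh⟩
    linarith [hx.2]
  have hRm : R ∈ Icc x1 x2 := ⟨by linarith [hz.1], hRx⟩
  have hR0 : u R t = 0 := by
    have hcR := (h.dx R hRm t (Ioc_subset_Icc_self ht)).continuousAt
    by_contra hh
    obtain ⟨d, hd, hb⟩ := Metric.eventually_nhds_iff.1 (hcR.eventually_ne hh)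
    obtain ⟨x, hx1, hx2⟩ := exists_between (show max z (R - d) < R from max_lt hzR' (by linarith))
    have q1 := le_max_left z (R - d)
    have q2 := le_max_right z (R - d)
    exact hb (y := x) (by rw [Real.dist_eq, abs_lt]; constructor <;> linarith) (hzero x ⟨by linarith, hx2⟩)
  have hRlt : R < x2 := lt_of_le_of_ne hRx (fun e => h2 (by rw [← e]; exact hR0))
  obtain ⟨r, hr, hi⟩ := h.isol ht ⟨by linarith [hz.1], hRlt⟩ hRc'
  obtain ⟨x, hx1, hx2⟩ := exists_between (show max z (R - r) < R from max_lt hzR' (by linarith))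
  have q1 := le_max_left z (R - r)
  have q2 := le_max_right z (R - r)
  exact hi x hx2.ne (by rw [abs_lt]; constructor <;> linarith) (hzero x ⟨by linarith, hx2⟩)

lemma RSol.nopat2 (h : RSol u ux uxx ut a ax x1 x2 t1 t2 M) {y : ℝ → ℝ} {t p : ℝ}
    (ht : t ∈ Ioc t1 t2) (hp : p ∈ Ioo x1 x2) (h2 : u x2 t ≠ 0) (h0 : u p t = 0)
    (hpat : ∀ r ∈ Ioo t1 t, ∀ x ∈ Icc x1 x2, 0 ≤ u x r * (x - y r)) : ux p t ≠ 0 := by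
  intro h1
  obtain ⟨r, hr, hn⟩ := h.nopat ht hp (h.clos ht hp h2) h0 h1
    (show 0 < min (p - x1) (x2 - p) from lt_min (by linarith [hp.1]) (by linarith [hp.2]))
    (show 0 < t - t1 by linarith [ht.1])
  refine hn (y r) 1 (by norm_num) fun x hx => ?_
  have q1 := abs_lt.1 (hx.trans_le (min_le_left _ _))
  have q2 := abs_lt.1 (hx.trans_le (min_le_right _ _))
  rw [one_mul]
  exact hpat r ⟨by linarith [hr.1], hr.2⟩ x ⟨by linarith [q1.1], by linarith [q2.2]⟩

lemma RSol.mp_alg (h : RSol u ux uxx ut a ax x1 x2 t1 t2 M) {x t : ℝ} (hx : x ∈ Icc x1 x2)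
    (ht : t ∈ Icc t1 t2) (hu : u x t < 0) (h1 : ux x t = 0) (h2 : 0 ≤ uxx x t) :
    2 * M * u x t < ut x t := by
  have e := (abs_le.1 (h.e x hx t ht)).1
  have hM := h.M1
  have ha : 0 < a x t := lt_of_lt_of_le (by positivity) (h.ba x hx t ht).1
  rw [h1, abs_zero, abs_of_neg hu] at e
  have e2 := mul_nonneg ha.le h2
  have e3 : M * u x t < 0 := mul_neg_of_pos_of_neg (by linarith) hu
  linarith

lemma RSol.pos (h : RSol u ux uxx ut a ax x1 x2 t1 t2 M) (h0 : ∀ x ∈ Icc x1 x2, 0 ≤ u x t1)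
    (hl : ∀ t ∈ Icc t1 t2, 0 < u x1 t ∧ 0 < u x2 t) :
    ∀ x ∈ Icc x1 x2, ∀ t ∈ Ioc t1 t2, 0 < u x t := by
  have hint : ∀ x ∈ Icc x1 x2, ∀ t ∈ Icc t1 t2, u x t ≤ 0 → x ∈ Ioo x1 x2 := by
    intro x hx t ht hu
    refine ⟨lt_of_le_of_ne hx.1 ?_, lt_of_le_of_ne hx.2 ?_⟩
    · rintro rfl; linarith [(hl t ht).1]
    · rintro rfl; linarith [(hl t ht).2]
  have hnn := mp_general (K := Icc x1 x2 ×ˢ Icc t1 t2) (isCompact_Icc.prod isCompact_Icc)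
    (z := u) (zx := ux) (zxx := uxx) (zt := ut) (k := 2 * M) h.cu (by
      rintro x t ⟨hx, ht⟩ hu
      simp only at hx ht
      have hx' := hint x hx t ht hu.le
      have ht' : t ∈ Ioc t1 t2 := by
        refine ⟨lt_of_le_of_ne ht.1 ?_, ht.2⟩
        rintro rfl; linarith [h0 x hx]
      obtain ⟨r1, r2⟩ := rect_in hx' ht'
      refine ⟨r1, r2, ?_, h.dxx x hx t ht, h.dt x hx t ht, h.mp_alg hx ht hu⟩
      filter_upwards [r1] with y hy
      exact h.dx y hy.1 t ht)
  intro x hx t ht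
  have ht' := Ioc_subset_Icc_self ht
  by_contra hn
  push Not at hn
  have hx' := hint x hx t ht' hn
  have hu0 : u x t = 0 := le_antisymm hn (hnn (x, t) ⟨hx, ht'⟩)
  refine h.nopat2 (y := fun _ => x1) ht hx' (hl t ht').2.ne' hu0 ?_ ?_
  · intro r hr y hy
    exact mul_nonneg (hnn (y, r) ⟨hy, hr.1.le, hr.2.le.trans ht.2⟩) (by linarith [hy.1])
  · have hm : IsLocalMin (fun y => u y t) x := by
      filter_upwards [Icc_mem_nhds hx'.1 hx'.2] with y hy
      rw [hu0]
      exact hnn (y, t) ⟨hy, ht'⟩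
    exact hm.hasDerivAt_eq_zero (h.dx x hx t ht')

lemma RSol.pat (h : RSol u ux uxx ut a ax x1 x2 t1 t2 M) {z : ℝ} (hz : z ∈ Ioo x1 x2)
    (h0 : ∀ x ∈ Icc x1 z, u x t1 ≤ 0) (h0' : ∀ x ∈ Icc x1 x2, z < x → 0 < u x t1)
    (hl : ∀ t ∈ Icc t1 t2, u x1 t < 0 ∧ 0 < u x2 t) :
    ∀ t ∈ Icc t1 t2, ∀ x ∈ Icc x1 x2, ∀ x' ∈ Icc x1 x2, x ≤ x' → u x' t ≤ 0 → u x t ≤ 0 := by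
  obtain ⟨L, hL⟩ : ∃ L : Set (ℝ × ℝ × ℝ), L = (Icc x1 x2 ×ˢ (Icc x1 x2 ×ˢ Icc t1 t2)) ∩
      {q | q.1 ≤ q.2.1 ∧ u q.2.1 q.2.2 ≤ 0} := ⟨_, rfl⟩
  have hLc : IsCompact L := by
    have c3 : IsCompact (Icc x1 x2 ×ˢ (Icc x1 x2 ×ˢ Icc t1 t2)) :=
      isCompact_Icc.prod (isCompact_Icc.prod isCompact_Icc)
    refine c3.of_isClosed_subset ?_ (by rw [hL]; exact inter_subset_left)
    have f1 : ContinuousOn (fun q : ℝ × ℝ × ℝ => (q.2.1 - q.1, - u q.2.1 q.2.2))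
        (Icc x1 x2 ×ˢ (Icc x1 x2 ×ˢ Icc t1 t2)) := by
      refine ContinuousOn.prodMk (by fun_prop) (ContinuousOn.neg ?_)
      exact h.cu.comp (f := fun q : ℝ × ℝ × ℝ => (q.2.1, q.2.2)) (by fun_prop) (fun q hq => hq.2)
    have := f1.preimage_isClosed_of_isClosed c3.isClosed (isClosed_Ici (a := ((0 : ℝ), (0 : ℝ))))
    rw [hL]
    convert this using 1
    ext q
    simp [Prod.le_def]
  have hKc : IsCompact ((fun q : ℝ × ℝ × ℝ => (q.1, q.2.2)) '' L) := hLc.image (by fun_prop)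
  obtain ⟨K, hK⟩ : ∃ K, K = (fun q : ℝ × ℝ × ℝ => (q.1, q.2.2)) '' L := ⟨_, rfl⟩
  rw [← hK] at hKc
  have mK : ∀ x t, (x, t) ∈ K ↔ x ∈ Icc x1 x2 ∧ t ∈ Icc t1 t2 ∧ ∃ x' ∈ Icc x1 x2, x ≤ x' ∧ u x' t ≤ 0 := by
    intro x t
    rw [hK, hL]
    constructor
    · rintro ⟨⟨p, q, r⟩, ⟨⟨g1, g2, g3⟩, g4, g5⟩, g6⟩
      simp only [Prod.mk.injEq] at g6
      obtain ⟨rfl, rfl⟩ := g6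
      exact ⟨g1, g3, q, g2, g4, g5⟩
    · rintro ⟨g1, g2, x', g3, g4, g5⟩
      exact ⟨(x, x', t), ⟨⟨g1, g3, g2⟩, g4, g5⟩, rfl⟩
  have hn := h.sgn (s := -1) (by norm_num)
  have hnn := mp_general (K := K) hKc
    (z := fun x t => -1 * u x t) (zx := fun x t => -1 * ux x t) (zxx := fun x t => -1 * uxx x t)
    (zt := fun x t => -1 * ut x t) (k := 2 * M)
    (hn.cu.mono (by rintro ⟨x, t⟩ hq; exact ⟨((mK x t).1 hq).1, ((mK x t).1 hq).2.1⟩)) (by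
      intro x t hq hu
      obtain ⟨hx, ht, x', hx', hxx', hu'⟩ := (mK x t).1 hq
      have hup : 0 < u x t := by linarith
      have hlt : x < x' := lt_of_le_of_ne hxx' (by rintro rfl; linarith)
      have hx1 : x1 < x := lt_of_le_of_ne hx.1 (by rintro rfl; linarith [(hl t ht).1])
      have hx2' : x' < x2 := lt_of_le_of_ne hx'.2 (by rintro rfl; linarith [(hl t ht).2])
      have hxi : x ∈ Ioo x1 x2 := ⟨hx1, by linarith⟩
      have ht1 : t1 < t := by
        refine lt_of_le_of_ne ht.1 ?_
        rintro rfl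
        have : z < x := by
          by_contra hc
          push Not at hc
          linarith [h0 x ⟨hx1.le, hc⟩]
        linarith [h0' x' hx' (by linarith)]
      obtain ⟨r1, r2⟩ := rect_in hxi (show t ∈ Ioc t1 t2 from ⟨ht1, ht.2⟩)
      refine ⟨?_, ?_, ?_, hn.dxx x hx t ht, hn.dt x hx t ht, hn.mp_alg hx ht hu⟩
      · filter_upwards [Ioo_mem_nhds hx1 hlt] with y hy
        exact (mK y t).2 ⟨⟨hy.1.le, by linarith [hy.2]⟩, ht, x', hx', hy.2.le, hu'⟩
      · have ev : ∀ᶠ s in 𝓝 t, 0 < u x s := (h.dt x hx t ht).continuousAt.eventually (lt_mem_nhds hup)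
        obtain ⟨d, hd, hb⟩ := Metric.eventually_nhds_iff.1 ev
        filter_upwards [r2, Ioo_mem_nhdsLT (show t - d < t by linarith), self_mem_nhdsWithin] with s hs hs2 hs3
        have hst : s < t := hs3
        refine (mK x s).2 ⟨hx, hs.2, ?_⟩
        by_contra hc
        push Not at hc
        have hs1 : s ∈ Icc t1 t2 := hs.2
        have := (h.mono hx1.le le_rfl hs1.1 ht.2).pos (fun y hy => (hc y ⟨by linarith [hy.1], hy.2⟩ hy.1).le)
          (fun r hr => ⟨hb (by rw [Real.dist_eq, abs_lt]; constructor <;> linarith [hr.1, hr.2, hs2.1]),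
            (hl r ⟨by linarith [hs1.1, hr.1], by linarith [hr.2, ht.2]⟩).2⟩) x' ⟨hxx', hx'.2⟩ t ⟨hst, le_refl _⟩
        linarith
      · filter_upwards [r1] with y hy
        exact hn.dx y hy.1 t ht)
  intro t ht x hx x' hx' hxx' hu'
  have := hnn (x, t) ((mK x t).2 ⟨hx, ht, x', hx', hxx', hu'⟩)
  simp only at this
  linarith

lemma RSol.one (h : RSol u ux uxx ut a ax x1 x2 t1 t2 M) {z : ℝ} (hz : z ∈ Ioo x1 x2)
    (h0 : ∀ x ∈ Icc x1 z, u x t1 ≤ 0) (h0' : ∀ x ∈ Icc x1 x2, z < x → 0 < u x t1)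
    (hl : ∀ t ∈ Icc t1 t2, u x1 t < 0 ∧ 0 < u x2 t) {t : ℝ} (ht : t ∈ Ioc t1 t2) {p q : ℝ}
    (hp : p ∈ Icc x1 x2) (hq : q ∈ Icc x1 x2) (hpq : p < q) (hp0 : u p t = 0) (hq0 : u q t = 0) : False := by
  have hP := h.pat hz h0 h0' hl
  have ht' := Ioc_subset_Icc_self ht
  have hp1 : x1 < p := lt_of_le_of_ne hp.1 (by rintro rfl; linarith [(hl t ht').1])
  have hpi : p ∈ Ioo x1 x2 := ⟨hp1, by linarith [hq.2]⟩
  refine h.nopat2 (y := fun r => sSup {x | x ∈ Icc x1 x2 ∧ u x r ≤ 0})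
    ht hpi (hl t ht').2.ne' hp0 ?_ ?_
  · intro r hr x hx
    have hr' : r ∈ Icc t1 t2 := ⟨hr.1.le, hr.2.le.trans ht.2⟩
    have hbd : BddAbove {x | x ∈ Icc x1 x2 ∧ u x r ≤ 0} := ⟨x2, fun y hy => hy.1.2⟩
    have hne : {x | x ∈ Icc x1 x2 ∧ u x r ≤ 0}.Nonempty :=
      ⟨x1, ⟨le_refl _, by linarith [hz.1, hz.2]⟩, (hl r hr').1.le⟩
    rcases lt_or_ge x (sSup {x | x ∈ Icc x1 x2 ∧ u x r ≤ 0}) with hc | hc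
    · obtain ⟨x', hx', hlt⟩ := exists_lt_of_lt_csSup hne hc
      exact mul_nonneg_of_nonpos_of_nonpos (hP r hr' x hx x' hx'.1 hlt.le hx'.2) (by linarith)
    · rcases le_or_gt (u x r) 0 with hu | hu
      · have := le_csSup hbd (show x ∈ _ from ⟨hx, hu⟩)
        rw [le_antisymm this hc, sub_self, mul_zero]
      · exact mul_nonneg hu.le (by linarith)
  · have hm : IsLocalMax (fun y => u y t) p := by
      filter_upwards [Ioo_mem_nhds hp1 hpq] with y hy
      rw [hp0]
      exact hP t ht' y ⟨hy.1.le, by linarith [hy.2, hq.2]⟩ q hq hy.2.le hq0.le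
    exact hm.hasDerivAt_eq_zero (h.dx p hp t ht')
end

open Set Filter Topology

lemma anti_local {f : ℝ → ℕ∞} {a b : ℝ} (H : ∀ τ ∈ Ioo a b, ∃ δ > 0,
    (∀ t ∈ Ioo (τ - δ) τ, a < t → f τ ≤ f t) ∧ (∀ t ∈ Ioo τ (τ + δ), t < b → f t ≤ f τ)) :
    ∀ p ∈ Ioo a b, ∀ q ∈ Ioo a b, p ≤ q → f q ≤ f p := by
  intro p hp q hq hpq
  obtain ⟨S, hS⟩ : ∃ S : Set ℝ, S = {t | t ∈ Icc p q ∧ ∀ r ∈ Icc p t, f r ≤ f p} := ⟨_, rfl⟩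
  have mS : ∀ t, t ∈ S ↔ t ∈ Icc p q ∧ ∀ r ∈ Icc p t, f r ≤ f p := fun t => by rw [hS]; rfl
  have hpS : p ∈ S := (mS p).2 ⟨⟨le_refl _, hpq⟩, fun r hr => by rw [le_antisymm hr.2 hr.1]⟩
  have hbd : BddAbove S := ⟨q, fun t ht => ((mS t).1 ht).1.2⟩
  obtain ⟨m, hm⟩ : ∃ m, m = sSup S := ⟨_, rfl⟩
  have hpm : p ≤ m := by rw [hm]; exact le_csSup hbd hpS
  have hmq : m ≤ q := by rw [hm]; exact csSup_le ⟨p, hpS⟩ fun t ht => ((mS t).1 ht).1.2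
  have hlt : ∀ r, p ≤ r → r < m → f r ≤ f p := by
    intro r h1 h2
    rw [hm] at h2
    obtain ⟨t, ht, hrt⟩ := exists_lt_of_lt_csSup ⟨p, hpS⟩ h2
    exact ((mS t).1 ht).2 r ⟨h1, hrt.le⟩
  obtain ⟨δ, hδ, hL, hR⟩ := H m ⟨by linarith [hp.1], by linarith [hq.2]⟩
  have hfm : f m ≤ f p := by
    rcases hpm.eq_or_lt with e | e
    · rw [e]
    obtain ⟨r, h1, h2⟩ := exists_between (show max p (m - δ) < m from max_lt e (by linarith))
    have q1 := le_max_left p (m - δ)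
    have q2 := le_max_right p (m - δ)
    exact (hL r ⟨by linarith, h2⟩ (by linarith [hp.1])).trans (hlt r (by linarith) h2)
  rcases hmq.eq_or_lt with e | e
  · rw [← e]; exact hfm
  exfalso
  obtain ⟨v, h1, h2⟩ := exists_between (show m < min q (m + δ) from lt_min e (by linarith))
  have q1 := h2.trans_le (min_le_left _ _)
  have q2 := h2.trans_le (min_le_right _ _)
  have : v ∈ S := by
    refine (mS v).2 ⟨⟨by linarith, q1.le⟩, fun r hr => ?_⟩
    rcases lt_trichotomy r m with c | c | c
    · exact hlt r hr.1 c
    · rw [c]; exact hfm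
    · exact (hR r ⟨c, by linarith [hr.2]⟩ (by linarith [hr.2, hq.2])).trans hfm
  have := le_csSup hbd this
  rw [← hm] at this
  linarith

lemma sg_cases {s s' : ℝ} (h : |s| = 1) (h' : |s'| = 1) : s = s' ∨ s = -s' := abs_eq_abs.1 (h.trans h'.symm)

lemma sg_uniq {s s' v : ℝ} (h : s * v = |v|) (h' : s' * v = |v|) (hv : v ≠ 0) : s = s' :=
  mul_right_cancel₀ hv (h.trans h'.symm)

lemma patt {f : ℝ → ℝ} {a b : ℝ} (hf : ContinuousOn f (Icc a b))
    (h1 : ∀ p ∈ Icc a b, ∀ q ∈ Icc a b, f p = 0 → f q = 0 → p = q) :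
    ∃ y s, |s| = 1 ∧ ∀ x ∈ Icc a b, 0 ≤ s * f x * (x - y) := by
  by_cases hz : ∃ y ∈ Icc a b, f y = 0
  · obtain ⟨y, hy, hfy⟩ := hz
    obtain ⟨s1, hs1, g1⟩ := const_sign (f := f) (S := Icc a b ∩ Iio y) (ordConnected_Icc.inter ordConnected_Iio)
      (hf.mono inter_subset_left) (fun x hx h0 => by
        have := h1 x hx.1 y hy h0 hfy
        have h3 : x < y := hx.2
        linarith)
    obtain ⟨s2, hs2, g2⟩ := const_sign (f := f) (S := Icc a b ∩ Ioi y) (ordConnected_Icc.inter ordConnected_Ioi)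
      (hf.mono inter_subset_left) (fun x hx h0 => by
        have := h1 x hx.1 y hy h0 hfy
        have h3 : y < x := hx.2
        linarith)
    rcases sg_cases hs1 hs2 with e | e
    · refine ⟨a, s2, hs2, fun x hx => mul_nonneg ?_ (by linarith [hx.1])⟩
      rcases lt_trichotomy x y with c | c | c
      · rw [← e, g1 x ⟨hx, c⟩]; exact abs_nonneg _
      · rw [c, hfy, mul_zero]
      · rw [g2 x ⟨hx, c⟩]; exact abs_nonneg _
    · refine ⟨y, s2, hs2, fun x hx => ?_⟩
      rcases lt_trichotomy x y with c | c | c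
      · have := g1 x ⟨hx, c⟩
        rw [e] at this
        have e2 : s2 * f x = -|f x| := by linarith
        rw [e2]
        exact mul_nonneg_of_nonpos_of_nonpos (by linarith [abs_nonneg (f x)]) (by linarith)
      · rw [c, hfy]; simp
      · rw [g2 x ⟨hx, c⟩]; exact mul_nonneg (abs_nonneg _) (by linarith)
  · push Not at hz
    obtain ⟨s, hs, g⟩ := const_sign (f := f) (S := Icc a b) ordConnected_Icc hf hz
    refine ⟨a, s, hs, fun x hx => ?_⟩
    rw [g x hx]
    exact mul_nonneg (abs_nonneg _) (by linarith [hx.1])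

section
variable {u ux uxx ut a ax : ℝ → ℝ → ℝ} {x1 x2 t1 t2 M : ℝ}

lemma RSol.nz (h : RSol u ux uxx ut a ax x1 x2 t1 t2 M) (hx : x1 ≤ x2) (ht : t1 ≤ t2)
    (hl : ∀ t ∈ Icc t1 t2, u x1 t ≠ 0 ∧ u x2 t ≠ 0) (h0 : ∀ x ∈ Icc x1 x2, u x t1 ≠ 0) :
    ∀ x ∈ Icc x1 x2, ∀ t ∈ Ioc t1 t2, u x t ≠ 0 := by
  have m1 : x1 ∈ Icc x1 x2 := ⟨le_refl _, hx⟩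
  have m2 : x2 ∈ Icc x1 x2 := ⟨hx, le_refl _⟩
  have n1 : t1 ∈ Icc t1 t2 := ⟨le_refl _, ht⟩
  obtain ⟨s, hs, g⟩ := const_sign ordConnected_Icc (h.cx n1) h0
  obtain ⟨s1, hs1, g1⟩ := const_sign ordConnected_Icc (h.ctt m1) (fun t ht => (hl t ht).1)
  obtain ⟨s2, hs2, g2⟩ := const_sign ordConnected_Icc (h.ctt m2) (fun t ht => (hl t ht).2)
  have e1 := sg_uniq (g x1 m1) (g1 t1 n1) (h0 x1 m1)
  have e2 := sg_uniq (g x2 m2) (g2 t1 n1) (h0 x2 m2)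
  have := (h.sgn hs).pos (fun x hx => by rw [g x hx]; exact abs_nonneg _) (fun t ht => by
    constructor
    · rw [e1, g1 t ht]; exact abs_pos.2 (hl t ht).1
    · rw [e2, g2 t ht]; exact abs_pos.2 (hl t ht).2)
  intro x hx t ht h3
  have := this x hx t ht
  rw [h3, mul_zero] at this
  exact lt_irrefl _ this

lemma RSol.le1 (h : RSol u ux uxx ut a ax x1 x2 t1 t2 M) (ht : t1 ≤ t2)
    (hl : ∀ t ∈ Icc t1 t2, u x1 t ≠ 0 ∧ u x2 t ≠ 0) {z : ℝ} (hz : z ∈ Ioo x1 x2)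
    (hz0 : u z t1 = 0) (h0 : ∀ x ∈ Icc x1 x2, x ≠ z → u x t1 ≠ 0) {t p q : ℝ} (htt : t ∈ Ioc t1 t2)
    (hp : p ∈ Icc x1 x2) (hq : q ∈ Icc x1 x2) (hpq : p < q) (hp0 : u p t = 0) (hq0 : u q t = 0) : False := by
  have hx : x1 ≤ x2 := by linarith [hz.1, hz.2]
  have m1 : x1 ∈ Icc x1 x2 := ⟨le_refl _, hx⟩
  have m2 : x2 ∈ Icc x1 x2 := ⟨hx, le_refl _⟩
  have n1 : t1 ∈ Icc t1 t2 := ⟨le_refl _, ht⟩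
  obtain ⟨s1, hs1, g1⟩ := const_sign ordConnected_Icc (h.ctt m1) (fun t ht => (hl t ht).1)
  obtain ⟨s2, hs2, g2⟩ := const_sign ordConnected_Icc (h.ctt m2) (fun t ht => (hl t ht).2)
  obtain ⟨r1, hr1, k1⟩ := const_sign (f := fun x => u x t1) (S := Icc x1 x2 ∩ Iio z)
    (ordConnected_Icc.inter ordConnected_Iio) ((h.cx n1).mono inter_subset_left)
    (fun x hx => h0 x hx.1 (ne_of_lt hx.2))
  obtain ⟨r2, hr2, k2⟩ := const_sign (f := fun x => u x t1) (S := Icc x1 x2 ∩ Ioi z)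
    (ordConnected_Icc.inter ordConnected_Ioi) ((h.cx n1).mono inter_subset_left)
    (fun x hx => h0 x hx.1 (ne_of_gt hx.2))
  have e1 := sg_uniq (k1 x1 ⟨m1, hz.1⟩) (g1 t1 n1) (hl t1 n1).1
  have e2 := sg_uniq (k2 x2 ⟨m2, hz.2⟩) (g2 t1 n1) (hl t1 n1).2
  rw [e1] at k1
  rw [e2] at k2
  rcases sg_cases hs1 hs2 with e | e
  · have := (h.sgn hs1).pos (fun x hx => by
      rcases lt_trichotomy x z with c | c | c
      · rw [k1 x ⟨hx, c⟩]; exact abs_nonneg _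
      · rw [c, hz0, mul_zero]
      · rw [e, k2 x ⟨hx, c⟩]; exact abs_nonneg _) (fun t ht => by
      constructor
      · rw [g1 t ht]; exact abs_pos.2 (hl t ht).1
      · rw [e, g2 t ht]; exact abs_pos.2 (hl t ht).2) p hp t htt
    rw [hp0, mul_zero] at this
    exact lt_irrefl _ this
  · refine (h.sgn hs2).one hz (fun x hx => ?_) (fun x hx hc => ?_) (fun t ht => ⟨?_, ?_⟩) htt hp hq hpq
      (by rw [hp0, mul_zero]) (by rw [hq0, mul_zero])
    · rcases hx.2.eq_or_lt with c | c
      · rw [c, hz0, mul_zero]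
      · have := k1 x ⟨⟨hx.1, by linarith [hz.2]⟩, c⟩
        rw [e] at this
        linarith [abs_nonneg (u x t1)]
    · rw [k2 x ⟨hx, hc⟩]; exact abs_pos.2 (h0 x hx hc.ne')
    · have := g1 t ht
      rw [e] at this
      linarith [abs_pos.2 (hl t ht).1]
    · rw [g2 t ht]; exact abs_pos.2 (hl t ht).2

lemma RSol.fin (h : RSol u ux uxx ut a ax x1 x2 t1 t2 M) {t : ℝ} (ht : t ∈ Ioc t1 t2)
    (h1 : u x1 t ≠ 0) (h2 : u x2 t ≠ 0) : {x | x ∈ Icc x1 x2 ∧ u x t = 0}.Finite := by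
  by_contra hn
  obtain ⟨p, hp, hacc⟩ := Set.Infinite.exists_accPt_of_subset_isCompact hn (isCompact_Icc (a := x1) (b := x2))
    (fun x hx => hx.1)
  rw [accPt_iff_frequently] at hacc
  refine hacc ?_
  by_cases hp0 : u p t = 0
  · have hpi : p ∈ Ioo x1 x2 := ⟨lt_of_le_of_ne hp.1 (by rintro rfl; exact h1 hp0),
      lt_of_le_of_ne hp.2 (by rintro rfl; exact h2 hp0)⟩
    obtain ⟨r, hr, hi⟩ := h.isol ht hpi (h.clos ht hpi h2)
    filter_upwards [Metric.ball_mem_nhds p hr] with x hx hc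
    exact hi x hc.1 (by rwa [Metric.mem_ball, Real.dist_eq] at hx) hc.2.2
  · filter_upwards [(h.dx p hp t (Ioc_subset_Icc_self ht)).continuousAt.eventually_ne hp0] with x hx hc
    exact hx hc.2.2

lemma RSol.tube (h : RSol u ux uxx ut a ax x1 x2 t1 t2 M) {τ : ℝ} {C : Set ℝ} (hC : IsClosed C)
    (h0 : ∀ x ∈ Icc x1 x2, x ∈ C → u x τ ≠ 0) : ∃ δ > 0, ∀ t ∈ Icc t1 t2, |t - τ| < δ →
      ∀ x ∈ Icc x1 x2, x ∈ C → u x t ≠ 0 := by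
  have c2 : IsCompact (Icc x1 x2 ×ˢ Icc t1 t2) := isCompact_Icc.prod isCompact_Icc
  have f1 := h.cu.preimage_isClosed_of_isClosed c2.isClosed (isClosed_singleton (x := (0 : ℝ)))
  have cB : IsCompact ((Icc x1 x2 ×ˢ Icc t1 t2) ∩ (fun q : ℝ × ℝ => u q.1 q.2) ⁻¹' {0}) :=
    c2.of_isClosed_subset f1 inter_subset_left
  have cB2 := (cB.inter_right (hC.preimage continuous_fst)).image continuous_snd
  have hτ : ∀ᶠ t in 𝓝 τ, t ∉ Prod.snd '' (((Icc x1 x2 ×ˢ Icc t1 t2) ∩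
      (fun q : ℝ × ℝ => u q.1 q.2) ⁻¹' {0}) ∩ Prod.fst ⁻¹' C) := by
    refine cB2.isClosed.isOpen_compl.mem_nhds ?_
    rintro ⟨⟨x, t⟩, ⟨⟨g1, g2⟩, g3⟩, g4⟩
    simp only at g4
    subst g4
    exact h0 x g1.1 g3 g2
  obtain ⟨δ, hδ, hb⟩ := Metric.eventually_nhds_iff.1 hτ
  refine ⟨δ, hδ, fun t ht htτ x hx hxC hu => ?_⟩
  exact hb (by rwa [Real.dist_eq]) ⟨(x, t), ⟨⟨⟨hx, ht⟩, hu⟩, hxC⟩, rfl⟩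

lemma RSol.loc (h : RSol u ux uxx ut a ax x1 x2 t1 t2 M) (hl : ∀ t ∈ Icc t1 t2, u x1 t ≠ 0 ∧ u x2 t ≠ 0)
    {τ : ℝ} (hτ : τ ∈ Ioc t1 t2) :
    ∃ δ > 0, (∀ t ∈ Ioo (τ - δ) τ, t1 < t →
        {x | x ∈ Icc x1 x2 ∧ u x τ = 0}.encard ≤ {x | x ∈ Icc x1 x2 ∧ u x t = 0}.encard) ∧
      (∀ t ∈ Ioo τ (τ + δ), t ≤ t2 →
        {x | x ∈ Icc x1 x2 ∧ u x t = 0}.encard ≤ {x | x ∈ Icc x1 x2 ∧ u x τ = 0}.encard) ∧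
      ((∃ z ∈ Icc x1 x2, u z τ = 0 ∧ ux z τ = 0) → ∀ δ' > 0, ∃ t ∈ Ioo (τ - δ') τ, t1 < t ∧
        {x | x ∈ Icc x1 x2 ∧ u x τ = 0}.encard < {x | x ∈ Icc x1 x2 ∧ u x t = 0}.encard) := by
  have hτ' := Ioc_subset_Icc_self hτ
  obtain ⟨Z, hZ⟩ : ∃ Z : ℝ → Set ℝ, Z = fun t => {x | x ∈ Icc x1 x2 ∧ u x t = 0} := ⟨_, rfl⟩
  have mZ : ∀ t x, x ∈ Z t ↔ x ∈ Icc x1 x2 ∧ u x t = 0 := fun t x => by rw [hZ]; rfl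
  have hfin : (Z τ).Finite := by rw [hZ]; exact h.fin hτ (hl τ hτ').1 (hl τ hτ').2
  have hint : ∀ z ∈ Z τ, z ∈ Ioo x1 x2 := by
    intro z hz
    rw [mZ] at hz
    exact ⟨lt_of_le_of_ne hz.1.1 (by rintro rfl; exact (hl τ hτ').1 hz.2),
      lt_of_le_of_ne hz.1.2 (by rintro rfl; exact (hl τ hτ').2 hz.2)⟩
  obtain ⟨e, he, heZ⟩ : ∃ e > 0, ∀ z ∈ Z τ, (x1 < z - e ∧ z + e < x2) ∧ ∀ z' ∈ Z τ, z ≠ z' → 2 * e < |z - z'| := by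
    have ev : ∀ᶠ e : ℝ in 𝓝[>] 0, ∀ z ∈ Z τ,
        (x1 < z - e ∧ z + e < x2) ∧ ∀ z' ∈ Z τ, z ≠ z' → 2 * e < |z - z'| := by
      have lim : ∀ c : ℝ, 0 < c → ∀ᶠ e : ℝ in 𝓝[>] 0, e < c := fun c hc =>
        (eventually_lt_nhds hc).filter_mono nhdsWithin_le_nhds
      rw [eventually_all_finite hfin]
      intro z hz
      have hi := hint z hz
      refine Eventually.and ?_ ?_
      · filter_upwards [lim (z - x1) (by linarith [hi.1]), lim (x2 - z) (by linarith [hi.2])] with e h1 h2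
        exact ⟨by linarith, by linarith⟩
      · rw [eventually_all_finite hfin]
        intro z' _
        by_cases c : z = z'
        · exact Eventually.of_forall fun _ hh => absurd c hh
        · filter_upwards [lim (|z - z'| / 2) (by have := abs_pos.2 (sub_ne_zero.2 c); linarith)] with e h1 _
          linarith
    obtain ⟨e, h1, h2⟩ := (ev.and self_mem_nhdsWithin).exists
    exact ⟨e, h2, h1⟩
  have hCc : IsClosed {x : ℝ | ∀ z ∈ Z τ, e ≤ |x - z|} := by
    simp only [setOf_forall]
    exact isClosed_biInter fun z _ => isClosed_le continuous_const (by fun_prop)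
  obtain ⟨δ, hδ, htube⟩ := h.tube (τ := τ) hCc (fun x hx hxC hu => by
    have := hxC x ((mZ τ x).2 ⟨hx, hu⟩)
    rw [sub_self, abs_zero] at this
    linarith)
  have hends : ∀ z ∈ Z τ, ∀ w, |w - z| = e → w ∈ Icc x1 x2 ∧ ∀ z' ∈ Z τ, e ≤ |w - z'| := by
    intro z hz w hw
    have h1 := (heZ z hz).1
    have h2 := abs_le.1 hw.le
    refine ⟨⟨by linarith [h2.1], by linarith [h2.2]⟩, fun z' hz' => ?_⟩
    by_cases c : z = z'
    · rw [← c, hw]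
    · have h3 := (heZ z hz).2 z' hz' c
      have h4 := abs_sub_le z w z'
      rw [abs_sub_comm z w, hw] at h4
      linarith
  have hend : ∀ z ∈ Z τ, ∀ t ∈ Icc t1 t2, |t - τ| < δ → u (z - e) t ≠ 0 ∧ u (z + e) t ≠ 0 := by
    intro z hz t ht htd
    have g1 := hends z hz (z - e) (by rw [sub_sub_cancel_left, abs_neg, abs_of_pos he])
    have g2 := hends z hz (z + e) (by rw [add_sub_cancel_left, abs_of_pos he])
    exact ⟨htube t ht htd _ g1.1 g1.2, htube t ht htd _ g2.1 g2.2⟩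
  have hsep : ∀ z ∈ Z τ, ∀ z' ∈ Z τ, ∀ w, w ∈ Icc (z - e) (z + e) → w ∈ Icc (z' - e) (z' + e) → z = z' := by
    intro z hz z' hz' w hw hw'
    by_contra c
    have h3 := (heZ z hz).2 z' hz' c
    have : |z - z'| ≤ 2 * e := by
      rw [abs_le]; constructor <;> linarith [hw.1, hw.2, hw'.1, hw'.2]
    linarith
  have hbef : ∀ t ∈ Ioo (τ - δ) τ, t1 < t → ∃ f : ℝ → ℝ, (∀ z ∈ Z τ, f z ∈ Icc (z - e) (z + e)) ∧
      (∀ z ∈ Z τ, f z ∈ Z t) ∧ InjOn f (Z τ) := by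
    intro t ht ht1
    have : ∀ z ∈ Z τ, ∃ y, y ∈ Icc (z - e) (z + e) ∧ u y t = 0 := by
      intro z hz
      by_contra hc
      push Not at hc
      have h1 := (heZ z hz).1
      refine (h.mono h1.1.le h1.2.le ht1.le hτ.2).nz (by linarith) ht.2.le (fun r hr => ?_) hc z
        ⟨by linarith, by linarith⟩ τ ⟨ht.2, le_refl _⟩ ((mZ τ z).1 hz).2
      refine hend z hz r ⟨by linarith [hr.1], by linarith [hr.2, hτ.2]⟩ ?_
      rw [abs_lt]; constructor <;> linarith [hr.1, hr.2, ht.1]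
    choose! f hf using this
    refine ⟨f, fun z hz => (hf z hz).1, fun z hz => ?_, fun z hz z' hz' hzz => ?_⟩
    · have h1 := (heZ z hz).1
      have h2 := (hf z hz).1
      exact (mZ t _).2 ⟨⟨by linarith [h2.1], by linarith [h2.2]⟩, (hf z hz).2⟩
    · exact hsep z hz z' hz' (f z) (hf z hz).1 (by rw [hzz]; exact (hf z' hz').1)
  have goal : (∀ t ∈ Ioo (τ - δ) τ, t1 < t → (Z τ).encard ≤ (Z t).encard) ∧
      (∀ t ∈ Ioo τ (τ + δ), t ≤ t2 → (Z t).encard ≤ (Z τ).encard) ∧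
      ((∃ z ∈ Icc x1 x2, u z τ = 0 ∧ ux z τ = 0) → ∀ δ' > 0, ∃ t ∈ Ioo (τ - δ') τ, t1 < t ∧
        (Z τ).encard < (Z t).encard) := by
    refine ⟨?_, ?_, ?_⟩
    · intro t ht ht1
      obtain ⟨f, -, h2, h3⟩ := hbef t ht ht1
      exact encard_le_encard_of_injOn h2 h3
    · intro t ht ht2
      have htm : t ∈ Icc t1 t2 := ⟨by linarith [hτ.1, ht.1], ht2⟩
      have : ∀ x ∈ Z t, ∃ z, z ∈ Z τ ∧ |x - z| < e := by
        intro x hx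
        by_contra hc
        push Not at hc
        exact htube t htm (by rw [abs_lt]; constructor <;> linarith [ht.1, ht.2]) x ((mZ t x).1 hx).1 hc
          ((mZ t x).1 hx).2
      choose! g hg using this
      refine encard_le_encard_of_injOn (f := g) (fun x hx => (hg x hx).1) ?_
      have key : ∀ x ∈ Z t, ∀ x' ∈ Z t, g x = g x' → ¬ x < x' := by
        intro x hx x' hx' hgg hlt
        have k1 := abs_lt.1 (hg x hx).2
        have k2 := abs_lt.1 (hg x' hx').2
        have hz := (hg x hx).1
        rw [← hgg] at k2
        have h1 := (heZ _ hz).1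
        refine (h.mono h1.1.le h1.2.le hτ.1.le ht2).le1 ht.1.le (fun r hr => ?_) (z := g x)
          ⟨by linarith, by linarith⟩ ((mZ τ _).1 hz).2 (fun y hy hyz hu => ?_) (t := t) (p := x) (q := x')
          ⟨ht.1, le_refl _⟩
          ⟨by linarith [k1.1], by linarith [k1.2]⟩ ⟨by linarith [k2.1], by linarith [k2.2]⟩ hlt
          ((mZ t _).1 hx).2 ((mZ t _).1 hx').2
        · refine hend _ hz r ⟨by linarith [hr.1, hτ.1], by linarith [hr.2]⟩ ?_
          rw [abs_lt]; constructor <;> linarith [hr.1, hr.2, ht.2]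
        · have hyZ : y ∈ Z τ := (mZ τ y).2 ⟨⟨by linarith [hy.1], by linarith [hy.2]⟩, hu⟩
          exact hyz (hsep y hyZ _ hz y ⟨by linarith, by linarith⟩ hy)
      intro x hx x' hx' hgg
      rcases lt_trichotomy x x' with c | c | c
      · exact absurd c (key x hx x' hx' hgg)
      · exact c
      · exact absurd c (key x' hx' x hx hgg.symm)
    · rintro ⟨z0, hz0, hu0, hux0⟩ δ' hδ'
      have hzZ : z0 ∈ Z τ := (mZ τ z0).2 ⟨hz0, hu0⟩
      have hi := hint z0 hzZ
      obtain ⟨t, ht, hn⟩ := h.nopat hτ hi (h.clos hτ hi (hl τ hτ').2) hu0 hux0 he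
        (show 0 < min (min δ δ') (τ - t1) from lt_min (lt_min hδ hδ') (by linarith [hτ.1]))
      have q1 := (min_le_left (min δ δ') (τ - t1)).trans (min_le_left δ δ')
      have q2 := (min_le_left (min δ δ') (τ - t1)).trans (min_le_right δ δ')
      have q3 := min_le_right (min δ δ') (τ - t1)
      have ht1 : t1 < t := by linarith [ht.1]
      refine ⟨t, ⟨by linarith [ht.1], ht.2⟩, ht1, ?_⟩
      have h1 := (heZ z0 hzZ).1
      have hss : Icc (z0 - e) (z0 + e) ⊆ Icc x1 x2 := Icc_subset_Icc h1.1.le h1.2.le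
      have h2z : ∃ p ∈ Icc (z0 - e) (z0 + e), ∃ q ∈ Icc (z0 - e) (z0 + e), u p t = 0 ∧ u q t = 0 ∧ p ≠ q := by
        by_contra hc
        push Not at hc
        obtain ⟨y, s, hs, hp⟩ := patt ((h.cx (t := t) ⟨ht1.le, by linarith [ht.2, hτ.2]⟩).mono hss) hc
        refine hn y s hs fun x hx => hp x ?_
        have := abs_lt.1 hx
        exact ⟨by linarith [this.1], by linarith [this.2]⟩
      obtain ⟨f, hf1, hf2, hf3⟩ := hbef t ⟨by linarith [ht.1], ht.2⟩ ht1
      obtain ⟨w, hw, hwu, hwf⟩ : ∃ w ∈ Icc (z0 - e) (z0 + e), u w t = 0 ∧ w ≠ f z0 := by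
        obtain ⟨p, hp, q, hq, hpu, hqu, hpq⟩ := h2z
        by_cases c : p = f z0
        · exact ⟨q, hq, hqu, fun hh => hpq (c.trans hh.symm)⟩
        · exact ⟨p, hp, hpu, c⟩
      have hwn : w ∉ f '' Z τ := by
        rintro ⟨z, hz, rfl⟩
        have := hsep z hz z0 hzZ _ (hf1 z hz) hw
        exact hwf (by rw [this])
      have hsub : insert w (f '' Z τ) ⊆ Z t := by
        rintro y (rfl | ⟨z, hz, rfl⟩)
        · exact (mZ t _).2 ⟨hss hw, hwu⟩
        · exact hf2 z hz
      have hle := encard_le_encard hsub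
      rw [encard_insert_of_notMem hwn, hf3.encard_image] at hle
      refine lt_of_lt_of_le ?_ hle
      exact ENat.lt_add_one_iff (by rw [encard_ne_top_iff]; exact hfin) |>.2 le_rfl
  rw [hZ] at goal
  exact ⟨δ, hδ, goal⟩
end

open Filter Topology

lemma reg_rsol {a b c u : ℝ → ℝ → ℝ} {xi1 xi2 : ℝ → ℝ} {T x1 x2 t1 t2 : ℝ}
    (hsol : IsClassicalSolution a b c xi1 xi2 T u) (hreg : Reg12 a b c xi1 xi2 T)
    (hsub : ∀ x ∈ Icc x1 x2, ∀ t ∈ Icc t1 t2, (x, t) ∈ domLat xi1 xi2 T) :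
    ∃ M, RSol u (pdx u) (pdxx u) (pdt u) a (pdx a) x1 x2 t1 t2 M := by
  obtain ⟨M0, hM0⟩ := hreg
  have hle : M0 ≤ |M0| + 1 := by linarith [le_abs_self M0]
  have hss : Icc x1 x2 ×ˢ Icc t1 t2 ⊆ domLat xi1 xi2 T := fun q hq => hsub q.1 hq.1 q.2 hq.2
  have hsc : Icc x1 x2 ×ˢ Icc t1 t2 ⊆ domCl xi1 xi2 T := fun q hq =>
    ⟨Ioc_subset_Icc_self (hss hq).1, (hss hq).2⟩
  refine ⟨|M0| + 1, hsol.cont.mono hsc, hsol.cont_x.mono hss, hsol.cont_xx.mono hss, hsol.cont_t.mono hss,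
    fun x hx t ht => (hsol.diff_x (x, t) (hsub x hx t ht)).hasDerivAt,
    fun x hx t ht => (hsol.diff_xx (x, t) (hsub x hx t ht)).hasDerivAt,
    fun x hx t ht => (hsol.diff_t (x, t) (hsub x hx t ht)).hasDerivAt,
    fun x hx t ht => (hM0 (x, t) (hsub x hx t ht)).2.1.hasDerivAt,
    fun t ht x hx => (hM0 (x, t) (hsub x hx t ht)).2.2.1.continuousAt.continuousWithinAt,
    fun x hx t ht t' ht' => ?_, by linarith [abs_nonneg M0], fun x hx t ht => ?_, fun x hx t ht => ?_⟩
  · have := (convex_Icc t1 t2).norm_image_sub_le_of_norm_hasDerivWithin_le (f := fun r => a x r)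
      (f' := fun r => pdt a x r) (C := |M0| + 1)
      (fun r hr => (hM0 (x, r) (hsub x hx r hr)).2.2.2.1.hasDerivAt.hasDerivWithinAt)
      (fun r hr => ((hM0 (x, r) (hsub x hx r hr)).2.2.2.2.2.2.2.2.1).trans hle) ht' ht
    simpa only [Real.norm_eq_abs] using this
  · obtain ⟨g0, -, -, -, -, -, g1, g2, -, g3, -⟩ := hM0 (x, t) (hsub x hx t ht)
    simp only at g0 g1 g2 g3
    refine ⟨?_, (le_abs_self _).trans (g1.trans hle), g3.trans hle⟩
    rw [abs_of_pos (inv_pos.2 g0)] at g2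
    rw [one_div]
    exact inv_le_of_inv_le₀ g0 (g2.trans hle)
  · obtain ⟨-, -, -, -, -, -, -, -, -, -, -, gb, -, -, gc⟩ := hM0 (x, t) (hsub x hx t ht)
    have e := hsol.eqn (x, t) (hsub x hx t ht)
    simp only at e gb gc
    have e2 : pdt u x t - a x t * pdxx u x t = b x t * pdx u x t + c x t * u x t := by rw [e]; ring
    rw [e2]
    refine (abs_add_le _ _).trans ?_
    rw [abs_mul, abs_mul, mul_add]
    exact add_le_add (mul_le_mul_of_nonneg_right (gb.trans hle) (abs_nonneg _))
      (mul_le_mul_of_nonneg_right (gc.trans hle) (abs_nonneg _))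

/-- Lemma 2.1 (N-moment case): in the one-boundary setting, near an N-moment `s` of
`w₁(t) = u(ξ₁(t),t)` the conclusions of Theorem A hold: on some interval
`(s-ε, s+ε)`, `Z(t)` is finite, non-increasing, and drops strictly across any time at
which `u(·,·)` has a multiple zero. -/
theorem one_boundary_N_moment
    (T X : ℝ) (xi1 : ℝ → ℝ) (a b c u : ℝ → ℝ → ℝ)
    (hT : 0 < T)
    (hxc : ContinuousOn xi1 (Icc 0 T)) (hxlt : ∀ t ∈ Icc (0:ℝ) T, xi1 t < X)
    (hsol : IsClassicalSolution a b c xi1 (fun _ => X) T u)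
    (hreg : Reg12 a b c xi1 (fun _ => X) T)
    (hX : ∀ t ∈ Icc (0:ℝ) T, u X t ≠ 0)
    (s : ℝ) (hs : s ∈ Ioo (0:ℝ) T) (hNs : u (xi1 s) s ≠ 0) :
    ∃ ε > 0, Ioo (s - ε) (s + ε) ⊆ Ioo (0:ℝ) T ∧
      (∀ t ∈ Ioo (s - ε) (s + ε), Znum u xi1 (fun _ => X) t < ⊤) ∧
      (∀ t₁ ∈ Ioo (s - ε) (s + ε), ∀ t₂ ∈ Ioo (s - ε) (s + ε), t₁ ≤ t₂ →
        Znum u xi1 (fun _ => X) t₂ ≤ Znum u xi1 (fun _ => X) t₁) ∧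
      (∀ τ ∈ Ioo (s - ε) (s + ε), HasMultipleZero u xi1 (fun _ => X) τ →
        ∀ t₁ t₂ : ℝ, s - ε < t₁ → t₁ < τ → τ < t₂ → t₂ < s + ε →
          Znum u xi1 (fun _ => X) t₂ < Znum u xi1 (fun _ => X) t₁) := by
  have hs' : s ∈ Icc (0 : ℝ) T := Ioo_subset_Icc_self hs
  have hmem : (xi1 s, s) ∈ domCl xi1 (fun _ => X) T := ⟨hs', le_refl _, (hxlt s hs').le⟩
  have hev := (hsol.cont (xi1 s, s) hmem).eventually_ne hNs
  obtain ⟨r0, hr0, hb⟩ := Metric.mem_nhdsWithin_iff.1 hev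
  obtain ⟨r, hr, hrlt⟩ := exists_between (show 0 < min r0 (X - xi1 s) from
    lt_min hr0 (by linarith [hxlt s hs']))
  have r1 := hrlt.trans_le (min_le_left _ _)
  have r2 := hrlt.trans_le (min_le_right _ _)
  have hxs : ContinuousAt xi1 s := hxc.continuousAt (Icc_mem_nhds hs.1 hs.2)
  obtain ⟨d, hd, hdb⟩ := Metric.continuousAt_iff.1 hxs (r / 2) (by linarith)
  obtain ⟨ε, hε, hεlt⟩ := exists_between (show 0 < min (min d r) (min s (T - s)) from
    lt_min (lt_min hd hr) (lt_min hs.1 (by linarith [hs.2])))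
  have q1 : ε < d := hεlt.trans_le ((min_le_left _ _).trans (min_le_left _ _))
  have q2 : ε < r := hεlt.trans_le ((min_le_left _ _).trans (min_le_right _ _))
  have q3 : ε < s := hεlt.trans_le ((min_le_right _ _).trans (min_le_left _ _))
  have q4 : ε < T - s := hεlt.trans_le ((min_le_right _ _).trans (min_le_right _ _))
  have ht0 : ∀ t ∈ Icc (s - ε) (s + ε), t ∈ Ioo (0 : ℝ) T := fun t ht =>
    ⟨by linarith [ht.1], by linarith [ht.2]⟩
  have hxi : ∀ t ∈ Icc (s - ε) (s + ε), |xi1 t - xi1 s| < r / 2 := by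
    intro t ht
    have := @hdb t (by rw [Real.dist_eq, abs_lt]; constructor <;> linarith [ht.1, ht.2])
    rwa [Real.dist_eq] at this
  have hnz : ∀ t ∈ Icc (s - ε) (s + ε), ∀ x, xi1 t ≤ x → x ≤ xi1 s + r / 2 → u x t ≠ 0 := by
    intro t ht x h1 h2
    have h3 := abs_lt.1 (hxi t ht)
    have hm : (x, t) ∈ domCl xi1 (fun _ => X) T :=
      ⟨Ioo_subset_Icc_self (ht0 t ht), h1, by simp only; linarith⟩
    refine hb (a := (x, t)) ⟨?_, hm⟩
    rw [Metric.mem_ball, Prod.dist_eq]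
    refine max_lt ?_ ?_
    · rw [Real.dist_eq, abs_lt]; constructor <;> simp only <;> linarith [h3.1, h3.2]
    · rw [Real.dist_eq, abs_lt]; constructor <;> simp only <;> linarith [ht.1, ht.2]
  have hsub : ∀ x ∈ Icc (xi1 s + r / 2) X, ∀ t ∈ Icc (s - ε) (s + ε), (x, t) ∈ domLat xi1 (fun _ => X) T := by
    intro x hx t ht
    have h3 := abs_lt.1 (hxi t ht)
    exact ⟨Ioo_subset_Ioc_self (ht0 t ht), by simp only; linarith [hx.1, h3.2], hx.2⟩
  obtain ⟨M, h⟩ := reg_rsol hsol hreg hsub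
  have hl : ∀ t ∈ Icc (s - ε) (s + ε), u (xi1 s + r / 2) t ≠ 0 ∧ u X t ≠ 0 := by
    intro t ht
    have h3 := abs_lt.1 (hxi t ht)
    exact ⟨hnz t ht _ (by linarith [h3.2]) le_rfl, hX t (Ioo_subset_Icc_self (ht0 t ht))⟩
  have hZ : ∀ t ∈ Icc (s - ε) (s + ε), zeroSet u xi1 (fun _ => X) t =
      {x | x ∈ Icc (xi1 s + r / 2) X ∧ u x t = 0} := by
    intro t ht
    have h3 := abs_lt.1 (hxi t ht)
    ext x
    constructor
    · rintro ⟨⟨g1, g2⟩, g3⟩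
      refine ⟨⟨?_, g2⟩, g3⟩
      by_contra hc
      push Not at hc
      exact hnz t ht x g1 hc.le g3
    · rintro ⟨⟨g1, g2⟩, g3⟩
      exact ⟨⟨by linarith [h3.2], g2⟩, g3⟩
  have hN : ∀ t ∈ Icc (s - ε) (s + ε), Znum u xi1 (fun _ => X) t =
      {x | x ∈ Icc (xi1 s + r / 2) X ∧ u x t = 0}.encard := by
    intro t ht
    rw [Znum, hZ t ht]
  have hanti := anti_local (f := Znum u xi1 (fun _ => X)) (a := s - ε) (b := s + ε) (by
    intro τ hτ
    obtain ⟨δ, hδ, g1, g2, -⟩ := h.loc hl (Ioo_subset_Ioc_self hτ)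
    refine ⟨δ, hδ, fun t ht ht1 => ?_, fun t ht ht2 => ?_⟩
    · rw [hN τ (Ioo_subset_Icc_self hτ), hN t ⟨ht1.le, by linarith [ht.2, hτ.2]⟩]
      exact g1 t ht ht1
    · rw [hN τ (Ioo_subset_Icc_self hτ), hN t ⟨by linarith [ht.1, hτ.1], ht2.le⟩]
      exact g2 t ht ht2.le)
  refine ⟨ε, hε, fun t ht => ht0 t (Ioo_subset_Icc_self ht), fun t ht => ?_, hanti, ?_⟩
  · have ht' := Ioo_subset_Icc_self ht
    rw [hN t ht', encard_lt_top_iff]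
    exact h.fin (Ioo_subset_Ioc_self ht) (hl t ht').1 (hl t ht').2
  · rintro τ hτ ⟨z, hz, hz0, hz1⟩ p q hp1 hp2 hq1 hq2
    have hτ' := Ioo_subset_Icc_self hτ
    obtain ⟨δ, hδ, -, -, g3⟩ := h.loc hl (Ioo_subset_Ioc_self hτ)
    have hzm : z ∈ {x | x ∈ Icc (xi1 s + r / 2) X ∧ u x τ = 0} := by
      rw [← hZ τ hτ']; exact ⟨hz, hz0⟩
    obtain ⟨t, ht, ht1, hlt⟩ := g3 ⟨z, hzm.1, hz0, hz1⟩ (τ - p) (by linarith)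
    have htm : t ∈ Ioo (s - ε) (s + ε) := ⟨ht1, by linarith [ht.2, hτ.2]⟩
    rw [← hN τ hτ', ← hN t (Ioo_subset_Icc_self htm)] at hlt
    exact (hanti τ hτ q ⟨by linarith, hq2⟩ hq1.le).trans_lt
      (hlt.trans_le (hanti p ⟨hp1, by linarith [hτ.2]⟩ t htm (by linarith [ht.1])))
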